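/- Let n ≥ 4 be an integer, let p be a real number with 2n/(n−1) ≤ p < n, and let α be a real number with 0 < α < 1. Set q = α(p−1)+1, δ = np − (n−p)q, θ = n(1−α)/((αp+1−α)(n−α(n−p))), and GN(n,p,α) = ((p−q)/(p√π))^θ (pq/(n(p−q)))^{θ/p} (pq/δ)^{(1−θ)/(αp)} ( Γ(((p−1)/p)(δ/(p−q)) + 1) Γ(n/2+1) / ( Γ(q(p−1)/(p−q) + 1) Γ(n(p−1)/p + 1) ) )^{θ/n}. Then for every smooth function u : ℝⁿ → ℝ with compact support contained in the open unit ball Bⁿ, writing dV = (2/(1−|x|²))ⁿ dx, one has ( ∫_{Bⁿ} |u|^{α(p−1)+1} dV )^{1/(α(p−1)+1)} ≤ GN(n,p,α) ( ∫_{Bⁿ} ((1−|x|²)/2)^p |∇u|^p dV − ((n−1)/p)^p ∫_{Bⁿ} |u|^p dV )^{θ/p} ( ∫_{Bⁿ} |u|^{αp} dV )^{(1−θ)/(αp)}. -/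

import Mathlib

open Real MeasureTheory

/-- The exponent `θ` in the Gagliardo–Nirenberg inequality for `0 < α < 1`. -/
noncomputable def thetaGN' (n : ℕ) (p α : ℝ) : ℝ :=
  (n : ℝ) * (1 - α) / ((α * p + 1 - α) * ((n : ℝ) - α * ((n : ℝ) - p)))

/-- The sharp constant `GN(n,p,α)` of Del Pino and Dolbeault, case `0 < α < 1`. -/
noncomputable def gagliardoNirenbergConst' (n : ℕ) (p α : ℝ) : ℝ :=
  let q : ℝ := α * (p - 1) + 1
  let δ : ℝ := (n : ℝ) * p - ((n : ℝ) - p) * q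
  let θ : ℝ := thetaGN' n p α
  ((p - q) / (p * Real.sqrt π)) ^ θ * (p * q / ((n : ℝ) * (p - q))) ^ (θ / p) *
    (p * q / δ) ^ ((1 - θ) / (α * p)) *
    ((Real.Gamma ((p - 1) / p * (δ / (p - q)) + 1) * Real.Gamma ((n : ℝ) / 2 + 1)) /
      (Real.Gamma (q * (p - 1) / (p - q) + 1) * Real.Gamma ((n : ℝ) * (p - 1) / p + 1))) ^
      (θ / (n : ℝ))

open Set Filter Topology Metric Module EuclideanGeometry
open scoped ENNReal

section Ball

variable {E : Type*} [NormedAddCommGroup E]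

/-- Points of the Poincaré ball at hyperbolic distance less than `2 * arsinh η`. -/
def HypNear (η : ℝ) (x y : E) : Prop :=
  ‖x - y‖ ^ 2 < η ^ 2 * ((1 - ‖x‖ ^ 2) * (1 - ‖y‖ ^ 2))

/-- The hyperbolic neighbourhood of a subset of the unit ball. -/
def hypThickening (η : ℝ) (A : Set E) : Set E :=
  {z ∈ ball (0 : E) 1 | ∃ w ∈ A, HypNear η z w}

lemma one_sub_norm_sq_pos {x : E} (hx : x ∈ ball (0 : E) 1) : 0 < 1 - ‖x‖ ^ 2 := by
  have h : ‖x‖ < 1 := by simpa using hx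
  nlinarith [norm_nonneg x]

lemma mem_ball_of_one_sub_norm_sq_pos {x : E} (h : 0 < 1 - ‖x‖ ^ 2) : x ∈ ball (0 : E) 1 := by
  have : ‖x‖ < 1 := by nlinarith [norm_nonneg x]
  simpa using this

lemma isOpen_setOf_hypNear (η : ℝ) : IsOpen {q : E × E | HypNear η q.1 q.2} := by
  unfold HypNear
  exact isOpen_lt (by fun_prop) (by fun_prop)

lemma isOpen_hypThickening (η : ℝ) (A : Set E) : IsOpen (hypThickening η A) := by
  have : hypThickening η A = ball (0 : E) 1 ∩ ⋃ w ∈ A, {z | HypNear η z w} := by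
    ext z; simp [hypThickening]
  rw [this]
  refine isOpen_ball.inter (isOpen_biUnion fun w _ => ?_)
  exact (isOpen_setOf_hypNear η).preimage (f := fun z : E => (z, w)) (by fun_prop)

lemma hypThickening_mono {η : ℝ} {A B : Set E} (h : A ⊆ B) :
    hypThickening η A ⊆ hypThickening η B := fun _ hz =>
  ⟨hz.1, hz.2.imp fun _ hw => ⟨h hw.1, hw.2⟩⟩

lemma subset_hypThickening {η : ℝ} (hη : 0 < η) {A : Set E} (hA : A ⊆ ball 0 1) :
    A ⊆ hypThickening η A := fun x hx => by
  refine ⟨hA hx, x, hx, ?_⟩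
  have := one_sub_norm_sq_pos (hA hx)
  simp only [HypNear, sub_self, norm_zero]
  rw [zero_pow two_ne_zero]
  positivity

/-- Data of a hyperbolic reflection of the Poincaré ball: the inversion in the sphere with
centre `c` and radius `R`, orthogonal to the unit sphere. -/
structure IsBallInversion (c : E) (R : ℝ) : Prop where
  pos : 0 < R
  norm_sq : ‖c‖ ^ 2 = 1 + R ^ 2

namespace IsBallInversion

variable {c : E} {R : ℝ}

lemma ne_center (h : IsBallInversion c R) {x : E} (hx : x ∈ ball (0 : E) 1) : x ≠ c := by
  rintro rfl
  nlinarith [one_sub_norm_sq_pos hx, h.norm_sq, h.pos]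

lemma dist_pos (h : IsBallInversion c R) {x : E} (hx : x ∈ ball (0 : E) 1) : 0 < dist x c :=
  _root_.dist_pos.2 (h.ne_center hx)

variable [InnerProductSpace ℝ E]

lemma one_sub_norm_sq_inversion (h : IsBallInversion c R) {x : E} (hx : x ≠ c) :
    1 - ‖inversion c R x‖ ^ 2 = (R / dist x c) ^ 2 * (1 - ‖x‖ ^ 2) := by
  obtain ⟨y, rfl⟩ : ∃ y, x = y + c := ⟨x - c, by simp⟩
  have hy : ‖y‖ ≠ 0 := by simpa using hx
  have hR := h.pos
  simp only [inversion, vsub_eq_sub, vadd_eq_add, add_sub_cancel_right, dist_eq_norm,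
    norm_add_sq_real, norm_smul, inner_smul_left, h.norm_sq]
  simp only [norm_div, norm_pow, norm_norm, Real.norm_of_nonneg hR.le, conj_trivial]
  field_simp
  ring

lemma inversion_mem_ball (h : IsBallInversion c R) {x : E} (hx : x ∈ ball (0 : E) 1) :
    inversion c R x ∈ ball (0 : E) 1 := by
  apply mem_ball_of_one_sub_norm_sq_pos
  rw [h.one_sub_norm_sq_inversion (h.ne_center hx)]
  have := one_sub_norm_sq_pos hx
  have := h.dist_pos hx
  have := h.pos
  positivity

lemma involutive (h : IsBallInversion c R) : Function.Involutive (inversion c R) :=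
  inversion_involutive c h.pos.ne'

lemma inversion_mem_ball_iff (h : IsBallInversion c R) {x : E} :
    inversion c R x ∈ ball (0 : E) 1 ↔ x ∈ ball (0 : E) 1 :=
  ⟨fun hx => by simpa [h.involutive x] using h.inversion_mem_ball hx, h.inversion_mem_ball⟩

lemma hypNear_inversion (h : IsBallInversion c R) {η : ℝ} {x y : E} (hx : x ∈ ball (0 : E) 1)
    (hy : y ∈ ball (0 : E) 1) :
    HypNear η (inversion c R x) (inversion c R y) ↔ HypNear η x y := by
  have hx' := h.dist_pos hx
  have hy' := h.dist_pos hy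
  have hR := h.pos
  unfold HypNear
  rw [h.one_sub_norm_sq_inversion (h.ne_center hx), h.one_sub_norm_sq_inversion (h.ne_center hy),
    ← dist_eq_norm, ← dist_eq_norm, dist_inversion_inversion (h.ne_center hx) (h.ne_center hy)]
  have : 0 < (R ^ 2 / (dist x c * dist y c)) ^ 2 := by positivity
  rw [show (R ^ 2 / (dist x c * dist y c) * dist x y) ^ 2 =
      (R ^ 2 / (dist x c * dist y c)) ^ 2 * dist x y ^ 2 by ring,
    show η ^ 2 * ((R / dist x c) ^ 2 * (1 - ‖x‖ ^ 2) * ((R / dist y c) ^ 2 * (1 - ‖y‖ ^ 2))) =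
      (R ^ 2 / (dist x c * dist y c)) ^ 2 * (η ^ 2 * ((1 - ‖x‖ ^ 2) * (1 - ‖y‖ ^ 2))) by ring]
  exact mul_lt_mul_iff_right₀ this

/-- If `a` and `b` lie on the same side of the mirror, reflecting `b` increases the distance. -/
lemma hypNear_of_hypNear_inversion (h : IsBallInversion c R) {η : ℝ} {a b : E}
    (ha : a ∈ ball (0 : E) 1) (hb : b ∈ ball (0 : E) 1)
    (hab : 0 ≤ (dist a c ^ 2 - R ^ 2) * (dist b c ^ 2 - R ^ 2))
    (hn : HypNear η a (inversion c R b)) : HypNear η a b := by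
  have hR := h.pos
  have hb' := h.dist_pos hb
  unfold HypNear at *
  rw [h.one_sub_norm_sq_inversion (h.ne_center hb)] at hn
  obtain ⟨x, rfl⟩ : ∃ x, a = x + c := ⟨a - c, by simp⟩
  obtain ⟨y, rfl⟩ : ∃ y, b = y + c := ⟨b - c, by simp⟩
  have e1 : inversion c R (y + c) = (R / ‖y‖) ^ 2 • y + c := by
    simp [inversion, dist_eq_norm]
  rw [e1] at hn
  simp only [dist_eq_norm, add_sub_add_right_eq_sub, add_sub_cancel_right] at *
  have e2 : ‖x - (R / ‖y‖) ^ 2 • y‖ ^ 2 =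
      (R / ‖y‖) ^ 2 * (‖x - y‖ ^ 2 + (‖x‖ ^ 2 - R ^ 2) * (‖y‖ ^ 2 - R ^ 2) / R ^ 2) := by
    rw [norm_sub_sq_real, norm_sub_sq_real, norm_smul, inner_smul_right]
    simp only [norm_div, norm_pow, norm_norm, Real.norm_of_nonneg hR.le]
    field_simp
    ring
  rw [e2] at hn
  have hk : 0 < (R / ‖y‖) ^ 2 := by positivity
  have e3 : 0 ≤ (‖x‖ ^ 2 - R ^ 2) * (‖y‖ ^ 2 - R ^ 2) / R ^ 2 := by positivity
  have : (R / ‖y‖) ^ 2 * (‖x - y‖ ^ 2 + (‖x‖ ^ 2 - R ^ 2) * (‖y‖ ^ 2 - R ^ 2) / R ^ 2) <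
      (R / ‖y‖) ^ 2 * (η ^ 2 * ((1 - ‖x + c‖ ^ 2) * (1 - ‖y + c‖ ^ 2))) := by
    refine hn.trans_eq (by ring)
  have := lt_of_mul_lt_mul_left this hk.le
  linarith

end IsBallInversion

variable [InnerProductSpace ℝ E]

/-- Two points of the ball at different distances from the origin are exchanged by a
hyperbolic reflection, with the origin on the side of the closer one. -/
lemma exists_isBallInversion {x y : E} (hy : y ∈ ball (0 : E) 1) (hxy : ‖x‖ < ‖y‖) :
    ∃ (c : E) (R : ℝ), IsBallInversion c R ∧ inversion c R y = x ∧ dist y c < R := by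
  have hy1 := one_sub_norm_sq_pos hy
  have hD : 0 < ‖y‖ ^ 2 - ‖x‖ ^ 2 := by nlinarith [norm_nonneg x]
  have hx1 : 0 < 1 - ‖x‖ ^ 2 := by linarith
  have hne : 0 < ‖x - y‖ := by
    rw [norm_pos_iff, sub_ne_zero]; rintro rfl; exact lt_irrefl _ hxy
  set D := ‖y‖ ^ 2 - ‖x‖ ^ 2 with hDdef
  set c : E := D⁻¹ • ((1 - ‖x‖ ^ 2) • y - (1 - ‖y‖ ^ 2) • x) with hc
  set R : ℝ := √((1 - ‖x‖ ^ 2) * (1 - ‖y‖ ^ 2)) * ‖x - y‖ / D with hRdef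
  have hRpos : 0 < R := by positivity
  have hR2 : R ^ 2 = (1 - ‖x‖ ^ 2) * (1 - ‖y‖ ^ 2) * ‖x - y‖ ^ 2 / D ^ 2 := by
    rw [hRdef, div_pow, mul_pow, Real.sq_sqrt (by positivity)]
  have hyc : y - c = ((1 - ‖y‖ ^ 2) / D) • (x - y) := by
    have : y = D⁻¹ • (D • y) := by rw [smul_smul, inv_mul_cancel₀ hD.ne', one_smul]
    rw [hc]
    nth_rewrite 1 [this]
    rw [← smul_sub, div_eq_inv_mul, mul_smul]
    congr 1
    rw [hDdef]
    module
  have hxc : x - c = ((1 - ‖x‖ ^ 2) / D) • (x - y) := by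
    have : x = D⁻¹ • (D • x) := by rw [smul_smul, inv_mul_cancel₀ hD.ne', one_smul]
    rw [hc]
    nth_rewrite 1 [this]
    rw [← smul_sub, div_eq_inv_mul, mul_smul]
    congr 1
    rw [hDdef]
    module
  have hdist : dist y c = (1 - ‖y‖ ^ 2) / D * ‖x - y‖ := by
    rw [dist_eq_norm, hyc, norm_smul, Real.norm_of_nonneg (by positivity)]
  refine ⟨c, R, ⟨hRpos, ?_⟩, ?_, ?_⟩
  · rw [hR2, hc, norm_smul, mul_pow, norm_sub_sq_real, norm_sub_sq_real, norm_smul, norm_smul,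
      inner_smul_left, inner_smul_right, Real.norm_of_nonneg hx1.le, Real.norm_of_nonneg hy1.le,
      norm_inv, Real.norm_of_nonneg hD.le, real_inner_comm]
    simp only [conj_trivial]
    field_simp
    rw [hDdef]
    ring
  · rw [inversion, vsub_eq_sub, vadd_eq_add, hyc, smul_smul, ← sub_eq_zero, add_sub_assoc,
      ← neg_sub x c, hxc, hdist, ← sub_eq_add_neg, ← sub_smul, div_pow, hR2]
    have : (1 - ‖x‖ ^ 2) * (1 - ‖y‖ ^ 2) * ‖x - y‖ ^ 2 / D ^ 2 / ((1 - ‖y‖ ^ 2) / D * ‖x - y‖) ^ 2 *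
      ((1 - ‖y‖ ^ 2) / D) - (1 - ‖x‖ ^ 2) / D = 0 := by
      field_simp
      simp
    rw [this, zero_smul]
  · rw [← abs_of_pos hRpos, ← abs_of_nonneg (dist_nonneg (x := y) (y := c)), ← sq_lt_sq, hR2, hdist]
    rw [mul_pow, div_pow, div_mul_eq_mul_div]
    gcongr
    rw [sq]
    gcongr

end Ball

section Polarization

variable {E : Type*} [NormedAddCommGroup E]

lemma HypNear.symm {η : ℝ} {x y : E} (h : HypNear η x y) : HypNear η y x := by
  unfold HypNear at *
  rwa [norm_sub_rev, mul_comm (1 - ‖y‖ ^ 2)]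

variable [InnerProductSpace ℝ E]

/-- Two-point symmetrization of `K` with respect to the sphere with centre `c` and radius `R`,
towards the exterior of the sphere. -/
def polarize (c : E) (R : ℝ) (K : Set E) : Set E :=
  {z | (R ≤ dist z c ∧ (z ∈ K ∨ inversion c R z ∈ K)) ∨ (z ∈ K ∧ inversion c R z ∈ K)}

/-- The points gained by polarizing `K`. -/
def polarizeGain (c : E) (R : ℝ) (K : Set E) : Set E :=
  {z | R ≤ dist z c ∧ z ∉ K ∧ inversion c R z ∈ K}

namespace IsBallInversion

variable {c : E} {R : ℝ}

lemma inversion_eq_self_of_le (h : IsBallInversion c R)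
    {z : E} (hz : z ∈ ball (0 : E) 1) (h1 : R ≤ dist z c)
    (h2 : R ≤ dist (inversion c R z) c) : inversion c R z = z := by
  have hp := h.dist_pos hz
  have hR := h.pos
  rw [dist_inversion_center, le_div_iff₀ hp] at h2
  apply inversion_of_mem_sphere
  rw [Metric.mem_sphere]
  nlinarith

lemma le_dist_inversion (h : IsBallInversion c R)
    {z : E} (hz : z ∈ ball (0 : E) 1) (h1 : dist z c ≤ R) :
    R ≤ dist (inversion c R z) c := by
  have hp := h.dist_pos hz
  have hR := h.pos
  rw [dist_inversion_center, le_div_iff₀ hp]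
  nlinarith

lemma dist_inversion_le (h : IsBallInversion c R)
    {z : E} (hz : z ∈ ball (0 : E) 1) (h1 : R ≤ dist z c) :
    dist (inversion c R z) c ≤ R := by
  have hp := h.dist_pos hz
  have hR := h.pos
  rw [dist_inversion_center, div_le_iff₀ hp]
  nlinarith

lemma hypNear_same_side (h : IsBallInversion c R)
    {η : ℝ} {a b : E} (ha : a ∈ ball (0 : E) 1) (hb : b ∈ ball (0 : E) 1)
    (hac : R ≤ dist a c) (hbc : dist b c ≤ R) (hn : HypNear η a b) :
    HypNear η a (inversion c R b) := by
  have hR := h.pos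
  refine h.hypNear_of_hypNear_inversion ha (h.inversion_mem_ball hb) ?_ ?_
  · have h2 := h.le_dist_inversion hb hbc
    apply mul_nonneg <;> nlinarith
  · rwa [h.involutive b]

lemma polarize_subset_ball (h : IsBallInversion c R)
    {K : Set E} (hK : K ⊆ ball 0 1) : polarize c R K ⊆ ball 0 1 := by
  rintro z (⟨-, hz | hz⟩ | ⟨hz, -⟩)
  · exact hK hz
  · exact h.inversion_mem_ball_iff.1 (hK hz)
  · exact hK hz

lemma hypThickening_polarize_subset (h : IsBallInversion c R)
    {η : ℝ} {K : Set E} (hK : K ⊆ ball 0 1) :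
    hypThickening η (polarize c R K) ⊆ polarize c R (hypThickening η K) := by
  rintro z ⟨hz, w, hw, hzw⟩
  have hwb := h.polarize_subset_ball hK hw
  have hσz := h.inversion_mem_ball hz
  have hσσ : ∀ x, inversion c R (inversion c R x) = x := h.involutive
  have key : ∀ {a b : E}, a ∈ ball (0 : E) 1 → b ∈ K → HypNear η a b → a ∈ hypThickening η K :=
    fun ha hb hab => ⟨ha, _, hb, hab⟩
  have hinv : ∀ {a b : E}, a ∈ ball (0 : E) 1 → b ∈ ball (0 : E) 1 → HypNear η a b →
      HypNear η (inversion c R a) (inversion c R b) :=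
    fun ha hb hab => (h.hypNear_inversion ha hb).2 hab
  by_cases hzc : R ≤ dist z c
  · refine Or.inl ⟨hzc, ?_⟩
    have : w ∈ K ∨ inversion c R w ∈ K := by
      rcases hw with ⟨-, hw⟩ | ⟨hw, -⟩
      · exact hw
      · exact Or.inl hw
    rcases this with hw' | hw'
    · exact Or.inl (key hz hw' hzw)
    · exact Or.inr (key hσz hw' (hinv hz hwb hzw))
  · push Not at hzc
    refine Or.inr ?_
    rcases hw with ⟨hwc, hw⟩ | ⟨hw1, hw2⟩
    · have h1 : HypNear η (inversion c R z) w :=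
        (h.hypNear_same_side hwb hz hwc hzc.le hzw.symm).symm
      have h2 : HypNear η z (inversion c R w) := by
        simpa [hσσ] using hinv hσz hwb h1
      rcases hw with hw | hw
      · exact ⟨key hz hw hzw, key hσz hw h1⟩
      · exact ⟨key hz hw h2, key hσz hw (hinv hz hwb hzw)⟩
    · exact ⟨key hz hw1 hzw, key hσz hw2 (hinv hz hwb hzw)⟩

lemma isCompact_polarize (h : IsBallInversion c R)
    {K : Set E} (hK : IsCompact K) (hKb : K ⊆ ball 0 1) :
    IsCompact (polarize c R K) := by
  have hσ : IsCompact (inversion c R ⁻¹' K) := by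
    rw [← h.involutive.image_eq_preimage_symm]
    refine hK.image_of_continuousOn ?_
    refine ContinuousOn.inversion continuousOn_const continuousOn_const continuousOn_id ?_
    exact fun x hx => h.ne_center (hKb hx)
  have hH : IsClosed {z : E | R ≤ dist z c} := isClosed_le (by fun_prop) (by fun_prop)
  have : polarize c R K = ({z : E | R ≤ dist z c} ∩ (K ∪ inversion c R ⁻¹' K)) ∪
      (K ∩ inversion c R ⁻¹' K) := rfl
  rw [this]
  exact ((hK.union hσ).inter_left hH).union (hK.inter hσ)

end IsBallInversion

end Polarization

section Volume

variable {E : Type*} [NormedAddCommGroup E] [InnerProductSpace ℝ E]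
  [MeasurableSpace E] [BorelSpace E]

lemma measurable_hypDensity :
    Measurable fun x : E => ENNReal.ofReal ((2 / (1 - ‖x‖ ^ 2)) ^ finrank ℝ E) := by
  fun_prop

variable [FiniteDimensional ℝ E]

/-- The hyperbolic volume on the Poincaré ball. -/
noncomputable def hypVol : Measure E :=
  (volume.restrict (ball 0 1)).withDensity
    fun x => ENNReal.ofReal ((2 / (1 - ‖x‖ ^ 2)) ^ finrank ℝ E)

lemma hypVol_apply {A : Set E} (hA : MeasurableSet A) :
    hypVol A = ∫⁻ x in A ∩ ball 0 1, ENNReal.ofReal ((2 / (1 - ‖x‖ ^ 2)) ^ finrank ℝ E) := by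
  rw [hypVol, withDensity_apply _ hA, Measure.restrict_restrict hA]

lemma hypVol_closedBall_lt_top {r : ℝ} (hr : r < 1) :
    hypVol (closedBall (0 : E) r) < ∞ := by
  rw [hypVol_apply measurableSet_closedBall]
  have hsub : closedBall (0 : E) r ∩ ball 0 1 ⊆ closedBall 0 r := inter_subset_left
  refine (lintegral_mono_set hsub).trans_lt ?_
  have : ∫⁻ x in closedBall (0 : E) r, ENNReal.ofReal ((2 / (1 - ‖x‖ ^ 2)) ^ finrank ℝ E) ≤
      ∫⁻ x in closedBall (0 : E) r, ENNReal.ofReal ((2 / (1 - r ^ 2)) ^ finrank ℝ E) := by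
    refine setLIntegral_mono' measurableSet_closedBall fun x hx => ?_
    have hx : ‖x‖ ≤ r := by simpa using hx
    have := norm_nonneg x
    have : 0 < 1 - r ^ 2 := by nlinarith
    have : 0 < 1 - ‖x‖ ^ 2 := by nlinarith
    gcongr
  refine this.trans_lt ?_
  rw [setLIntegral_const]
  exact ENNReal.mul_lt_top ENNReal.ofReal_lt_top measure_closedBall_lt_top

lemma hypVol_lt_top_of_isCompact {K : Set E} (hK : IsCompact K) (hKb : K ⊆ ball 0 1) :
    hypVol K < ∞ := by
  obtain ⟨r, hr, hKr⟩ := exists_pos_lt_subset_ball one_pos hK.isClosed hKb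
  exact (measure_mono (hKr.trans ball_subset_closedBall)).trans_lt (hypVol_closedBall_lt_top hr.2)

end Volume

section VolumePolarization

variable {E : Type*} [NormedAddCommGroup E] [InnerProductSpace ℝ E] [FiniteDimensional ℝ E]
  [MeasurableSpace E] [BorelSpace E]

lemma volume_pos_of_isOpen {U : Set E} (hU : IsOpen U) (hne : (U ∩ ball 0 1).Nonempty) :
    0 < hypVol U := by
  rw [hypVol_apply hU.measurableSet, setLIntegral_pos_iff measurable_hypDensity]
  have : Function.support (fun x : E => ENNReal.ofReal ((2 / (1 - ‖x‖ ^ 2)) ^ finrank ℝ E)) ∩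
      (U ∩ ball 0 1) = U ∩ ball 0 1 := by
    refine inter_eq_right.2 fun x hx => ?_
    have := one_sub_norm_sq_pos hx.2
    have : 0 < (2 / (1 - ‖x‖ ^ 2)) ^ finrank ℝ E := by positivity
    simpa using this
  rw [this]
  exact (hU.inter isOpen_ball).measure_pos volume hne

lemma hypVol_sphere (hE : 0 < finrank ℝ E) (r : ℝ) : hypVol (sphere (0 : E) r) = 0 := by
  have : Nontrivial E := nontrivial_of_finrank_pos hE
  rw [hypVol_apply isClosed_sphere.measurableSet]
  refine setLIntegral_measure_zero _ _ (measure_mono_null inter_subset_left ?_)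
  exact Measure.addHaar_sphere _ _ _

lemma measurable_inversion (c : E) (R : ℝ) : Measurable (inversion c R) := by
  unfold inversion
  simp only [vsub_eq_sub, vadd_eq_add]
  fun_prop

lemma measurableSet_polarizeGain (c : E) (R : ℝ) {K : Set E} (hK : MeasurableSet K) :
    MeasurableSet (polarizeGain c R K) := by
  have : polarizeGain c R K = {z | R ≤ dist z c} ∩ (Kᶜ ∩ inversion c R ⁻¹' K) := rfl
  rw [this]
  exact (measurableSet_le (by fun_prop) (by fun_prop)).inter
    (hK.compl.inter (measurable_inversion c R hK))

namespace IsBallInversion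

variable {c : E} {R : ℝ}

/-- Hyperbolic reflections preserve the hyperbolic volume. -/
lemma hypVol_preimage (h : IsBallInversion c R) {A : Set E} (hA : MeasurableSet A) :
    hypVol (inversion c R ⁻¹' A) = hypVol A := by
  rw [hypVol_apply (measurable_inversion c R hA), hypVol_apply hA]
  have himg : A ∩ ball 0 1 = inversion c R '' (inversion c R ⁻¹' A ∩ ball 0 1) := by
    rw [h.involutive.image_eq_preimage_symm]
    ext x
    simp only [mem_inter_iff, mem_preimage, h.involutive x, h.inversion_mem_ball_iff]
  have hS : MeasurableSet (inversion c R ⁻¹' A ∩ ball 0 1) :=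
    (measurable_inversion c R hA).inter measurableSet_ball
  rw [himg, lintegral_image_eq_lintegral_abs_det_fderiv_mul volume hS
    (fun x hx => (hasFDerivAt_inversion (h.ne_center hx.2)).hasFDerivWithinAt)
    h.involutive.injective.injOn]
  refine setLIntegral_congr_fun hS fun x hx => ?_
  have hd := h.dist_pos hx.2
  have hx1 := one_sub_norm_sq_pos hx.2
  have hR := h.pos
  rw [← ENNReal.ofReal_mul (abs_nonneg _)]
  congr 1
  rw [h.one_sub_norm_sq_inversion (h.ne_center hx.2), ContinuousLinearMap.det]
  simp only [ContinuousLinearMap.toLinearMap_smul, LinearMap.det_smul]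
  have hdet : |LinearMap.det (((ℝ ∙ (x - c))ᗮ.reflection : E →L[ℝ] E) : E →ₗ[ℝ] E)| = 1 := by
    have := ((ℝ ∙ (x - c))ᗮ).det_reflection
    have h2 : (((ℝ ∙ (x - c))ᗮ.reflection : E →L[ℝ] E) : E →ₗ[ℝ] E) =
      ((ℝ ∙ (x - c))ᗮ).reflection.toLinearMap := rfl
    rw [h2, this, abs_pow, abs_neg, abs_one, one_pow]
  rw [abs_mul, hdet, mul_one, abs_of_nonneg (by positivity), ← mul_pow]
  congr 1
  field_simp

/-- The effect of polarization of `K` on the volume of `K ∩ D`, where `D` is already polarized. -/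
lemma hypVol_polarize_inter (h : IsBallInversion c R)
    {K D : Set E} (hK : MeasurableSet K) (hKb : K ⊆ ball 0 1)
    (hD : MeasurableSet D) (hDp : ∀ z ∈ D, z ∈ ball (0 : E) 1 → dist z c ≤ R →
      inversion c R z ∈ D) :
    hypVol (polarize c R K ∩ D) =
      hypVol (K ∩ D) + hypVol ((polarizeGain c R K ∩ D) \ inversion c R ⁻¹' D) := by
  set P := polarizeGain c R K with hPdef
  set σ := inversion c R with hσ
  have hP : MeasurableSet P := measurableSet_polarizeGain c R hK
  have hσm : Measurable σ := measurable_inversion c R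
  have hσσ : ∀ x, σ (σ x) = x := h.involutive
  have hPb : P ⊆ ball 0 1 := fun z hz => h.inversion_mem_ball_iff.1 (hKb hz.2.2)
  have e1 : polarize c R K ∩ D = ((K ∩ D) \ σ ⁻¹' P) ∪ (P ∩ D) := by
    ext z
    simp only [polarize, polarizeGain, P, mem_inter_iff, mem_union, Set.mem_sdiff, mem_preimage,
      mem_ofPred_eq, ← hσ, hσσ]
    by_cases hz : z ∈ K
    · have hzb := hKb hz
      have l1 : dist z c ≤ R → R ≤ dist (σ z) c := h.le_dist_inversion hzb
      have l2 : R ≤ dist z c → R ≤ dist (σ z) c → σ z = z := h.inversion_eq_self_of_le hzb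
      rcases le_total R (dist z c) with h1 | h1
      · by_cases h3 : R ≤ dist (σ z) c
        · have := l2 h1 h3
          simp only [this]; tauto
        · tauto
      · have := l1 h1
        by_cases h3 : R ≤ dist z c
        · have := l2 h3 (l1 h1)
          simp only [this]; tauto
        · tauto
    · tauto
  have hdisj : Disjoint ((K ∩ D) \ σ ⁻¹' P) (P ∩ D) := by
    rw [Set.disjoint_left]
    rintro z ⟨⟨hz, -⟩, -⟩ ⟨hz', -⟩
    exact hz'.2.1 hz
  have e2 : hypVol (K ∩ D) = hypVol ((K ∩ D) \ σ ⁻¹' P) + hypVol (P ∩ D ∩ σ ⁻¹' D) := by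
    rw [← measure_inter_add_sdiff (K ∩ D) (hσm hP), add_comm]
    congr 1
    rw [← h.hypVol_preimage ((hP.inter hD).inter (hσm hD))]
    congr 1
    ext z
    simp only [mem_inter_iff, mem_preimage, ← hσ, hσσ]
    constructor
    · rintro ⟨⟨h1, h2⟩, h3⟩
      refine ⟨⟨h3, ?_⟩, h2⟩
      refine hDp z h2 (hKb h1) ?_
      have h4 := h.dist_inversion_le (hPb h3) h3.1
      rwa [← hσ, hσσ] at h4
    · rintro ⟨⟨h1, h2⟩, h3⟩
      refine ⟨⟨?_, h3⟩, h1⟩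
      have := h1.2.2
      rwa [← hσ, hσσ] at this
  rw [e1, measure_union hdisj (hP.inter hD), e2, add_assoc, measure_inter_add_sdiff _ (hσm hD)]

lemma hypVol_polarize (h : IsBallInversion c R)
    {K : Set E} (hK : MeasurableSet K) (hKb : K ⊆ ball 0 1) :
    hypVol (polarize c R K) = hypVol K := by
  simpa using h.hypVol_polarize_inter hK hKb MeasurableSet.univ (fun _ _ _ _ => mem_univ _)

lemma hypVol_hypThickening_polarize_le (h : IsBallInversion c R)
    {η : ℝ} {K : Set E} (hKb : K ⊆ ball 0 1) :
    hypVol (hypThickening η (polarize c R K)) ≤ hypVol (hypThickening η K) := by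
  rw [← h.hypVol_polarize (isOpen_hypThickening η K).measurableSet (fun _ hz => hz.1)]
  exact measure_mono (h.hypThickening_polarize_subset hKb)

end IsBallInversion

end VolumePolarization

section PolarizeBall

variable {E : Type*} [NormedAddCommGroup E] [InnerProductSpace ℝ E]

lemma IsBallInversion.norm_inversion_le {c : E} {R : ℝ} (h : IsBallInversion c R) {z : E}
    (hz : z ∈ ball (0 : E) 1) (hzc : dist z c ≤ R) : ‖inversion c R z‖ ≤ ‖z‖ := by
  have h1 := h.one_sub_norm_sq_inversion (h.ne_center hz)
  have h2 := one_sub_norm_sq_pos hz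
  have h3 := h.dist_pos hz
  have h4 : 1 ≤ (R / dist z c) ^ 2 := one_le_pow₀ ((one_le_div h3).2 hzc)
  have h5 : ‖inversion c R z‖ ^ 2 ≤ ‖z‖ ^ 2 := by nlinarith
  exact le_of_sq_le_sq h5 (norm_nonneg _)

lemma IsBallInversion.polarize_subset_closedBall {c : E} {R : ℝ} (h : IsBallInversion c R)
    {K : Set E} {r : ℝ} (hr : r < 1) (hK : K ⊆ closedBall 0 r) :
    polarize c R K ⊆ closedBall 0 r := by
  have hKb : K ⊆ ball 0 1 := hK.trans (closedBall_subset_ball hr)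
  rintro z (⟨hzc, hz | hz⟩ | ⟨hz, -⟩)
  · exact hK hz
  · have hzb := h.inversion_mem_ball_iff.1 (hKb hz)
    have h1 := h.norm_inversion_le (hKb hz) (h.dist_inversion_le hzb hzc)
    rw [h.involutive z] at h1
    have h2 := hK hz
    rw [mem_closedBall_zero_iff] at h2 ⊢
    exact h1.trans h2
  · exact hK hz

end PolarizeBall

section Maximizer

open TopologicalSpace

variable {E : Type*} [NormedAddCommGroup E] [InnerProductSpace ℝ E] [FiniteDimensional ℝ E]
  [MeasurableSpace E] [BorelSpace E]

lemma isOpen_setOf_measure_compacts_lt (μ : Measure E) [IsFiniteMeasure μ] (c : ℝ≥0∞) :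
    IsOpen {L : Compacts E | μ L < c} := by
  rw [isOpen_iff_mem_nhds]
  intro L hL
  obtain ⟨U, hLU, hU, hUc⟩ := Set.exists_isOpen_lt_of_lt (L : Set E) c hL
  filter_upwards [(Compacts.isOpen_subsets_of_isOpen hU).mem_nhds hLU] with L' hL'
  exact (measure_mono hL').trans_lt hUc

lemma isOpen_setOf_lt_hypVol_hypThickening (η : ℝ) (c : ℝ≥0∞) :
    IsOpen {L : Compacts E | c < hypVol (hypThickening η (L : Set E))} := by
  rw [isOpen_iff_mem_nhds]
  intro L hL
  have hreg : (hypVol : Measure E).InnerRegularWRT IsCompact IsOpen :=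
    (Measure.InnerRegularWRT.isCompact_isClosed hypVol).trans
      (Measure.InnerRegularWRT.of_pseudoMetrizableSpace hypVol)
  obtain ⟨C, hCL, hC, hcC⟩ := hreg (isOpen_hypThickening η (L : Set E)) c hL
  have : ∀ᶠ L' : Compacts E in 𝓝 L, ∀ y ∈ C, y ∈ hypThickening η (L' : Set E) := by
    refine hC.eventually_forall_of_forall_eventually fun y hy => ?_
    obtain ⟨hyb, w, hw, hyw⟩ := hCL hy
    have h1 : ∀ᶠ q : E × E in 𝓝 y ×ˢ 𝓝 w, HypNear η q.1 q.2 := by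
      rw [← nhds_prod_eq]
      exact (isOpen_setOf_hypNear η).mem_nhds hyw
    obtain ⟨U, hU, W, hW, hUW⟩ := eventually_prod_iff.1 h1
    obtain ⟨W', hW', hWo, hwW⟩ := _root_.eventually_nhds_iff.1 hW
    have h2 := (Compacts.isOpen_inter_nonempty_of_isOpen hWo).mem_nhds
      (show L ∈ {K : Compacts E | ((K : Set E) ∩ W').Nonempty} from ⟨w, hw, hwW⟩)
    rw [nhds_prod_eq]
    filter_upwards [prod_mem_prod h2 (inter_mem hU (isOpen_ball.mem_nhds hyb))]
    rintro ⟨L', y'⟩ ⟨⟨w', hw', hw'W⟩, hy', hyb'⟩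
    exact ⟨hyb', w', hw', hUW hy' (hW' _ hw'W)⟩
  filter_upwards [this] with L' hL'
  exact hcC.trans_le (measure_mono hL')

/-- Among the compact sets whose volume is at least that of `K` and whose thickening is no larger
than that of `K`, one contains a given ball. -/
lemma exists_ball_subset_hypThickening_le {K : Set E} (hK : IsCompact K) (hKb : K ⊆ ball 0 1)
    {r : ℝ} (hr : r < 1) (hrK : hypVol (closedBall (0 : E) r) ≤ hypVol K) (η : ℝ) :
    ∃ L : Set E, ball 0 r ⊆ L ∧ hypVol (hypThickening η L) ≤ hypVol (hypThickening η K) := by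
  obtain ⟨r₀, hr₀, hKr⟩ := exists_pos_lt_subset_ball one_pos hK.isClosed hKb
  replace hKr := hKr.trans ball_subset_closedBall
  set D := closedBall (0 : E) r with hDdef
  have hDm : MeasurableSet D := measurableSet_closedBall
  have hDfin : hypVol D ≠ ∞ := (hypVol_closedBall_lt_top hr).ne
  set μ : Measure E := hypVol.restrict (closedBall 0 r₀) with hμ
  have : IsFiniteMeasure μ := ⟨by simpa [μ] using hypVol_closedBall_lt_top (E := E) hr₀.2⟩
  have hμL : ∀ L : Set E, L ⊆ closedBall 0 r₀ → μ L = hypVol L := fun L hL =>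
    Measure.restrict_eq_self _ hL
  have hb1 : closedBall (0 : E) r₀ ⊆ ball 0 1 := closedBall_subset_ball hr₀.2
  set S : Set (Compacts E) := {L | (L : Set E) ⊆ closedBall 0 r₀} ∩
    ({L | hypVol K ≤ μ L} ∩ {L | hypVol (hypThickening η (L : Set E)) ≤
      hypVol (hypThickening η K)}) with hS
  have hScomp : IsCompact S := by
    refine (Compacts.isCompact_subsets_of_isCompact (isCompact_closedBall 0 r₀)).inter_right
      (IsClosed.inter ?_ ?_)
    · have := (isOpen_setOf_measure_compacts_lt μ (hypVol K)).isClosed_compl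
      convert this using 1
      ext L
      simp
    · have := (isOpen_setOf_lt_hypVol_hypThickening (E := E) η
        (hypVol (hypThickening η K))).isClosed_compl
      convert this using 1
      ext L
      simp
  have hSne : S.Nonempty := ⟨⟨K, hK⟩, hKr, (hμL K hKr).ge, le_refl (hypVol (hypThickening η K))⟩
  have husc : UpperSemicontinuousOn (fun L : Compacts E => (μ.restrict D) L) S := by
    apply UpperSemicontinuous.upperSemicontinuousOn
    rw [upperSemicontinuous_iff_isOpen_preimage]
    exact fun c => isOpen_setOf_measure_compacts_lt (μ.restrict D) c
  obtain ⟨L, ⟨hLr, hLK, hLη⟩, hmax⟩ := UpperSemicontinuousOn.exists_isMaxOn hSne hScomp husc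
  refine ⟨L, ?_, hLη⟩
  by_contra hnot
  have hLm : MeasurableSet (L : Set E) := L.isCompact.isClosed.measurableSet
  have hLb : (L : Set E) ⊆ ball 0 1 := hLr.trans hb1
  obtain ⟨x, hxr, hxL⟩ := not_subset.1 hnot
  have hVK : hypVol K ≤ hypVol (L : Set E) := by rw [← hμL _ hLr]; exact hLK
  have hopen : IsOpen (ball (0 : E) r \ L) := isOpen_ball.sdiff L.isCompact.isClosed
  have hpos : 0 < hypVol (ball (0 : E) r \ L) :=
    volume_pos_of_isOpen hopen ⟨x, ⟨hxr, hxL⟩, ball_subset_ball hr.le hxr⟩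
  have hlt : hypVol ((L : Set E) ∩ D) < hypVol (L : Set E) := by
    refine lt_of_lt_of_le ?_ (hrK.trans hVK)
    have h1 : hypVol ((L : Set E) ∩ D) + hypVol (ball (0 : E) r \ L) ≤ hypVol D := by
      rw [← measure_union _ hopen.measurableSet]
      · exact measure_mono (union_subset inter_subset_right
          (sdiff_subset.trans ball_subset_closedBall))
      · exact disjoint_sdiff_right.mono_left inter_subset_left
    have hfin : hypVol ((L : Set E) ∩ D) ≠ ∞ := ne_top_of_le_ne_top hDfin
      (measure_mono inter_subset_right)
    exact (ENNReal.lt_add_right hfin hpos.ne').trans_le h1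
  have hne : hypVol ((L : Set E) \ D) ≠ 0 := by
    intro h0
    rw [← measure_inter_add_sdiff (L : Set E) hDm, h0, add_zero] at hlt
    simp at hlt
  obtain ⟨y, ⟨hyL, hyD⟩, hy⟩ := exists_mem_forall_mem_nhdsWithin_pos_measure hne
  have hxy : ‖x‖ < ‖y‖ := by
    rw [mem_ball_zero_iff] at hxr
    rw [hDdef, mem_closedBall_zero_iff, not_le] at hyD
    exact hxr.trans hyD
  obtain ⟨c, R, h, hyx, hyc⟩ := exists_isBallInversion (hLb hyL) hxy
  have hL'c := h.isCompact_polarize L.isCompact hLb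
  have hL'r := h.polarize_subset_closedBall hr₀.2 hLr
  have hmem : (⟨polarize c R L, hL'c⟩ : Compacts E) ∈ S := by
    refine ⟨hL'r, ?_, ?_⟩
    · change hypVol K ≤ μ (polarize c R L)
      rw [hμL _ hL'r, h.hypVol_polarize hLm hLb]
      exact hVK
    · exact (h.hypVol_hypThickening_polarize_le hLb).trans hLη
  have hle := hmax hmem
  have e1 : ∀ A : Set E, A ⊆ closedBall 0 r₀ → μ.restrict D A = hypVol (A ∩ D) := fun A hA => by
    rw [Measure.restrict_apply' hDm, hμL _ (inter_subset_left.trans hA)]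
  change μ.restrict D (polarize c R L) ≤ μ.restrict D L at hle
  rw [e1 _ hL'r, e1 _ hLr, h.hypVol_polarize_inter hLm hLb hDm] at hle
  swap
  · intro z hzD hzb hzc
    rw [hDdef, mem_closedBall_zero_iff] at hzD ⊢
    exact (h.norm_inversion_le hzb hzc).trans hzD
  have hfin : hypVol ((L : Set E) ∩ D) ≠ ∞ := ne_top_of_le_ne_top hDfin
      (measure_mono inter_subset_right)
  have hgain : 0 < hypVol ((polarizeGain c R L ∩ D) \ inversion c R ⁻¹' D) := by
    set T : Set E := ((L : Set E) \ D) ∩ ({z | dist z c < R} ∩ inversion c R ⁻¹' (ball 0 r \ L))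
      with hT
    have hTm : MeasurableSet T := by
      refine (MeasurableSet.diff hLm hDm).inter (MeasurableSet.inter ?_ ?_)
      · exact measurableSet_lt (by fun_prop) (by fun_prop)
      · exact measurable_inversion c R hopen.measurableSet
    have hTpos : 0 < hypVol T := by
      refine hy T (inter_mem self_mem_nhdsWithin (mem_nhdsWithin_of_mem_nhds (inter_mem ?_ ?_)))
      · exact (isOpen_lt (by fun_prop) (by fun_prop)).mem_nhds hyc
      · have hcont : ContinuousAt (inversion c R) y :=
          (hasFDerivAt_inversion (h.ne_center (hLb hyL))).continuousAt
        refine hcont.preimage_mem_nhds (hopen.mem_nhds ?_)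
        rw [hyx]
        exact ⟨hxr, hxL⟩
    rw [← h.hypVol_preimage hTm] at hTpos
    refine hTpos.trans_le (measure_mono ?_)
    rintro w ⟨⟨hwL, hwD⟩, hwc, hw2⟩
    have hσσ : inversion c R (inversion c R w) = w := h.involutive w
    rw [mem_preimage, hσσ] at hw2
    have hwc' := h.le_dist_inversion (hLb hwL) (le_of_lt hwc)
    rw [hσσ] at hwc'
    exact ⟨⟨⟨hwc', hw2.2, hwL⟩, ball_subset_closedBall hw2.1⟩, hwD⟩
  exact (ENNReal.lt_add_right hfin hgain.ne').not_ge hle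

end Maximizer

section Tanh

lemma tanh_strictMono : StrictMono tanh := fun a b hab => by
  have hI : ∀ x, tanh x ∈ Ioo (-1 : ℝ) 1 := fun x => ⟨neg_one_lt_tanh x, tanh_lt_one x⟩
  rwa [← artanh_lt_artanh_iff (hI a) (hI b), artanh_tanh, artanh_tanh]

lemma tanh_sub_tanh_sq (a b : ℝ) : (tanh b - tanh a) ^ 2 =
    sinh (b - a) ^ 2 * ((1 - tanh b ^ 2) * (1 - tanh a ^ 2)) := by
  have ha := cosh_pos a
  have hb := cosh_pos b
  rw [tanh_eq_sinh_div_cosh, tanh_eq_sinh_div_cosh, sinh_sub, div_pow, div_pow]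
  have e1 : sinh a ^ 2 = cosh a ^ 2 - 1 := by linarith [cosh_sq a]
  have e2 : sinh b ^ 2 = cosh b ^ 2 - 1 := by linarith [cosh_sq b]
  have e3 : 1 - sinh b ^ 2 / cosh b ^ 2 = 1 / cosh b ^ 2 := by rw [e2]; field_simp; ring
  have e4 : 1 - sinh a ^ 2 / cosh a ^ 2 = 1 / cosh a ^ 2 := by rw [e1]; field_simp; ring
  rw [e3, e4]
  field_simp

variable {E : Type*} [NormedAddCommGroup E] [InnerProductSpace ℝ E]

lemma ball_tanh_subset_hypThickening {a b : ℝ} (ha : 0 < a) (hab : a < b) :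
    ball (0 : E) (tanh b) ⊆ hypThickening (sinh (b - a)) (ball 0 (tanh a)) := by
  intro z hz
  rw [mem_ball_zero_iff] at hz
  have hz1 : z ∈ ball (0 : E) 1 := by
    rw [mem_ball_zero_iff]; exact hz.trans (tanh_lt_one b)
  have hzI : ‖z‖ ∈ Ioo (-1 : ℝ) 1 :=
    ⟨by linarith [norm_nonneg z], by simpa using hz1⟩
  by_cases hza : z ∈ ball (0 : E) (tanh a)
  · refine subset_hypThickening (sinh_pos_iff.2 (by linarith)) ?_ hza
    exact ball_subset_ball (tanh_lt_one a).le
  rw [mem_ball_zero_iff, not_lt] at hza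
  obtain ⟨b', hb'⟩ : ∃ b', tanh b' = ‖z‖ := ⟨_, tanh_artanh hzI⟩
  have hbb : b' < b := by
    rw [← hb'] at hz; exact tanh_strictMono.lt_iff_lt.1 hz
  have hab' : a ≤ b' := by
    rw [← hb'] at hza; exact tanh_strictMono.le_iff_le.1 hza
  set a' := max ((b' - b) / 2 + a) 0 with ha'
  have h1 : a' < a := max_lt (by linarith) ha
  have h2 : 0 ≤ a' := le_max_right _ _
  have h3 : b' - a' < b - a := by
    have := le_max_left ((b' - b) / 2 + a) 0
    linarith
  have ht0 : 0 ≤ tanh a' := by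
    rw [← tanh_zero]; exact tanh_strictMono.monotone h2
  have htz : 0 < ‖z‖ := by
    rw [← hb', ← tanh_zero]; exact tanh_strictMono (ha.trans_le hab')
  have hw : ‖(tanh a' / ‖z‖) • z‖ = tanh a' := by
    rw [norm_smul, Real.norm_of_nonneg (by positivity)]
    field_simp
  refine ⟨hz1, (tanh a' / ‖z‖) • z, ?_, ?_⟩
  · rw [mem_ball_zero_iff, hw]
    exact tanh_strictMono h1
  · unfold HypNear
    have e : z - (tanh a' / ‖z‖) • z = ((tanh b' - tanh a') / ‖z‖) • z := by
      rw [sub_div, sub_smul, hb', div_self htz.ne', one_smul]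
    have e2 : ‖z - (tanh a' / ‖z‖) • z‖ ^ 2 = (tanh b' - tanh a') ^ 2 := by
      rw [e, norm_smul, norm_div, norm_norm, div_mul_cancel₀ _ htz.ne', Real.norm_eq_abs, sq_abs]
    rw [e2, hw, ← hb', tanh_sub_tanh_sq]
    have p1 : 0 < 1 - tanh b' ^ 2 := by linarith [tanh_sq_lt_one b']
    have p2 : 0 < 1 - tanh a' ^ 2 := by linarith [tanh_sq_lt_one a']
    have p3 : 0 ≤ sinh (b' - a') := sinh_nonneg_iff.2 (by linarith)
    have p4 : sinh (b' - a') < sinh (b - a) := sinh_lt_sinh.2 h3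
    gcongr

variable [FiniteDimensional ℝ E] [MeasurableSpace E] [BorelSpace E]

/-- Isoperimetric inequality: geodesic balls have the smallest neighbourhoods. -/
theorem hypVol_ball_le_hypVol_hypThickening {K : Set E} (hK : IsCompact K) (hKb : K ⊆ ball 0 1)
    {a b : ℝ} (ha : 0 < a) (hab : a < b)
    (hV : hypVol (closedBall (0 : E) (tanh a)) ≤ hypVol K) :
    hypVol (ball (0 : E) (tanh b)) ≤ hypVol (hypThickening (sinh (b - a)) K) := by
  obtain ⟨L, h1, h2⟩ := exists_ball_subset_hypThickening_le hK hKb (tanh_lt_one a) hV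
    (sinh (b - a))
  exact (measure_mono ((ball_tanh_subset_hypThickening ha hab).trans (hypThickening_mono h1))).trans
    h2

end Tanh

section SinhInequality

/-- The volume of the hyperbolic ball of radius `τ`, divided by that of the Euclidean unit ball. -/
noncomputable def ballVol (n : ℕ) (τ : ℝ) : ℝ := n * ∫ s in 0..τ, sinh s ^ (n - 1)

lemma ballVol_zero (n : ℕ) : ballVol n 0 = 0 := by simp [ballVol]

lemma hasDerivAt_ballVol (n : ℕ) (τ : ℝ) :
    HasDerivAt (ballVol n) (n * sinh τ ^ (n - 1)) τ := by
  have hc : Continuous fun s : ℝ => sinh s ^ (n - 1) := continuous_sinh.pow _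
  exact (intervalIntegral.integral_hasDerivAt_right (hc.intervalIntegrable _ _)
    (hc.stronglyMeasurableAtFilter _ _) hc.continuousAt).const_mul _

lemma continuous_ballVol (n : ℕ) : Continuous (ballVol n) :=
  continuous_iff_continuousAt.2 fun τ => (hasDerivAt_ballVol n τ).continuousAt

lemma nonneg_of_hasDerivAt_nonneg {f f' : ℝ → ℝ} (h0 : 0 ≤ f 0)
    (hf : ∀ x, 0 ≤ x → HasDerivAt f (f' x) x) (hf' : ∀ x, 0 ≤ x → 0 ≤ f' x) {x : ℝ}
    (hx : 0 ≤ x) : 0 ≤ f x := by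
  have hm : MonotoneOn f (Ici 0) := by
    refine monotoneOn_of_hasDerivWithinAt_nonneg (convex_Ici 0)
      (fun x hx => (hf x hx).continuousAt.continuousWithinAt) (f' := f')
      (fun x hx => ?_) (fun x hx => ?_)
    · rw [interior_Ici] at hx
      exact (hf x (le_of_lt hx)).hasDerivWithinAt
    · rw [interior_Ici] at hx
      exact hf' x (le_of_lt hx)
  exact h0.trans (hm self_mem_Ici hx hx)

lemma ballVol_nonneg (n : ℕ) {τ : ℝ} (hτ : 0 ≤ τ) : 0 ≤ ballVol n τ :=
  nonneg_of_hasDerivAt_nonneg (ballVol_zero n).ge (fun x _ => hasDerivAt_ballVol n x)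
    (fun x hx => by have := sinh_nonneg_iff.2 hx; positivity) hτ

lemma ballVol_add_le (n : ℕ) {τ ε : ℝ} (hτ : 0 ≤ τ) (hε : 0 ≤ ε) :
    ballVol n τ + ε * (n * sinh τ ^ (n - 1)) ≤ ballVol n (τ + ε) := by
  have := nonneg_of_hasDerivAt_nonneg
    (f := fun e => ballVol n (τ + e) - (ballVol n τ + e * (n * sinh τ ^ (n - 1))))
    (f' := fun e => n * sinh (τ + e) ^ (n - 1) - n * sinh τ ^ (n - 1)) (by simp)
    (fun x _ => by
      have h1 := (hasDerivAt_ballVol n (τ + x)).comp x ((hasDerivAt_id x).const_add τ)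
      have h2 := ((hasDerivAt_id x).mul_const (n * sinh τ ^ (n - 1))).const_add (ballVol n τ)
      exact (h1.sub h2).congr_deriv (by simp))
    (fun x hx => by
      have h1 : 0 ≤ sinh τ := sinh_nonneg_iff.2 hτ
      have h2 : sinh τ ≤ sinh (τ + x) := sinh_le_sinh.2 (by linarith)
      have : sinh τ ^ (n - 1) ≤ sinh (τ + x) ^ (n - 1) := by gcongr
      have : (0 : ℝ) ≤ n := by positivity
      nlinarith) hε
  linarith

lemma mul_ballVol_le {n : ℕ} (hn : 2 ≤ n) {τ : ℝ} (hτ : 0 ≤ τ) :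
    (n - 1) / n * ballVol n τ ≤ sinh τ ^ (n - 1) := by
  have hn0 : (0 : ℝ) < n := by positivity
  have hn1 : (1 : ℝ) ≤ n := by exact_mod_cast (by omega : 1 ≤ n)
  have := nonneg_of_hasDerivAt_nonneg
    (f := fun x => sinh x ^ (n - 1) - (n - 1) / n * ballVol n x)
    (f' := fun x => (n - 1) * sinh x ^ (n - 2) * (cosh x - sinh x))
    (by simp [ballVol_zero, show n - 1 ≠ 0 by omega])
    (fun x _ => by
      have h1 := ((hasDerivAt_sinh x).pow (n - 1)).sub
        ((hasDerivAt_ballVol n x).const_mul (((n : ℝ) - 1) / n))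
      refine h1.congr_deriv ?_
      rw [Nat.cast_sub (by omega), show n - 1 - 1 = n - 2 by omega,
        show n - 1 = n - 2 + 1 by omega, pow_succ]
      push_cast
      field_simp)
    (fun x hx => by
      have h1 : 0 ≤ sinh x := sinh_nonneg_iff.2 hx
      have h2 := (sinh_lt_cosh x).le
      have h3 : (0 : ℝ) ≤ n - 1 := by linarith
      have h4 : 0 ≤ cosh x - sinh x := by linarith
      positivity) hτ
  linarith

lemma ballVol_add_rpow_le {n : ℕ} (hn : 2 ≤ n) {τ : ℝ} (hτ : 0 ≤ τ) :
    ballVol n τ + ((n - 1) / n * ballVol n τ) ^ (((n : ℝ) + 1) / (n - 1)) ≤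
      sinh τ ^ n * cosh τ := by
  have hn0 : (0 : ℝ) < n := by positivity
  have hn1 : (0 : ℝ) < n - 1 := by
    have : (1 : ℝ) < n := by exact_mod_cast (by omega : 1 < n)
    linarith
  have he : 1 ≤ ((n : ℝ) + 1) / (n - 1) := by rw [one_le_div hn1]; linarith
  have := nonneg_of_hasDerivAt_nonneg
    (f := fun x => sinh x ^ n * cosh x -
      (ballVol n x + (((n : ℝ) - 1) / n * ballVol n x) ^ (((n : ℝ) + 1) / (n - 1))))
    (f' := fun x => (n + 1) * sinh x ^ (n - 1) *
      (sinh x ^ 2 - ((n - 1) / n * ballVol n x) ^ (2 / ((n : ℝ) - 1))))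
    (by
      have : (0 : ℝ) ^ (((n : ℝ) + 1) / (n - 1)) = 0 := zero_rpow (by linarith)
      simp [ballVol_zero, this])
    (fun x _ => by
      have h1 := (hasDerivAt_ballVol n x).const_mul (((n : ℝ) - 1) / n)
      have h2 := h1.rpow_const (p := ((n : ℝ) + 1) / (n - 1)) (Or.inr he)
      have h3 := ((((hasDerivAt_sinh x).pow n).mul (hasDerivAt_cosh x)).sub
        ((hasDerivAt_ballVol n x).add h2))
      refine h3.congr_deriv ?_
      rw [show ((n : ℝ) + 1) / (n - 1) - 1 = 2 / (n - 1) by field_simp; ring]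
      obtain ⟨m, rfl⟩ : ∃ m, n = m + 1 := ⟨n - 1, by omega⟩
      simp only [Nat.add_sub_cancel, Pi.pow_apply]
      push_cast
      have hm : (m : ℝ) ≠ 0 := by push_cast at hn1; linarith
      have e2 : cosh x * cosh x = sinh x ^ 2 + 1 := by rw [← sq, cosh_sq]
      simp only [add_sub_cancel_right]
      field_simp
      rw [cosh_sq]
      ring)
    (fun x hx => by
      have h1 : 0 ≤ sinh x := sinh_nonneg_iff.2 hx
      have hb := ballVol_nonneg n hx
      have h2 : ((n - 1) / n * ballVol n x) ^ (2 / ((n : ℝ) - 1)) ≤ sinh x ^ 2 := by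
        calc ((n - 1) / n * ballVol n x) ^ (2 / ((n : ℝ) - 1))
            ≤ (sinh x ^ (n - 1)) ^ (2 / ((n : ℝ) - 1)) := by
              gcongr
              exact mul_ballVol_le hn hx
          _ = sinh x ^ 2 := by
              rw [← rpow_natCast, ← rpow_mul h1, Nat.cast_sub (by omega), Nat.cast_one,
                mul_div_cancel₀ _ hn1.ne', ← Nat.cast_two, rpow_natCast]
      have h3 : 0 ≤ sinh x ^ 2 - ((n - 1) / n * ballVol n x) ^ (2 / ((n : ℝ) - 1)) := by linarith
      positivity) hτ
  linarith

lemma ballVol_sq_add_rpow_le {n : ℕ} (hn : 2 ≤ n) {τ : ℝ} (hτ : 0 ≤ τ) :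
    ballVol n τ ^ 2 + ((n - 1) / n * ballVol n τ) ^ (2 * (n : ℝ) / (n - 1)) ≤
      sinh τ ^ (2 * n) := by
  have hn0 : (0 : ℝ) < n := by positivity
  have hn1 : (0 : ℝ) < n - 1 := by
    have : (1 : ℝ) < n := by exact_mod_cast (by omega : 1 < n)
    linarith
  have he : 1 ≤ 2 * (n : ℝ) / (n - 1) := by rw [one_le_div hn1]; linarith
  have := nonneg_of_hasDerivAt_nonneg
    (f := fun x => sinh x ^ (2 * n) -
      (ballVol n x ^ 2 + (((n : ℝ) - 1) / n * ballVol n x) ^ (2 * (n : ℝ) / (n - 1))))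
    (f' := fun x => 2 * n * sinh x ^ (n - 1) * (sinh x ^ n * cosh x -
      (ballVol n x + (((n : ℝ) - 1) / n * ballVol n x) ^ (((n : ℝ) + 1) / (n - 1)))))
    (by
      have : (0 : ℝ) ^ (2 * (n : ℝ) / (n - 1)) = 0 := zero_rpow (by linarith)
      simp [ballVol_zero, this])
    (fun x _ => by
      have h1 := (hasDerivAt_ballVol n x).const_mul (((n : ℝ) - 1) / n)
      have h2 := h1.rpow_const (p := 2 * (n : ℝ) / (n - 1)) (Or.inr he)
      have h3 := (((hasDerivAt_sinh x).pow (2 * n)).sub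
        (((hasDerivAt_ballVol n x).pow 2).add h2))
      refine h3.congr_deriv ?_
      rw [show 2 * (n : ℝ) / (n - 1) - 1 = (n + 1) / (n - 1) by field_simp; ring]
      obtain ⟨m, rfl⟩ : ∃ m, n = m + 1 := ⟨n - 1, by omega⟩
      simp only [Nat.add_sub_cancel]
      rw [show 2 * (m + 1) - 1 = m + (m + 1) by omega, pow_add]
      push_cast
      have hm : (m : ℝ) ≠ 0 := by push_cast at hn1; linarith
      simp only [add_sub_cancel_right]
      field_simp)
    (fun x hx => by
      have h1 : 0 ≤ sinh x := sinh_nonneg_iff.2 hx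
      have h2 := ballVol_add_rpow_le hn hx
      have h3 := sub_nonneg.2 h2
      positivity) hτ
  linarith

/-- A lower bound for the hyperbolic isoperimetric profile; `ω` is the volume of the unit ball. -/
noncomputable def profile (n : ℕ) (p ω s : ℝ) : ℝ :=
  ((n * ω ^ (1 / (n : ℝ)) * s ^ (1 - 1 / (n : ℝ))) ^ p + ((n - 1) * s) ^ p) ^ (1 / p)

lemma profile_ballVol_le {n : ℕ} (hn : 2 ≤ n) {p : ℝ} (hp : 2 * (n : ℝ) / (n - 1) ≤ p) {ω : ℝ}
    (hω : 0 ≤ ω) {τ : ℝ} (hτ : 0 ≤ τ) :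
    profile n p ω (ω * ballVol n τ) ≤ ω * (n * sinh τ ^ (n - 1)) := by
  have hn0 : (0 : ℝ) < n := by positivity
  have hn1 : (0 : ℝ) < n - 1 := by
    have : (1 : ℝ) < n := by exact_mod_cast (by omega : 1 < n)
    linarith
  set p₀ := 2 * (n : ℝ) / (n - 1) with hp₀
  have hp₀0 : 0 < p₀ := by positivity
  have hp0 : 0 < p := by linarith
  have hb := ballVol_nonneg n hτ
  have hs : 0 ≤ sinh τ := sinh_nonneg_iff.2 hτ
  set b := ballVol n τ with hbdef
  have hω1 : ω ^ (1 / (n : ℝ)) * (ω * b) ^ (1 - 1 / (n : ℝ)) = ω * b ^ (1 - 1 / (n : ℝ)) := by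
    rcases hω.eq_or_lt with rfl | hω
    · rw [zero_rpow (by positivity)]; simp
    · rw [mul_rpow hω.le hb, ← mul_assoc, ← rpow_add hω]; norm_num
  have e1 : (b ^ (1 - 1 / (n : ℝ))) ^ p₀ = b ^ 2 := by
    rw [← rpow_mul hb, ← rpow_natCast]
    congr 1
    rw [hp₀]; field_simp; norm_num
  have e2 : (sinh τ ^ (n - 1)) ^ p₀ = sinh τ ^ (2 * n) := by
    rw [← rpow_natCast, ← rpow_natCast, ← rpow_mul hs]
    congr 1
    rw [hp₀, Nat.cast_sub (by omega)]; push_cast; field_simp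
  have key : (b ^ (1 - 1 / (n : ℝ))) ^ p + ((n - 1) / n * b) ^ p ≤ (sinh τ ^ (n - 1)) ^ p := by
    have hr : 1 ≤ p / p₀ := by rwa [one_le_div hp₀0]
    have e3 : ∀ x : ℝ, 0 ≤ x → x ^ p = (x ^ p₀) ^ (p / p₀) := fun x hx => by
      rw [← rpow_mul hx, mul_div_cancel₀ _ hp₀0.ne']
    rw [e3 _ (by positivity), e3 ((n - 1) / n * b) (by positivity), e3 (sinh τ ^ (n - 1))
      (by positivity), e1, e2]
    refine (Real.add_rpow_le_rpow_add (by positivity) (by positivity) hr).trans ?_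
    gcongr
    exact ballVol_sq_add_rpow_le hn hτ
  unfold profile
  rw [mul_assoc, hω1, show ((n : ℝ) - 1) * (ω * b) = n * (ω * ((n - 1) / n * b)) by field_simp]
  have e4 : (n * (ω * b ^ (1 - 1 / (n : ℝ)))) ^ p + (n * (ω * ((n - 1) / n * b))) ^ p ≤
      (ω * (n * sinh τ ^ (n - 1))) ^ p := by
    rw [← mul_assoc, ← mul_assoc (n : ℝ), ← mul_assoc ω, mul_comm (n : ℝ) ω,
      mul_rpow (x := ω * n) (by positivity) (by positivity),
      mul_rpow (x := ω * n) (by positivity) (by positivity),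
      mul_rpow (x := ω * n) (by positivity) (by positivity), ← mul_add]
    gcongr
  calc _ ≤ ((ω * (n * sinh τ ^ (n - 1))) ^ p) ^ (1 / p) := by gcongr
    _ = _ := by rw [one_div, rpow_rpow_inv (by positivity) hp0.ne']

lemma profile_zero {n : ℕ} (hn : 2 ≤ n) {p : ℝ} (hp : 0 < p) (ω : ℝ) : profile n p ω 0 = 0 := by
  have hn1 : (1 : ℝ) < n := by exact_mod_cast (by omega : 1 < n)
  have : 1 - 1 / (n : ℝ) ≠ 0 := by
    rw [sub_ne_zero, ne_comm, Ne, div_eq_one_iff_eq (by linarith)]; linarith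
  rw [profile, zero_rpow this, mul_zero, mul_zero, zero_rpow hp.ne', add_zero,
    zero_rpow (one_div_ne_zero hp.ne')]

lemma continuous_profile {n : ℕ} (hn : 2 ≤ n) {p : ℝ} (hp : 0 < p) (ω : ℝ) :
    Continuous (profile n p ω) := by
  have hn1 : (1 : ℝ) < n := by exact_mod_cast (by omega : 1 < n)
  have h1 : 0 ≤ 1 - 1 / (n : ℝ) := by
    rw [sub_nonneg, div_le_one (by linarith)]; linarith
  unfold profile
  refine Continuous.rpow_const ?_ fun _ => Or.inr (by positivity)
  refine Continuous.add ?_ ?_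
  · refine Continuous.rpow_const ?_ fun _ => Or.inr hp.le
    exact continuous_const.mul (continuous_id.rpow_const fun _ => Or.inr h1)
  · exact Continuous.rpow_const (by fun_prop) fun _ => Or.inr hp.le

end SinhInequality

section BallVolume

variable {E : Type*} [NormedAddCommGroup E] [InnerProductSpace ℝ E] [FiniteDimensional ℝ E]
  [MeasurableSpace E] [BorelSpace E]

lemma hasDerivAt_tanh (x : ℝ) : HasDerivAt tanh (1 / cosh x ^ 2) x := by
  have h := (hasDerivAt_sinh x).div (hasDerivAt_cosh x) (cosh_pos x).ne'
  have e : tanh = fun y => sinh y / cosh y := funext tanh_eq_sinh_div_cosh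
  rw [e]
  refine h.congr_deriv ?_
  congr 1
  nlinarith [cosh_sq x]

lemma integral_tanh_half {n : ℕ} (hn : 1 ≤ n) (τ : ℝ) :
    ∫ y in 0..tanh (τ / 2), y ^ (n - 1) * (2 / (1 - y ^ 2)) ^ n = ∫ s in 0..τ, sinh s ^ (n - 1) := by
  have hcosh : ∀ x : ℝ, cosh x ≠ 0 := fun x => (cosh_pos x).ne'
  have hd : ∀ s ∈ uIcc 0 τ, HasDerivAt (fun s => tanh (s / 2)) (1 / cosh (s / 2) ^ 2 / 2) s := by
    intro s _
    have h := (hasDerivAt_tanh (s / 2)).comp s ((hasDerivAt_id s).div_const 2)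
    exact h.congr_deriv (by ring)
  have hc : ContinuousOn (fun s : ℝ => 1 / cosh (s / 2) ^ 2 / 2) (uIcc 0 τ) := by
    have : ∀ x : ℝ, cosh (x / 2) ^ 2 ≠ 0 := fun x => pow_ne_zero _ (hcosh _)
    fun_prop (disch := simp [this])
  have hg : ContinuousOn (fun y : ℝ => y ^ (n - 1) * (2 / (1 - y ^ 2)) ^ n)
      ((fun s => tanh (s / 2)) '' uIcc 0 τ) := by
    refine ContinuousOn.mul (by fun_prop) (ContinuousOn.pow (ContinuousOn.div₀ (by fun_prop)
      (by fun_prop) ?_) _)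
    rintro _ ⟨s, -, rfl⟩
    have := tanh_sq_lt_one (s / 2)
    exact (sub_pos.2 this).ne'
  have h := intervalIntegral.integral_comp_mul_deriv' hd hc hg
  rw [zero_div, tanh_zero] at h
  rw [← h]
  refine intervalIntegral.integral_congr fun s _ => ?_
  obtain ⟨m, rfl⟩ : ∃ m, n = m + 1 := ⟨n - 1, by omega⟩
  simp only [Function.comp, Nat.add_sub_cancel]
  have e1 : sinh s = 2 * sinh (s / 2) * cosh (s / 2) := by rw [← sinh_two_mul]; ring_nf
  have e2 : 1 - (sinh (s / 2) / cosh (s / 2)) ^ 2 = 1 / cosh (s / 2) ^ 2 := by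
    have := hcosh (s / 2)
    rw [div_pow, sinh_sq]; field_simp; ring
  rw [tanh_eq_sinh_div_cosh, e2, e1]
  have := hcosh (s / 2)
  rw [div_pow, div_div_eq_mul_div, div_one, mul_pow, mul_pow, mul_pow, ← pow_mul]
  field_simp
  ring

lemma hypVol_ball_tanh (hn : 1 ≤ finrank ℝ E) {τ : ℝ} (hτ : 0 ≤ τ) :
    hypVol (ball (0 : E) (tanh (τ / 2))) =
      ENNReal.ofReal (volume.real (ball (0 : E) 1) * ballVol (finrank ℝ E) τ) := by
  set r := tanh (τ / 2) with hr
  set n := finrank ℝ E with hndef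
  have hr1 : r < 1 := tanh_lt_one _
  have hr0 : 0 ≤ r := by
    rw [hr, ← tanh_zero]; exact tanh_strictMono.monotone (by linarith)
  have : Nontrivial E := nontrivial_of_finrank_pos (R := ℝ) (by omega)
  rw [hypVol_apply measurableSet_ball, inter_eq_left.2 (ball_subset_ball hr1.le)]
  have hint : IntegrableOn (fun x : E => (2 / (1 - ‖x‖ ^ 2)) ^ n) (ball 0 r) := by
    refine IntegrableOn.mono_set (ContinuousOn.integrableOn_compact (isCompact_closedBall 0 r) ?_)
      ball_subset_closedBall
    refine ContinuousOn.pow (ContinuousOn.div₀ (by fun_prop) (by fun_prop) fun x hx => ?_) _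
    exact (one_sub_norm_sq_pos (closedBall_subset_ball hr1 hx)).ne'
  rw [← ofReal_integral_eq_lintegral_ofReal hint]
  swap
  · refine (ae_restrict_iff' measurableSet_ball).2 (ae_of_all _ fun x hx => ?_)
    have := one_sub_norm_sq_pos (ball_subset_ball hr1.le hx)
    change 0 ≤ _
    positivity
  congr 1
  rw [← integral_indicator measurableSet_ball]
  have e1 : (ball (0 : E) r).indicator (fun x => (2 / (1 - ‖x‖ ^ 2)) ^ n) =
      fun x => (Iio r).indicator (fun y : ℝ => (2 / (1 - y ^ 2)) ^ n) ‖x‖ := by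
    ext x
    simp [indicator]
  rw [e1, integral_fun_norm_addHaar volume, ballVol, ← integral_tanh_half hn τ, ← hr]
  simp only [smul_eq_mul, nsmul_eq_mul, ← hndef]
  rw [mul_left_comm, ← mul_assoc, ← mul_assoc]
  congr 1
  rw [intervalIntegral.integral_of_le hr0, integral_Ioc_eq_integral_Ioo,
    ← Ioi_inter_Iio, ← setIntegral_indicator measurableSet_Iio]
  refine setIntegral_congr_fun measurableSet_Ioi fun y _ => ?_
  simp only [indicator]
  split_ifs <;> simp

lemma hypVol_closedBall_tanh (hn : 1 ≤ finrank ℝ E) {τ : ℝ} (hτ : 0 ≤ τ) :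
    hypVol (closedBall (0 : E) (tanh (τ / 2))) =
      ENNReal.ofReal (volume.real (ball (0 : E) 1) * ballVol (finrank ℝ E) τ) := by
  rw [← hypVol_ball_tanh hn hτ, ← ball_union_sphere]
  refine le_antisymm ((measure_union_le _ _).trans ?_) (measure_mono subset_union_left)
  rw [hypVol_sphere hn, add_zero]

lemma exists_ballVol_eq {n : ℕ} (hn : 1 ≤ n) {v : ℝ} (hv : 0 < v) : ∃ τ, 0 < τ ∧ ballVol n τ = v := by
  have h1 : 0 < (n : ℝ) * sinh 1 ^ (n - 1) := by
    have := sinh_pos_iff.2 one_pos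
    have : (0 : ℝ) < n := by positivity
    positivity
  set c := (n : ℝ) * sinh 1 ^ (n - 1)
  have h2 : v ≤ ballVol n (1 + v / c) := by
    have h3 := ballVol_add_le n zero_le_one (ε := v / c) (by positivity)
    have h4 := ballVol_nonneg n zero_le_one
    rw [div_mul_cancel₀ _ h1.ne'] at h3
    linarith
  obtain ⟨τ, hτ, hτv⟩ := intermediate_value_Icc (by positivity : (0 : ℝ) ≤ 1 + v / c)
    (continuous_ballVol n).continuousOn ⟨by rw [ballVol_zero]; exact hv.le, h2⟩
  refine ⟨τ, lt_of_le_of_ne hτ.1 ?_, hτv⟩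
  rintro rfl
  rw [ballVol_zero] at hτv
  exact hv.ne hτv

lemma volume_real_unitBall_pos : 0 < volume.real (ball (0 : E) 1) :=
  ENNReal.toReal_pos (measure_ball_pos volume _ one_pos).ne' measure_ball_lt_top.ne

/-- Quantitative growth of neighbourhoods of compact sets. -/
lemma hypVol_add_profile_le_of_isCompact (hn : 2 ≤ finrank ℝ E) {p : ℝ}
    (hp : 2 * (finrank ℝ E : ℝ) / (finrank ℝ E - 1) ≤ p) {K : Set E} (hK : IsCompact K)
    (hKb : K ⊆ ball 0 1) {ε : ℝ} (hε : 0 < ε) :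
    ENNReal.ofReal (hypVol.real K + ε * profile (finrank ℝ E) p (volume.real (ball (0 : E) 1))
      (hypVol.real K)) ≤ hypVol (hypThickening (sinh (ε / 2)) K) := by
  set n := finrank ℝ E with hndef
  set ω := volume.real (ball (0 : E) 1) with hω
  have hω0 : 0 < ω := volume_real_unitBall_pos
  have hn1 : (0 : ℝ) < n - 1 := by
    have : (1 : ℝ) < n := by exact_mod_cast (by omega : 1 < n)
    linarith
  have hp0 : 0 < p := lt_of_lt_of_le (by positivity) hp
  have hfin := (hypVol_lt_top_of_isCompact hK hKb).ne
  rcases (measureReal_nonneg : 0 ≤ hypVol.real K).eq_or_lt with h0 | hpos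
  · rw [← h0, profile_zero hn hp0]; simp
  obtain ⟨τ, hτ, hτv⟩ := exists_ballVol_eq (n := n) (by omega) (div_pos hpos hω0)
  have hV : hypVol.real K = ω * ballVol n τ := by rw [hτv]; field_simp
  have h1 := hypVol_ball_le_hypVol_hypThickening hK hKb (a := τ / 2) (b := (τ + ε) / 2)
    (by linarith) (by linarith) (by
      rw [hypVol_closedBall_tanh (by omega) hτ.le, ← hndef, ← hω, ← hV,
        measureReal_def, ENNReal.ofReal_toReal hfin])
  rw [hypVol_ball_tanh (by omega) (by linarith), ← hndef, ← hω,
    show (τ + ε) / 2 - τ / 2 = ε / 2 by ring] at h1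
  refine le_trans (ENNReal.ofReal_le_ofReal ?_) h1
  have h2 := ballVol_add_le n hτ.le hε.le
  have h3 := profile_ballVol_le hn hp hω0.le hτ.le
  rw [hV]
  calc _ ≤ ω * ballVol n τ + ε * (ω * (n * sinh τ ^ (n - 1))) := by gcongr
    _ = ω * (ballVol n τ + ε * (n * sinh τ ^ (n - 1))) := by ring
    _ ≤ _ := by gcongr

lemma innerRegularWRT_hypVol : (hypVol : Measure E).InnerRegularWRT IsCompact IsOpen :=
  (Measure.InnerRegularWRT.isCompact_isClosed hypVol).trans
    (Measure.InnerRegularWRT.of_pseudoMetrizableSpace hypVol)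

/-- Quantitative growth of neighbourhoods of open sets. -/
lemma hypVol_add_profile_le (hn : 2 ≤ finrank ℝ E) {p : ℝ}
    (hp : 2 * (finrank ℝ E : ℝ) / (finrank ℝ E - 1) ≤ p) {U : Set E} (hU : IsOpen U)
    (hUb : U ⊆ ball 0 1) (hUfin : hypVol U ≠ ∞) {ε : ℝ} (hε : 0 < ε) :
    ENNReal.ofReal (hypVol.real U + ε * profile (finrank ℝ E) p (volume.real (ball (0 : E) 1))
      (hypVol.real U)) ≤ hypVol (hypThickening (sinh (ε / 2)) U) := by
  set n := finrank ℝ E with hndef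
  set ω := volume.real (ball (0 : E) 1) with hω
  have hω0 : 0 < ω := volume_real_unitBall_pos
  have hn1 : (0 : ℝ) < n - 1 := by
    have : (1 : ℝ) < n := by exact_mod_cast (by omega : 1 < n)
    linarith
  have hp0 : 0 < p := lt_of_lt_of_le (by positivity) hp
  rcases (measureReal_nonneg : 0 ≤ hypVol.real U).eq_or_lt with h0 | hpos
  · rw [← h0, profile_zero hn hp0]; simp
  have hcont := continuous_profile hn hp0 ω
  have hseq : ∀ k : ℕ, ∃ K ⊆ U, IsCompact K ∧
      hypVol.real U - hypVol.real U / (k + 1) < hypVol.real K := by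
    intro k
    have hk : 0 < hypVol.real U / (k + 1) := by positivity
    have : ENNReal.ofReal (hypVol.real U - hypVol.real U / (k + 1)) < hypVol U := by
      rw [ENNReal.ofReal_lt_iff_lt_toReal _ hUfin]
      · exact sub_lt_self _ hk
      · exact sub_nonneg.2 (div_le_self hpos.le (by linarith [k.cast_nonneg (α := ℝ)]))
    obtain ⟨K, hKU, hK, hlt⟩ := innerRegularWRT_hypVol hU _ this
    refine ⟨K, hKU, hK, ?_⟩
    exact (ENNReal.ofReal_lt_iff_lt_toReal (sub_nonneg.2 (div_le_self hpos.le
      (by linarith [k.cast_nonneg (α := ℝ)]))) (ne_top_of_le_ne_top hUfin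
      (measure_mono hKU))).1 hlt
  choose K hKU hK hlt using hseq
  have hlim : Tendsto (fun k => hypVol.real (K k)) atTop (𝓝 (hypVol.real U)) := by
    refine tendsto_of_tendsto_of_tendsto_of_le_of_le (f := fun k => hypVol.real (K k)) ?_
      tendsto_const_nhds (fun k => (hlt k).le) (fun k => measureReal_mono (hKU k) hUfin)
    have : Tendsto (fun k : ℕ => hypVol.real U / ((k : ℝ) + 1)) atTop (𝓝 0) :=
      tendsto_const_nhds.div_atTop (tendsto_natCast_atTop_atTop.atTop_add tendsto_const_nhds)
    simpa using tendsto_const_nhds.sub this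
  have hlim2 : Tendsto (fun k => ENNReal.ofReal (hypVol.real (K k) +
      ε * profile n p ω (hypVol.real (K k)))) atTop
      (𝓝 (ENNReal.ofReal (hypVol.real U + ε * profile n p ω (hypVol.real U)))) := by
    refine (ENNReal.continuous_ofReal.tendsto _).comp (hlim.add ?_)
    exact ((hcont.tendsto _).comp hlim).const_mul ε
  refine le_of_tendsto hlim2 (Eventually.of_forall fun k => ?_)
  exact (hypVol_add_profile_le_of_isCompact hn hp (hK k) ((hKU k).trans hUb) hε).trans
    (measure_mono (hypThickening_mono (hKU k)))

end BallVolume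

section Coarea

variable {E : Type*} [NormedAddCommGroup E]

/-- The pairs `(x, t)` such that `x` is outside the superlevel set `{t < |u|}` but `η`-close
to it. -/
def nearLevel (u : E → ℝ) (η : ℝ) : Set (E × ℝ) :=
  {q | |u q.1| ≤ q.2 ∧ q.1 ∈ hypThickening η {y | q.2 < |u y|}}

lemma HypNear.norm_sub_lt {η : ℝ} (hη : 0 ≤ η) {x y : E} (hx : x ∈ ball (0 : E) 1)
    (hy : y ∈ ball (0 : E) 1) (h : HypNear η x y) : ‖x - y‖ < η := by
  have hx1 := one_sub_norm_sq_pos hx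
  have hy1 := one_sub_norm_sq_pos hy
  refine lt_of_pow_lt_pow_left₀ 2 hη (h.trans_le ?_)
  have : (1 - ‖x‖ ^ 2) * (1 - ‖y‖ ^ 2) ≤ 1 :=
    mul_le_one₀ (by nlinarith [norm_nonneg x]) hy1.le (by nlinarith [norm_nonneg y])
  nlinarith [sq_nonneg η]

lemma HypNear.norm_sub_le {η : ℝ} (hη : 0 ≤ η) {x y : E} (hx : x ∈ ball (0 : E) 1)
    (hy : y ∈ ball (0 : E) 1) (h : HypNear η x y) : ‖x - y‖ ≤ η * (1 - ‖x‖ ^ 2 + η) := by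
  have hx1 := one_sub_norm_sq_pos hx
  have hy1 := one_sub_norm_sq_pos hy
  have h1 := h.norm_sub_lt hη hx hy
  have hx2 : ‖x‖ < 1 := by simpa using hx
  have hy2 : ‖y‖ < 1 := by simpa using hy
  have h2 : 1 - ‖y‖ ^ 2 ≤ 1 - ‖x‖ ^ 2 + 2 * η := by
    have : ‖x‖ ≤ ‖x - y‖ + ‖y‖ := by simpa using norm_add_le (x - y) y
    nlinarith [norm_nonneg x, norm_nonneg y]
  refine le_of_sq_le_sq (h.le.trans ?_) (by positivity)
  rw [mul_pow]
  gcongr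
  nlinarith [sq_nonneg η]

lemma isOpen_setOf_mem_hypThickening (u : E → ℝ) (η : ℝ) :
    IsOpen {q : E × ℝ | q.1 ∈ hypThickening η {y | q.2 < |u y|}} := by
  have : {q : E × ℝ | q.1 ∈ hypThickening η {y | q.2 < |u y|}} =
      ⋃ y, ({z | z ∈ ball 0 1} ∩ {z | HypNear η z y}) ×ˢ Iio |u y| := by
    ext q
    simp only [hypThickening, mem_ofPred_eq, mem_iUnion, mem_prod, mem_inter_iff, mem_Iio]
    tauto
  rw [this]
  refine isOpen_iUnion fun y => IsOpen.prod (isOpen_ball.inter ?_) isOpen_Iio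
  exact (isOpen_setOf_hypNear η).preimage (by fun_prop : Continuous fun z : E => (z, y))


variable [NormedSpace ℝ E] in
lemma eventually_abs_le_of_hypNear {u : E → ℝ} (hu : Differentiable ℝ u) {x : E}
    (hx : x ∈ ball (0 : E) 1) {e : ℝ} (he : 0 < e) :
    ∀ᶠ η in 𝓝[>] (0 : ℝ), ∀ y ∈ ball (0 : E) 1, HypNear η x y →
      |u y| ≤ |u x| + ((1 - ‖x‖ ^ 2) * ‖fderiv ℝ u x‖ + e) * η := by
  set N := ‖fderiv ℝ u x‖ with hN
  have hN0 : 0 ≤ N := norm_nonneg _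
  have hx1 := one_sub_norm_sq_pos hx
  have hlo := (hu x).hasFDerivAt.isLittleO.def (half_pos he)
  obtain ⟨δ, hδ, hball⟩ := Metric.eventually_nhds_iff.1 hlo
  have h1 : ∀ᶠ η in 𝓝[>] (0 : ℝ), η < δ :=
    mem_nhdsWithin_of_mem_nhds (Iio_mem_nhds hδ)
  have h2 : ∀ᶠ η in 𝓝[>] (0 : ℝ), η < (e / 2) / (N + e / 2) :=
    mem_nhdsWithin_of_mem_nhds (Iio_mem_nhds (by positivity))
  filter_upwards [h1, h2, self_mem_nhdsWithin] with η hη1 hη2 hη0 y hy hxy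
  replace hη0 : 0 < η := hη0
  have d1 := hxy.norm_sub_lt hη0.le hx hy
  have d2 := hxy.norm_sub_le hη0.le hx hy
  have h3 := hball (y := y) (by rw [dist_eq_norm, norm_sub_rev]; exact d1.trans hη1)
  have h4 : |u y - u x| ≤ (N + e / 2) * ‖x - y‖ := by
    have h5 : ‖fderiv ℝ u x (y - x)‖ ≤ N * ‖y - x‖ := (fderiv ℝ u x).le_opNorm _
    have h6 : ‖u y - u x‖ ≤ ‖u y - u x - fderiv ℝ u x (y - x)‖ + ‖fderiv ℝ u x (y - x)‖ := by
      simpa using norm_add_le (u y - u x - fderiv ℝ u x (y - x)) (fderiv ℝ u x (y - x))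
    rw [← Real.norm_eq_abs, norm_sub_rev x y]
    linarith
  have h7 : |u y| ≤ |u x| + |u y - u x| := by
    have := abs_add_le (u x) (u y - u x)
    rwa [add_sub_cancel] at this
  have h8 : (N + e / 2) * ‖x - y‖ ≤ (N + e / 2) * (η * (1 - ‖x‖ ^ 2 + η)) := by gcongr
  have h9 : (N + e / 2) * (1 - ‖x‖ ^ 2 + η) ≤ (1 - ‖x‖ ^ 2) * N + e := by
    rw [lt_div_iff₀ (by positivity)] at hη2
    nlinarith [norm_nonneg x, sq_nonneg ‖x‖]
  nlinarith


lemma lintegral_nearLevel_le {u : E → ℝ} {w : ℝ → ℝ} {x : E}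
    {η κ c : ℝ} (hκ : ∀ y ∈ ball (0 : E) 1, HypNear η x y → |u y| ≤ |u x| + κ)
    (hub : tsupport u ⊆ ball 0 1)
    (hw : ∀ t, |u x| ≤ t → t < |u x| + κ → (∃ y, t < |u y|) → w t ≤ c) :
    ∫⁻ t in Ioi (0 : ℝ), (nearLevel u η).indicator (fun q => ENNReal.ofReal (w q.2)) (x, t) ≤
      ENNReal.ofReal c * ENNReal.ofReal κ := by
  have hsub : ∀ t ∈ Ioi (0 : ℝ),
      (nearLevel u η).indicator (fun q => ENNReal.ofReal (w q.2)) (x, t) ≤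
      (Ico |u x| (|u x| + κ)).indicator (fun _ => ENNReal.ofReal c) t := by
    intro t ht
    by_cases h : (x, t) ∈ nearLevel u η
    · obtain ⟨h1, -, y, hy, hxy⟩ := h
      have hyb : y ∈ ball (0 : E) 1 := by
        refine hub (subset_tsupport u ?_)
        have : 0 < |u y| := lt_trans ht hy
        exact abs_pos.1 this
      have hyt : t < |u y| := hy
      have h2 : t < |u x| + κ := hyt.trans_le (hκ y hyb hxy)
      rw [indicator_of_mem (show t ∈ Ico |u x| (|u x| + κ) from ⟨h1, h2⟩)]
      refine (indicator_le_self _ _ _).trans ?_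
      exact ENNReal.ofReal_le_ofReal (hw t h1 h2 ⟨y, hyt⟩)
    · rw [indicator_of_notMem h]
      exact zero_le
  calc _ ≤ ∫⁻ t in Ioi (0 : ℝ), (Ico |u x| (|u x| + κ)).indicator (fun _ => ENNReal.ofReal c) t :=
        setLIntegral_mono' measurableSet_Ioi hsub
    _ ≤ ∫⁻ t, (Ico |u x| (|u x| + κ)).indicator (fun _ => ENNReal.ofReal c) t :=
        setLIntegral_le_lintegral _ _
    _ = _ := by
        rw [lintegral_indicator measurableSet_Ico, setLIntegral_const, Real.volume_Ico]
        simp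

variable [MeasurableSpace E] [BorelSpace E]

lemma measurableSet_nearLevel {u : E → ℝ} (hu : Continuous u) (η : ℝ) :
    MeasurableSet (nearLevel u η) := by
  have h : MeasurableSet {q : E × ℝ | |u q.1| ≤ q.2} :=
    measurableSet_le (hu.comp continuous_fst).abs.measurable measurable_snd
  exact h.inter (isOpen_setOf_mem_hypThickening u η).measurableSet

variable [InnerProductSpace ℝ E] [FiniteDimensional ℝ E]

lemma ae_hypVol_mem_ball : ∀ᵐ x ∂(hypVol : Measure E), x ∈ ball (0 : E) 1 := by
  rw [ae_iff]
  change hypVol (ball (0 : E) 1)ᶜ = 0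
  rw [hypVol_apply measurableSet_ball.compl, compl_inter_self, setLIntegral_empty]

instance : SFinite (hypVol : Measure E) := by unfold hypVol; infer_instance

lemma lintegral_mul_le_lintegral_nearLevel {u : E → ℝ} (hu : Continuous u) {r₀ : ℝ} (hr₀ : r₀ < 1)
    (hsupp : tsupport u ⊆ closedBall 0 r₀) (hn : 2 ≤ finrank ℝ E) {p : ℝ}
    (hp : 2 * (finrank ℝ E : ℝ) / (finrank ℝ E - 1) ≤ p) {w : ℝ → ℝ} (hw : Measurable w)
    {ε : ℝ} (hε : 0 < ε) :
    ENNReal.ofReal ε * ∫⁻ t in Ioi (0 : ℝ), ENNReal.ofReal (w t) *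
      ENNReal.ofReal (profile (finrank ℝ E) p (volume.real (ball (0 : E) 1))
        (hypVol.real {x | t < |u x|})) ≤
    ∫⁻ x, (∫⁻ t in Ioi (0 : ℝ), (nearLevel u (sinh (ε / 2))).indicator
      (fun q => ENNReal.ofReal (w q.2)) (x, t)) ∂hypVol := by
  set η := sinh (ε / 2) with hη
  have hη0 : 0 < η := sinh_pos_iff.2 (by linarith)
  have hm := measurableSet_nearLevel hu η
  have hmeas : Measurable ((nearLevel u η).indicator (fun q => ENNReal.ofReal (w q.2))) :=
    (ENNReal.measurable_ofReal.comp (hw.comp measurable_snd)).indicator hm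
  rw [lintegral_lintegral_swap (f := fun x t => (nearLevel u η).indicator
    (fun q => ENNReal.ofReal (w q.2)) (x, t)) hmeas.aemeasurable,
    ← lintegral_const_mul' _ _ ENNReal.ofReal_ne_top]
  refine setLIntegral_mono' measurableSet_Ioi fun t ht => ?_
  set U : Set E := {x | t < |u x|} with hU
  have hUo : IsOpen U := isOpen_Ioi.preimage hu.abs
  have hUs : U ⊆ closedBall 0 r₀ := fun x hx => hsupp (subset_tsupport u
    (abs_pos.1 (lt_trans ht hx)))
  have hUb : U ⊆ ball 0 1 := hUs.trans (closedBall_subset_ball hr₀)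
  have hUfin : hypVol U ≠ ∞ := ne_top_of_le_ne_top (hypVol_closedBall_lt_top hr₀).ne
    (measure_mono hUs)
  have e1 : ∀ x, (nearLevel u η).indicator (fun q => ENNReal.ofReal (w q.2)) (x, t) =
      (hypThickening η U \ U).indicator (fun _ => ENNReal.ofReal (w t)) x := by
    intro x
    simp only [indicator, nearLevel, hU, Set.mem_sdiff, mem_ofPred_eq, not_lt]
    congr 1
    rw [and_comm, Set.mem_sdiff, mem_ofPred_eq, not_lt]
  have hTo := isOpen_hypThickening η U
  simp_rw [e1]
  rw [lintegral_indicator (hTo.measurableSet.diff hUo.measurableSet), setLIntegral_const,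
    mul_left_comm]
  gcongr
  have h1 := hypVol_add_profile_le hn hp hUo hUb hUfin hε
  rw [← hη] at h1
  have h2 : 0 ≤ profile (finrank ℝ E) p (volume.real (ball (0 : E) 1)) (hypVol.real U) := by
    have : (1 : ℝ) ≤ finrank ℝ E := by exact_mod_cast (by omega : 1 ≤ finrank ℝ E)
    have : (0 : ℝ) ≤ finrank ℝ E - 1 := by linarith
    unfold profile
    positivity
  rw [ENNReal.ofReal_add measureReal_nonneg (by positivity), measureReal_def,
    ENNReal.ofReal_toReal hUfin, ENNReal.ofReal_mul hε.le,
    ← measure_inter_add_sdiff (hypThickening η U) hUo.measurableSet,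
    inter_eq_right.2 (subset_hypThickening hη0 hUb)] at h1
  exact (ENNReal.add_le_add_iff_left hUfin).1 h1

end Coarea

section CoareaLimit

variable {E : Type*} [NormedAddCommGroup E]

lemma eventually_sinh_half_le {c : ℝ} (hc : 1 / 2 < c) :
    ∀ᶠ ε in 𝓝[>] (0 : ℝ), sinh (ε / 2) ≤ c * ε := by
  have h : HasDerivAt (fun ε : ℝ => sinh (ε / 2)) (1 / 2) 0 := by
    have := (hasDerivAt_sinh ((0 : ℝ) / 2)).comp (0 : ℝ) ((hasDerivAt_id (0 : ℝ)).div_const 2)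
    exact this.congr_deriv (by simp)
  have h1 := h.tendsto_slope_zero_right
  filter_upwards [h1.eventually_lt_const hc, self_mem_nhdsWithin] with ε h2 h3
  replace h3 : 0 < ε := h3
  simp only [zero_add, zero_div, sinh_zero, sub_zero, smul_eq_mul] at h2
  rw [inv_mul_lt_iff₀ h3] at h2
  linarith

lemma tendsto_sinh_half : Tendsto (fun ε : ℝ => sinh (ε / 2)) (𝓝[>] 0) (𝓝[>] 0) := by
  refine tendsto_nhdsWithin_iff.2 ⟨?_, ?_⟩
  · have : Continuous fun ε : ℝ => sinh (ε / 2) := by fun_prop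
    have := this.tendsto 0
    simp only [zero_div, sinh_zero] at this
    exact this.mono_left nhdsWithin_le_nhds
  · filter_upwards [self_mem_nhdsWithin] with ε h
    replace h : 0 < ε := h
    exact sinh_pos_iff.2 (by linarith)

variable [NormedSpace ℝ E] in
lemma eventually_lintegral_nearLevel_div_le {u : E → ℝ} (hu : Differentiable ℝ u)
    (hub : tsupport u ⊆ ball 0 1) {w : ℝ → ℝ} {x : E} (hx : x ∈ ball (0 : E) 1)
    (hwx : 0 ≤ w |u x|)
    (hw : ∀ e > 0, ∀ᶠ t in 𝓝[≥] |u x|, w t ≤ w |u x| + e) {e : ℝ} (he : 0 < e) :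
    ∀ᶠ ε in 𝓝[>] (0 : ℝ),
      (∫⁻ t in Ioi (0 : ℝ), (nearLevel u (sinh (ε / 2))).indicator
        (fun q => ENNReal.ofReal (w q.2)) (x, t)) / ENNReal.ofReal ε ≤
      ENNReal.ofReal ((w |u x| + e) * (((1 - ‖x‖ ^ 2) * ‖fderiv ℝ u x‖ + e) * (1 / 2 + e))) := by
  have hx1 := one_sub_norm_sq_pos hx
  set m := (1 - ‖x‖ ^ 2) * ‖fderiv ℝ u x‖ + e with hm
  have hm0 : 0 < m := by positivity
  have h1 := tendsto_sinh_half.eventually (eventually_abs_le_of_hypNear hu hx he)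
  have h2 := eventually_sinh_half_le (c := 1 / 2 + e) (by linarith)
  obtain ⟨b, hb, hbw⟩ := mem_nhdsGE_iff_exists_Ico_subset.1 (hw e he)
  have h3 : ∀ᶠ ε in 𝓝[>] (0 : ℝ), m * sinh (ε / 2) < b - |u x| := by
    have : Tendsto (fun ε : ℝ => m * sinh (ε / 2)) (𝓝[>] 0) (𝓝 (m * 0)) :=
      (tendsto_sinh_half.mono_right nhdsWithin_le_nhds).const_mul m
    rw [mul_zero] at this
    exact this.eventually_lt_const (sub_pos.2 hb)
  filter_upwards [h1, h2, h3, self_mem_nhdsWithin] with ε h1 h2 h3 hε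
  replace hε : 0 < ε := hε
  refine (ENNReal.div_le_div_right (lintegral_nearLevel_le h1 hub
    (c := w |u x| + e) fun t ht ht' _ => hbw ⟨ht, by linarith⟩) _).trans ?_
  rw [← ENNReal.ofReal_mul (by positivity), ← ENNReal.ofReal_div_of_pos hε]
  refine ENNReal.ofReal_le_ofReal ?_
  rw [div_le_iff₀ hε]
  calc (w |u x| + e) * (m * sinh (ε / 2)) ≤ (w |u x| + e) * (m * ((1 / 2 + e) * ε)) := by gcongr
    _ = _ := by ring

variable [NormedSpace ℝ E] in
lemma limsup_lintegral_nearLevel_div_le {u : E → ℝ} (hu : Differentiable ℝ u)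
    (hub : tsupport u ⊆ ball 0 1) {w : ℝ → ℝ} {x : E} (hx : x ∈ ball (0 : E) 1)
    (hwx : 0 ≤ w |u x|)
    (hw : ∀ e > 0, ∀ᶠ t in 𝓝[≥] |u x|, w t ≤ w |u x| + e) {s : ℕ → ℝ}
    (hs : Tendsto s atTop (𝓝[>] 0)) :
    limsup (fun k => (∫⁻ t in Ioi (0 : ℝ), (nearLevel u (sinh (s k / 2))).indicator
        (fun q => ENNReal.ofReal (w q.2)) (x, t)) / ENNReal.ofReal (s k)) atTop ≤
      ENNReal.ofReal (w |u x| * ((1 - ‖x‖ ^ 2) / 2 * ‖fderiv ℝ u x‖)) := by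
  set F : ℝ → ℝ≥0∞ := fun e => ENNReal.ofReal
    ((w |u x| + e) * (((1 - ‖x‖ ^ 2) * ‖fderiv ℝ u x‖ + e) * (1 / 2 + e))) with hF
  have hFc : Continuous F := ENNReal.continuous_ofReal.comp (by fun_prop)
  have h0 : F 0 = ENNReal.ofReal (w |u x| * ((1 - ‖x‖ ^ 2) / 2 * ‖fderiv ℝ u x‖)) := by
    simp only [hF]; congr 1; ring
  rw [← h0]
  refine ge_of_tendsto ((hFc.tendsto 0).mono_left (nhdsWithin_le_nhds (s := Ioi 0))) ?_
  filter_upwards [self_mem_nhdsWithin] with e he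
  exact limsup_le_of_le (h := hs.eventually
    (eventually_lintegral_nearLevel_div_le hu hub hx hwx hw he))

variable [InnerProductSpace ℝ E] [FiniteDimensional ℝ E] [MeasurableSpace E] [BorelSpace E]

/-- Superlevel-set isoperimetry: the weighted coarea inequality with the isoperimetric profile. -/
theorem lintegral_mul_profile_le {u : E → ℝ} (hu : ContDiff ℝ 1 u) {r₀ : ℝ} (hr₀ : r₀ < 1)
    (hsupp : tsupport u ⊆ closedBall 0 r₀) (hn : 2 ≤ finrank ℝ E) {p : ℝ}
    (hp : 2 * (finrank ℝ E : ℝ) / (finrank ℝ E - 1) ≤ p) {w : ℝ → ℝ} (hw : Measurable w)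
    (hw0 : ∀ t, 0 ≤ t → 0 ≤ w t) {W : ℝ} (hwW : ∀ t, 0 ≤ t → (∃ y, t < |u y|) → w t ≤ W)
    (hwusc : ∀ t, 0 ≤ t → ∀ e > 0, ∀ᶠ t' in 𝓝[≥] t, w t' ≤ w t + e) :
    ∫⁻ t in Ioi (0 : ℝ), ENNReal.ofReal (w t) *
      ENNReal.ofReal (profile (finrank ℝ E) p (volume.real (ball (0 : E) 1))
        (hypVol.real {x | t < |u x|})) ≤
    ∫⁻ x, ENNReal.ofReal (w |u x| * ((1 - ‖x‖ ^ 2) / 2 * ‖fderiv ℝ u x‖)) ∂hypVol := by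
  have hub : tsupport u ⊆ ball 0 1 := hsupp.trans (closedBall_subset_ball hr₀)
  have hcs : HasCompactSupport u :=
    (isCompact_closedBall (0 : E) r₀).of_isClosed_subset (isClosed_tsupport u) hsupp
  obtain ⟨C, hC⟩ := hu.lipschitzWith_of_hasCompactSupport hcs one_ne_zero
  have hud : Differentiable ℝ u := hu.differentiable one_ne_zero
  set r₁ := (1 + r₀) / 2 with hr₁
  obtain ⟨s, hs, hsk⟩ := exists_seq_forall_of_frequently
    (((eventually_sinh_half_le (c := 1) (by norm_num)).and
      ((tendsto_sinh_half.mono_right nhdsWithin_le_nhds).eventually_lt_const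
        (show (0 : ℝ) < (1 - r₀) / 2 by linarith))).and
      (self_mem_nhdsWithin (a := (0 : ℝ)) (s := Ioi 0))).frequently
  have hs0 : ∀ k, 0 < s k := fun k => (hsk k).2
  set f : ℕ → E → ℝ≥0∞ := fun k x => (∫⁻ t in Ioi (0 : ℝ),
    (nearLevel u (sinh (s k / 2))).indicator (fun q => ENNReal.ofReal (w q.2)) (x, t)) /
      ENNReal.ofReal (s k) with hf
  set g : E → ℝ≥0∞ := (closedBall (0 : E) r₁).indicator
    fun _ => ENNReal.ofReal W * ENNReal.ofReal C with hg
  have hfm : ∀ k, Measurable (f k) := by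
    intro k
    have hmeas : Measurable ((nearLevel u (sinh (s k / 2))).indicator
        (fun q => ENNReal.ofReal (w q.2))) :=
      (ENNReal.measurable_ofReal.comp (hw.comp measurable_snd)).indicator
        (measurableSet_nearLevel hu.continuous _)
    exact hmeas.lintegral_prod_right'.div_const _
  have hfg : ∀ k, f k ≤ᵐ[hypVol] g := by
    intro k
    filter_upwards [ae_hypVol_mem_ball] with x hx
    have hη0 : 0 < sinh (s k / 2) := sinh_pos_iff.2 (by linarith [hs0 k])
    by_cases hxr : x ∈ closedBall (0 : E) r₁
    · have h1 := lintegral_nearLevel_le (u := u) (w := w) (x := x) (η := sinh (s k / 2))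
        (κ := C * sinh (s k / 2)) (c := W) (fun y hy hxy => by
          have h2 := hC.dist_le_mul y x
          rw [Real.dist_eq, dist_eq_norm, norm_sub_rev] at h2
          have h3 := hxy.norm_sub_lt hη0.le hx hy
          have h4 : |u y| ≤ |u x| + |u y - u x| := by
            have := abs_add_le (u x) (u y - u x)
            rwa [add_sub_cancel] at this
          have : (C : ℝ) * ‖x - y‖ ≤ C * sinh (s k / 2) := by gcongr
          linarith) hub (fun t ht _ hy => hwW t ((abs_nonneg _).trans ht) hy)
      rw [hg, indicator_of_mem hxr]
      refine (ENNReal.div_le_div_right h1 _).trans ?_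
      rw [mul_div_assoc]
      gcongr
      rw [← ENNReal.ofReal_div_of_pos (hs0 k)]
      refine ENNReal.ofReal_le_ofReal ?_
      rw [div_le_iff₀ (hs0 k)]
      have := (hsk k).1.1
      rw [one_mul] at this
      gcongr
    · have h1 : ∫⁻ t in Ioi (0 : ℝ), (nearLevel u (sinh (s k / 2))).indicator
          (fun q => ENNReal.ofReal (w q.2)) (x, t) = 0 := by
        refine setLIntegral_eq_zero measurableSet_Ioi fun t ht => indicator_of_notMem ?_ _
        rintro ⟨-, -, y, hy, hxy⟩
        have hyr : y ∈ closedBall (0 : E) r₀ :=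
          hsupp (subset_tsupport u (abs_pos.1 (lt_trans ht hy)))
        have h3 := hxy.norm_sub_lt hη0.le hx (closedBall_subset_ball hr₀ hyr)
        have h4 := (hsk k).1.2
        rw [mem_closedBall_zero_iff] at hyr hxr
        have : ‖x‖ ≤ ‖x - y‖ + ‖y‖ := by simpa using norm_add_le (x - y) y
        exact hxr (by rw [hr₁]; linarith)
      simp only [hf]
      rw [h1, ENNReal.zero_div]
      exact zero_le
  have hgfin : ∫⁻ x, g x ∂hypVol ≠ ∞ := by
    rw [hg, lintegral_indicator measurableSet_closedBall, setLIntegral_const]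
    exact ENNReal.mul_ne_top (by finiteness) (hypVol_closedBall_lt_top (by linarith)).ne
  have hlow : ∀ k, ∫⁻ t in Ioi (0 : ℝ), ENNReal.ofReal (w t) *
      ENNReal.ofReal (profile (finrank ℝ E) p (volume.real (ball (0 : E) 1))
        (hypVol.real {x | t < |u x|})) ≤ ∫⁻ x, f k x ∂hypVol := by
    intro k
    have hsk0 : ENNReal.ofReal (s k) ≠ 0 := by simpa using hs0 k
    have h1 := lintegral_mul_le_lintegral_nearLevel hu.continuous hr₀ hsupp hn hp hw (hs0 k)
    simp only [hf, div_eq_mul_inv]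
    rw [lintegral_mul_const' _ _ (ENNReal.inv_ne_top.2 hsk0), ← div_eq_mul_inv,
      ENNReal.le_div_iff_mul_le (Or.inl hsk0) (Or.inl ENNReal.ofReal_ne_top), mul_comm]
    exact h1
  calc _ ≤ limsup (fun k => ∫⁻ x, f k x ∂hypVol) atTop :=
        le_limsup_of_frequently_le (Eventually.of_forall hlow).frequently
    _ ≤ ∫⁻ x, limsup (fun k => f k x) atTop ∂hypVol := limsup_lintegral_le g hfm hfg hgfin
    _ ≤ _ := by
        refine lintegral_mono_ae ?_
        filter_upwards [ae_hypVol_mem_ball] with x hx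
        exact limsup_lintegral_nearLevel_div_le hud hub hx (hw0 _ (abs_nonneg _))
          (hwusc _ (abs_nonneg _)) hs

end CoareaLimit

section Rearrangement

variable {X : Type*} [MeasurableSpace X] {ν : Measure X} {f : X → ℝ}

/-- The decreasing rearrangement of `f` with respect to `ν`. -/
noncomputable def decRearr (ν : Measure X) (f : X → ℝ) (s : ℝ) : ℝ :=
  sSup {t | 0 ≤ t ∧ s < ν.real {x | t < f x}}

lemma antitone_measureReal_lt (hfin : ν {x | 0 < f x} ≠ ∞) :
    AntitoneOn (fun t => ν.real {x | t < f x}) (Ici 0) := fun _ hs _ _ hst =>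
  measureReal_mono (fun _ hx => lt_of_le_of_lt hst hx)
    (ne_top_of_le_ne_top hfin (measure_mono fun x hx =>
      show 0 < f x from lt_of_le_of_lt (mem_Ici.1 hs) hx))

lemma exists_gt_lt_measureReal (hfin : ν {x | 0 < f x} ≠ ∞) {s t : ℝ} (ht : 0 ≤ t)
    (h : s < ν.real {x | t < f x}) : ∃ t' > t, s < ν.real {x | t' < f x} := by
  have hU : {x | t < f x} = ⋃ k : ℕ, {x | t + 1 / ((k : ℝ) + 1) < f x} := by
    ext x
    simp only [mem_ofPred_eq, mem_iUnion]
    constructor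
    · intro hx
      obtain ⟨k, hk⟩ := exists_nat_one_div_lt (sub_pos.2 hx)
      exact ⟨k, by linarith⟩
    · rintro ⟨k, hk⟩
      have : (0 : ℝ) < 1 / ((k : ℝ) + 1) := by positivity
      linarith
  have hmono : Monotone fun k : ℕ => {x | t + 1 / ((k : ℝ) + 1) < f x} := by
    intro j k hjk x hx
    have : 1 / ((k : ℝ) + 1) ≤ 1 / ((j : ℝ) + 1) := Nat.one_div_le_one_div hjk
    simp only [mem_ofPred_eq] at hx ⊢
    linarith
  have h1 := tendsto_measure_iUnion_atTop (μ := ν) hmono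
  rw [← hU] at h1
  have h2 : ν {x | t < f x} ≠ ∞ :=
    ne_top_of_le_ne_top hfin (measure_mono fun x hx => lt_of_le_of_lt ht hx)
  have h3 := (ENNReal.tendsto_toReal h2).comp h1
  obtain ⟨k, hk⟩ := (h3.eventually_const_lt h).exists
  exact ⟨t + 1 / ((k : ℝ) + 1), by simp only [gt_iff_lt, lt_add_iff_pos_right]; positivity, hk⟩

lemma lt_decRearr_iff (hfin : ν {x | 0 < f x} ≠ ∞) {M : ℝ} (hM : ∀ x, f x ≤ M) {s t : ℝ}
    (hs : 0 ≤ s) (ht : 0 ≤ t) : t < decRearr ν f s ↔ s < ν.real {x | t < f x} := by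
  have hbdd : BddAbove {t | 0 ≤ t ∧ s < ν.real {x | t < f x}} := by
    refine ⟨M, fun t' ht' => ?_⟩
    by_contra! hlt
    have : {x | t' < f x} = ∅ := eq_empty_of_forall_notMem fun x hx =>
      absurd (hM x) (not_le.2 (hlt.trans hx))
    have h2 := ht'.2
    rw [this] at h2
    simp only [measureReal_empty] at h2
    linarith
  constructor
  · intro h
    have hne : {t | 0 ≤ t ∧ s < ν.real {x | t < f x}}.Nonempty := by
      by_contra hne
      rw [decRearr, not_nonempty_iff_eq_empty.1 hne, Real.sSup_empty] at h
      linarith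
    obtain ⟨t', ⟨ht'0, ht'⟩, htt⟩ := exists_lt_of_lt_csSup hne h
    exact ht'.trans_le (antitone_measureReal_lt hfin ht ht'0 htt.le)
  · intro h
    obtain ⟨t', htt, ht'⟩ := exists_gt_lt_measureReal hfin ht h
    exact htt.trans_le (le_csSup hbdd ⟨ht.trans htt.le, ht'⟩)

lemma decRearr_nonneg (s : ℝ) : 0 ≤ decRearr ν f s := Real.sSup_nonneg fun _ h => h.1

lemma decRearr_of_neg {s : ℝ} (hs : s < 0) : decRearr ν f s = 0 := by
  refine Real.sSup_of_not_bddAbove ?_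
  rintro ⟨B, hB⟩
  have := hB (a := |B| + 1) ⟨by positivity, hs.trans_le measureReal_nonneg⟩
  linarith [le_abs_self B]

lemma decRearr_pos (hfin : ν {x | 0 < f x} ≠ ∞) {M : ℝ} (hM : ∀ x, f x ≤ M) {s : ℝ}
    (hs : s ∈ Ioo 0 (ν.real {x | 0 < f x})) : 0 < decRearr ν f s :=
  (lt_decRearr_iff hfin hM hs.1.le le_rfl).2 hs.2

lemma measurable_decRearr (hfin : ν {x | 0 < f x} ≠ ∞) {M : ℝ} (hM : ∀ x, f x ≤ M) :
    Measurable (decRearr ν f) := by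
  refine measurable_of_Ioi fun t => ?_
  rcases lt_or_ge t 0 with ht | ht
  · have : decRearr ν f ⁻¹' Ioi t = univ :=
      eq_univ_of_forall fun s => ht.trans_le (decRearr_nonneg s)
    rw [this]
    exact .univ
  · have : decRearr ν f ⁻¹' Ioi t = Ico 0 (ν.real {x | t < f x}) := by
      ext s
      rcases lt_or_ge s 0 with hs | hs
      · simp [decRearr_of_neg hs, hs.not_ge, ht.not_gt]
      · simp [lt_decRearr_iff hfin hM hs ht, hs]
    rw [this]
    exact measurableSet_Ico

/-- `f` and its decreasing rearrangement are equimeasurable. -/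
lemma lintegral_comp_decRearr (hf : Measurable f) (hfin : ν {x | 0 < f x} ≠ ∞) {M : ℝ}
    (hM : ∀ x, f x ≤ M) {F : ℝ → ℝ≥0∞} (hF : Measurable F) :
    ∫⁻ x in {x | 0 < f x}, F (f x) ∂ν =
      ∫⁻ s in Ioo 0 (ν.real {x | 0 < f x}), F (decRearr ν f s) := by
  have hφ := measurable_decRearr hfin hM
  set S := ν.real {x | 0 < f x} with hS
  set κ₁ := (ν.restrict {x | 0 < f x}).map f with hκ₁
  set κ₂ := (volume.restrict (Ioo 0 S)).map (decRearr ν f) with hκ₂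
  have : IsFiniteMeasure (ν.restrict {x | 0 < f x}) :=
    ⟨by rw [Measure.restrict_apply_univ]; exact hfin.lt_top⟩
  have hpos : MeasurableSet {x | 0 < f x} := measurableSet_lt measurable_const hf
  have hIoi : ∀ t, 0 ≤ t → κ₁ (Ioi t) = κ₂ (Ioi t) := by
    intro t ht
    rw [hκ₁, hκ₂, Measure.map_apply hf measurableSet_Ioi, Measure.map_apply hφ measurableSet_Ioi,
      Measure.restrict_apply (hf measurableSet_Ioi), Measure.restrict_apply (hφ measurableSet_Ioi)]
    have e1 : f ⁻¹' Ioi t ∩ {x | 0 < f x} = {x | t < f x} := by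
      ext x
      simp only [mem_inter_iff, mem_preimage, mem_Ioi, mem_ofPred_eq, and_iff_left_iff_imp]
      exact fun h => ht.trans_lt h
    have e2 : decRearr ν f ⁻¹' Ioi t ∩ Ioo 0 S = Ioo 0 (ν.real {x | t < f x}) := by
      ext s
      simp only [mem_inter_iff, mem_preimage, mem_Ioi, mem_Ioo]
      constructor
      · rintro ⟨h1, h2, h3⟩
        exact ⟨h2, (lt_decRearr_iff hfin hM h2.le ht).1 h1⟩
      · rintro ⟨h1, h2⟩
        exact ⟨(lt_decRearr_iff hfin hM h1.le ht).2 h2, h1,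
          h2.trans_le (antitone_measureReal_lt hfin self_mem_Ici ht ht)⟩
    have h2 : ν {x | t < f x} ≠ ∞ :=
      ne_top_of_le_ne_top hfin (measure_mono fun x hx => lt_of_le_of_lt ht hx)
    rw [e1, e2, Real.volume_Ioo, sub_zero, ofReal_measureReal h2]
  have hIic0 : κ₁ (Iic 0) = 0 ∧ κ₂ (Iic 0) = 0 := by
    constructor
    · rw [hκ₁, Measure.map_apply hf measurableSet_Iic,
        Measure.restrict_apply (hf measurableSet_Iic)]
      convert measure_empty (μ := ν)
      ext x; simp
    · rw [hκ₂, Measure.map_apply hφ measurableSet_Iic,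
        Measure.restrict_apply (hφ measurableSet_Iic)]
      convert measure_empty (μ := (volume : Measure ℝ))
      ext s
      simp only [mem_inter_iff, mem_preimage, mem_Iic, mem_empty_iff_false, iff_false, not_and]
      exact fun h1 h2 => absurd (decRearr_pos hfin hM h2) (not_lt.2 h1)
  have huniv : ∀ t : ℝ, Iic t ∪ Ioi t = univ := fun t => Iic_union_Ioi
  have hsplit : ∀ κ : Measure ℝ, ∀ t, κ univ = κ (Iic t) + κ (Ioi t) := fun κ t => by
    rw [← huniv t, measure_union (Iic_disjoint_Ioi le_rfl) measurableSet_Ioi]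
  have hmass : κ₁ univ = κ₂ univ := by
    rw [hsplit κ₁ 0, hsplit κ₂ 0, hIic0.1, hIic0.2, hIoi 0 le_rfl]
  have hκ : κ₁ = κ₂ := by
    refine Measure.ext_of_Iic _ _ fun t => ?_
    rcases lt_or_ge t 0 with ht | ht
    · rw [measure_mono_null (Iic_subset_Iic.2 ht.le) hIic0.1,
        measure_mono_null (Iic_subset_Iic.2 ht.le) hIic0.2]
    · have h1 := hsplit κ₁ t
      rw [hmass, hsplit κ₂ t, hIoi t ht] at h1
      exact ((ENNReal.add_left_inj (measure_ne_top κ₂ _)).1 h1).symm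
  calc _ = ∫⁻ t, F t ∂κ₁ := (lintegral_map hF hf).symm
    _ = ∫⁻ t, F t ∂κ₂ := by rw [hκ]
    _ = _ := lintegral_map hF hφ

end Rearrangement

section Transport

/-- The primitive of an integrable density which is positive on `(0, S)` and vanishes outside
`[0, S]`. -/
lemma primitive_facts {a : ℝ → ℝ} {S : ℝ} (ha : Integrable a)
    (ha0 : ∀ s, 0 ≤ a s) (hpos : ∀ s ∈ Ioo 0 S, 0 < a s) (hzero : ∀ s ∉ Icc 0 S, a s = 0) :
    Continuous (fun s => ∫ x in (0 : ℝ)..s, a x) ∧ Monotone (fun s => ∫ x in (0 : ℝ)..s, a x) ∧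
    StrictMonoOn (fun s => ∫ x in (0 : ℝ)..s, a x) (Icc 0 S) ∧
    (∀ s, 0 ≤ s → volume.withDensity (fun x => ENNReal.ofReal (a x)) (Iic s) =
      ENNReal.ofReal (∫ x in (0 : ℝ)..s, a x)) ∧
    (∀ s < 0, volume.withDensity (fun x => ENNReal.ofReal (a x)) (Iic s) = 0) ∧
    (∀ s, S ≤ s → ∫ x in (0 : ℝ)..s, a x = ∫ x in (0 : ℝ)..S, a x) ∧
    (∀ s ≤ 0, ∫ x in (0 : ℝ)..s, a x = 0) := by
  have hii : ∀ c d, IntervalIntegrable a volume c d := fun c d => ha.intervalIntegrable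
  have hsub : ∀ c d, (∫ x in (0 : ℝ)..d, a x) - ∫ x in (0 : ℝ)..c, a x = ∫ x in c..d, a x :=
    fun c d => intervalIntegral.integral_interval_sub_left (hii _ _) (hii _ _)
  have hIic : ∀ s < 0, volume.withDensity (fun x => ENNReal.ofReal (a x)) (Iic s) = 0 := by
    intro s hs
    rw [withDensity_apply _ measurableSet_Iic]
    refine setLIntegral_eq_zero measurableSet_Iic fun x hx => ?_
    have hx' : x ≤ s := hx
    simp [hzero x (fun h => by linarith [h.1])]
  have hIio : volume.withDensity (fun x => ENNReal.ofReal (a x)) (Iio 0) = 0 := by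
    rw [withDensity_apply _ measurableSet_Iio]
    refine setLIntegral_eq_zero measurableSet_Iio fun x hx => ?_
    have hx' : x < 0 := hx
    simp [hzero x (fun h => by linarith [h.1])]
  refine ⟨intervalIntegral.continuous_primitive hii 0, fun c d hcd => ?_, fun c hc d hd hcd => ?_,
    fun s hs => ?_, hIic, fun s hs => ?_, fun s hs => ?_⟩
  · have h1 := hsub c d
    have h2 := intervalIntegral.integral_nonneg (μ := volume) hcd (fun x _ => ha0 x)
    simp only
    linarith
  · have h1 := hsub c d
    have h2 := intervalIntegral.intervalIntegral_pos_of_pos_on (hii c d)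
      (fun x hx => hpos x ⟨hc.1.trans_lt hx.1, hx.2.trans_le hd.2⟩) hcd
    simp only
    linarith
  · have hd : Disjoint (Iio 0) (Icc 0 s) :=
      disjoint_left.2 fun x h1 h2 => absurd h1 (not_lt.2 h2.1)
    rw [← Iio_union_Icc_eq_Iic hs, measure_union hd measurableSet_Icc, hIio, zero_add,
      withDensity_apply _ measurableSet_Icc, setLIntegral_congr Ioc_ae_eq_Icc.symm,
      intervalIntegral.integral_of_le hs,
      ofReal_integral_eq_lintegral_ofReal ha.integrableOn (Eventually.of_forall ha0)]
  · rw [← sub_eq_zero, hsub S s, intervalIntegral.integral_of_le hs]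
    exact setIntegral_eq_zero_of_forall_eq_zero fun x hx =>
      hzero x fun h => absurd hx.1 (not_lt.2 h.2)
  · rw [intervalIntegral.integral_symm, intervalIntegral.integral_of_le hs, neg_eq_zero,
      setIntegral_congr_set Ioo_ae_eq_Ioc.symm]
    exact setIntegral_eq_zero_of_forall_eq_zero fun x hx =>
      hzero x fun h => absurd hx.2 (not_lt.2 h.1)

/-- Monotone transport between two densities on the line with the same total mass. -/
lemma exists_monotone_transport {a b : ℝ → ℝ} {S ρ : ℝ} (hS : 0 < S) (hρ : 0 < ρ)
    (ha : Integrable a) (ha0 : ∀ s, 0 ≤ a s) (hapos : ∀ s ∈ Ioo 0 S, 0 < a s)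
    (hazero : ∀ s ∉ Icc 0 S, a s = 0) (hb : Integrable b) (hb0 : ∀ s, 0 ≤ b s)
    (hbpos : ∀ s ∈ Ioo 0 ρ, 0 < b s) (hbzero : ∀ s ∉ Icc 0 ρ, b s = 0)
    (hab : ∫⁻ s, ENNReal.ofReal (a s) = ∫⁻ r, ENNReal.ofReal (b r)) :
    ∃ R : ℝ → ℝ, Monotone R ∧ (∀ s, R s ∈ Icc 0 ρ) ∧ StrictMonoOn R (Icc 0 S) ∧
      ∀ F : ℝ → ℝ≥0∞, Measurable F → ∫⁻ s, ENNReal.ofReal (a s) * F (R s) =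
        ∫⁻ r, ENNReal.ofReal (b r) * F r := by
  obtain ⟨hNc, hNm, hNs, hN1, hN2, hN3, hN4⟩ := primitive_facts ha ha0 hapos hazero
  obtain ⟨hGc, hGm, hGs, hG1, hG2, hG3, hG4⟩ := primitive_facts hb hb0 hbpos hbzero
  set N := fun s => ∫ x in (0 : ℝ)..s, a x with hN
  set G := fun s => ∫ x in (0 : ℝ)..s, b x with hG
  set κ₁ := volume.withDensity (fun x => ENNReal.ofReal (a x)) with hκ₁
  set κ₂ := volume.withDensity (fun x => ENNReal.ofReal (b x)) with hκ₂
  replace hN1 : ∀ s, 0 ≤ s → κ₁ (Iic s) = ENNReal.ofReal (N s) := hN1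
  replace hG1 : ∀ s, 0 ≤ s → κ₂ (Iic s) = ENNReal.ofReal (G s) := hG1
  replace hN3 : ∀ s, S ≤ s → N s = N S := hN3
  replace hG3 : ∀ s, ρ ≤ s → G s = G ρ := hG3
  replace hN4 : ∀ s ≤ 0, N s = 0 := hN4
  replace hG4 : ∀ s ≤ 0, G s = 0 := hG4
  have hfin₁ : IsFiniteMeasure κ₁ :=
    isFiniteMeasure_withDensity_ofReal ha.2
  have hmass : κ₁ univ = κ₂ univ := by
    rw [hκ₁, hκ₂, withDensity_apply _ .univ, withDensity_apply _ .univ, Measure.restrict_univ, hab]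
  have htop : ∀ {c : ℝ → ℝ} {L : ℝ}, (∀ s ∉ Icc 0 L, c s = 0) →
      volume.withDensity (fun x => ENNReal.ofReal (c x)) univ =
      volume.withDensity (fun x => ENNReal.ofReal (c x)) (Iic L) := by
    intro c L hc
    have h0 : volume.withDensity (fun x => ENNReal.ofReal (c x)) (Ioi L) = 0 := by
      rw [withDensity_apply _ measurableSet_Ioi]
      refine setLIntegral_eq_zero measurableSet_Ioi fun x hx => ?_
      simp [hc x (fun h => absurd hx (not_lt.2 h.2))]
    rw [← Iic_union_Ioi (a := L), measure_union (Iic_disjoint_Ioi le_rfl) measurableSet_Ioi, h0,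
      add_zero]
  have hNG : N S = G ρ := by
    have h1 : ENNReal.ofReal (N S) = ENNReal.ofReal (G ρ) := by
      rw [← hN1 S hS.le, ← hG1 ρ hρ.le, ← htop hazero, ← htop hbzero]
      exact hmass
    have h2 : 0 ≤ N S := (hN4 0 le_rfl).symm.le.trans (hNm hS.le)
    have h3 : 0 ≤ G ρ := (hG4 0 le_rfl).symm.le.trans (hGm hρ.le)
    exact (ENNReal.ofReal_eq_ofReal_iff h2 h3).1 h1
  have hN0 : ∀ s, 0 ≤ N s := fun s => by
    rcases le_total s 0 with h | h
    · exact (hN4 s h).symm.le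
    · exact (hN4 0 le_rfl).symm.le.trans (hNm h)
  have hNle : ∀ s, N s ≤ G ρ := fun s => by
    rw [← hNG]
    rcases le_total s S with h | h
    · exact hNm h
    · exact (hN3 s h).le
  have hex : ∀ s, ∃ r ∈ Icc 0 ρ, G r = N s := fun s =>
    intermediate_value_Icc hρ.le hGc.continuousOn ⟨by rw [hG4 0 le_rfl]; exact hN0 s, hNle s⟩
  choose R hR hGR using hex
  have hRm : Monotone R := fun s t hst => by
    rw [← hGs.le_iff_le (hR s) (hR t)]
    change G (R s) ≤ G (R t)
    rw [hGR, hGR]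
    exact hNm hst
  have hRs : StrictMonoOn R (Icc 0 S) := fun s hs t ht hst => by
    rw [← hGs.lt_iff_lt (hR s) (hR t)]
    change G (R s) < G (R t)
    rw [hGR, hGR]
    exact hNs hs ht hst
  refine ⟨R, hRm, hR, hRs, fun F hF => ?_⟩
  have hκ : κ₁.map R = κ₂ := by
    refine Measure.ext_of_Iic _ _ fun r => ?_
    rw [Measure.map_apply hRm.measurable measurableSet_Iic]
    rcases lt_or_ge r 0 with hr | hr
    · rw [hG2 r hr]
      convert measure_empty (μ := κ₁)
      exact eq_empty_of_forall_notMem fun s hs => absurd ((hR s).1.trans hs) (not_le.2 hr)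
    rcases le_or_gt ρ r with hr' | hr'
    · rw [hG1 r hr, hG3 r hr', ← hG1 ρ hρ.le, ← htop hbzero, ← hκ₂, ← hmass]
      congr 1
      exact eq_univ_of_forall fun s => (hR s).2.trans hr'
    · obtain ⟨t, ht, htr⟩ : ∃ t ∈ Icc 0 S, N t = G r :=
        intermediate_value_Icc hS.le hNc.continuousOn ⟨by
          rw [hN4 0 le_rfl]; exact (hG4 0 le_rfl).symm.le.trans (hGm hr), by
          rw [hNG]; exact hGm hr'.le⟩
      have htS : t < S := by
        refine lt_of_le_of_ne ht.2 fun h => ?_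
        have := hGs (a := r) ⟨hr, hr'.le⟩ ⟨hρ.le, le_rfl⟩ hr'
        change G r < G ρ at this
        rw [← htr, h, hNG] at this
        exact lt_irrefl _ this
      rw [hG1 r hr, ← htr, ← hN1 t ht.1]
      congr 1
      ext s
      simp only [mem_preimage, mem_Iic]
      rw [← hGs.le_iff_le (hR s) ⟨hr, hr'.le⟩]
      change G (R s) ≤ G r ↔ _
      rw [hGR, ← htr]
      constructor
      · intro h
        by_contra! hlt
        have h1 : N t < N (min s S) := hNs ht ⟨ht.1.trans (le_min hlt.le htS.le), min_le_right _ _⟩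
          (lt_min hlt htS)
        have h2 : N (min s S) ≤ N s := hNm (min_le_left _ _)
        linarith
      · exact fun h => hNm h
  have hm : ∀ {c : ℝ → ℝ}, Integrable c → AEMeasurable (fun x => ENNReal.ofReal (c x)) :=
    fun hc => hc.1.aemeasurable.ennreal_ofReal
  have h1 : ∫⁻ s, (F ∘ R) s ∂κ₁ = ∫⁻ r, F r ∂κ₂ := by
    rw [← hκ, lintegral_map hF hRm.measurable]; rfl
  rw [hκ₁, hκ₂, lintegral_withDensity_eq_lintegral_mul₀ (hm ha)
    (hF.comp hRm.measurable).aemeasurable,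
    lintegral_withDensity_eq_lintegral_mul₀ (hm hb) hF.aemeasurable] at h1
  exact h1

end Transport

section TransportInequality

lemma transport_pointwise_le {d γ m q y g : ℝ} (hd : 0 < d) (hγ : 0 < γ) (hmq : m * (1 + γ) = q)
    (hy : 0 < y) (hg : 0 < g) :
    (1 + d * γ) * y ^ q ≤ d * γ * (y ^ q * (y ^ m / g) ^ (1 / d)) + y ^ m * g ^ γ := by
  have hD : 0 < 1 + d * γ := by positivity
  set w := d * γ / (1 + d * γ) with hw
  set v := 1 / (1 + d * γ) with hv
  have hwv : w + v = 1 := by rw [hw, hv]; field_simp; ring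
  have h1 := Real.geom_mean_le_arith_mean2_weighted (w₁ := w) (w₂ := v) (by positivity)
    (by positivity) (p₁ := y ^ q * (y ^ m / g) ^ (1 / d)) (p₂ := y ^ m * g ^ γ) (by positivity)
    (by positivity) hwv
  have h2 : (y ^ q * (y ^ m / g) ^ (1 / d)) ^ w * (y ^ m * g ^ γ) ^ v = y ^ q := by
    rw [Real.mul_rpow (by positivity) (by positivity), Real.mul_rpow (by positivity) (by positivity),
      ← Real.rpow_mul (x := y ^ m / g) (by positivity), Real.div_rpow (by positivity) hg.le,
      ← Real.rpow_mul hy.le, ← Real.rpow_mul hy.le, ← Real.rpow_mul hy.le, ← Real.rpow_mul hg.le]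
    have h3 : γ * v = 1 / d * w := by rw [hw, hv]; field_simp
    rw [h3]
    have h4 : g ^ (1 / d * w) ≠ 0 := (Real.rpow_pos_of_pos hg _).ne'
    have h5 : y ^ (q * w) * (y ^ (m * (1 / d * w)) / g ^ (1 / d * w)) *
        (y ^ (m * v) * g ^ (1 / d * w)) = y ^ (q * w) * y ^ (m * (1 / d * w)) * y ^ (m * v) := by
      field_simp
    rw [h5, ← Real.rpow_add hy, ← Real.rpow_add hy]
    congr 1
    rw [← h3, ← hmq]
    linear_combination m * (1 + γ) * hwv
  rw [h2] at h1
  calc (1 + d * γ) * y ^ q ≤ (1 + d * γ) * (w * (y ^ q * (y ^ m / g) ^ (1 / d)) +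
        v * (y ^ m * g ^ γ)) := by gcongr
    _ = _ := by rw [hw, hv]; field_simp

variable {X : Type*} [MeasurableSpace X] {ν : Measure X} {f : X → ℝ}

/-- One-dimensional transport step: the distribution function of `f` is transported to the radial
density `d ω r ^ (d - 1) g r`. -/
lemma exists_radius {d ω γ m q P M ρ : ℝ} {g : ℝ → ℝ} (hf : Measurable f) (hf0 : ∀ x, 0 ≤ f x)
    (hfin : ν {x | 0 < f x} ≠ ∞) (hM : ∀ x, f x ≤ M) (hS : 0 < ν.real {x | 0 < f x})
    (hd : 1 < d) (hω : 0 < ω) (hγ : 0 < γ) (hm : 0 < m) (hmq : m * (1 + γ) = q) (hP : 0 < P)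
    (hρ : 0 < ρ) (hg : Measurable g) (hgpos : ∀ r ∈ Ioo 0 ρ, 0 < g r)
    (hgint : IntegrableOn (fun r => d * ω * r ^ (d - 1) * g r) (Ioo 0 ρ))
    (hT : ∫⁻ x, ENNReal.ofReal (f x ^ m) ∂ν =
      ∫⁻ r in Ioo 0 ρ, ENNReal.ofReal (d * ω * r ^ (d - 1) * g r)) :
    ∃ R : ℝ → ℝ, Antitone R ∧ (∀ t, R t ∈ Icc 0 ρ) ∧
      ∫⁻ x, ENNReal.ofReal (f x ^ m * R (f x) ^ P) ∂ν ≤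
        ∫⁻ r in Ioo 0 ρ, ENNReal.ofReal (d * ω * r ^ (d - 1) * g r * r ^ P) ∧
      ENNReal.ofReal (1 + d * γ) * ∫⁻ x, ENNReal.ofReal (f x ^ q) ∂ν ≤
        (∫⁻ r in Ioo 0 ρ, ENNReal.ofReal (d * ω * r ^ (d - 1) * g r * g r ^ γ)) +
        ENNReal.ofReal (γ * q) * ∫⁻ t in Ioi (0 : ℝ), ENNReal.ofReal (t ^ (q - 1) * R t *
          (d * ω ^ (1 / d) * ν.real {x | t < f x} ^ (1 - 1 / d))) := by
  have hd0 : 0 < d := by linarith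
  have hq : 0 < q := by rw [← hmq]; positivity
  set S := ν.real {x | 0 < f x} with hSdef
  set φ := decRearr ν f with hφ
  have hφm : Measurable φ := measurable_decRearr hfin hM
  have hφ0 : ∀ s, 0 ≤ φ s := decRearr_nonneg
  have hφpos : ∀ s ∈ Ioo 0 S, 0 < φ s := fun s hs => decRearr_pos hfin hM hs
  set b : ℝ → ℝ := fun r => d * ω * r ^ (d - 1) * g r with hb
  have hbpos : ∀ r ∈ Ioo 0 ρ, 0 < b r := fun r hr => by
    have h1 := hgpos r hr
    have h2 : 0 < r := hr.1
    simp only [hb]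
    positivity
  have hpos : MeasurableSet {x | 0 < f x} := measurableSet_lt measurable_const hf
  -- integrals of functions vanishing with `f`
  have hrearr : ∀ F : ℝ → ℝ≥0∞, Measurable F → F 0 = 0 →
      ∫⁻ x, F (f x) ∂ν = ∫⁻ s in Ioo 0 S, F (φ s) := by
    intro F hF hF0
    rw [← lintegral_comp_decRearr hf hfin hM hF, ← lintegral_indicator hpos]
    refine lintegral_congr fun x => ?_
    by_cases hx : 0 < f x
    · rw [indicator_of_mem (show x ∈ {x | 0 < f x} from hx)]
    · rw [indicator_of_notMem (show x ∉ {x | 0 < f x} from hx),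
        le_antisymm (not_lt.1 hx) (hf0 x), hF0]
  have hrpm : ∀ c : ℝ, Measurable fun y : ℝ => y ^ c := fun c => by fun_prop
  have hlin_a : ∫⁻ s in Ioo 0 S, ENNReal.ofReal (φ s ^ m) =
      ∫⁻ r in Ioo 0 ρ, ENNReal.ofReal (b r) := by
    rw [← hT]
    exact (hrearr (fun y => ENNReal.ofReal (y ^ m)) (hrpm m).ennreal_ofReal
      (by simp [Real.zero_rpow hm.ne'])).symm
  have hbfin : ∫⁻ r in Ioo 0 ρ, ENNReal.ofReal (b r) ≠ ∞ :=
    (hgint.lintegral_lt_top).ne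
  have ha_int : IntegrableOn (fun s => φ s ^ m) (Ioo 0 S) := by
    refine ⟨((hrpm m).comp hφm).aestronglyMeasurable, ?_⟩
    rw [hasFiniteIntegral_iff_ofReal (Eventually.of_forall fun s => Real.rpow_nonneg (hφ0 s) _),
      hlin_a]
    exact hbfin.lt_top
  have hind : ∀ (c : ℝ → ℝ) (L : ℝ) (F : ℝ → ℝ≥0∞),
      ∫⁻ s, ENNReal.ofReal ((Ioo 0 L).indicator c s) * F s =
      ∫⁻ s in Ioo 0 L, ENNReal.ofReal (c s) * F s := by
    intro c L F
    rw [← lintegral_indicator measurableSet_Ioo]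
    refine lintegral_congr fun s => ?_
    by_cases hs : s ∈ Ioo 0 L
    · rw [indicator_of_mem hs, indicator_of_mem hs]
    · rw [indicator_of_notMem hs, indicator_of_notMem hs, ENNReal.ofReal_zero, zero_mul]
  have hmass : ∫⁻ s, ENNReal.ofReal ((Ioo 0 S).indicator (fun s => φ s ^ m) s) =
      ∫⁻ r, ENNReal.ofReal ((Ioo 0 ρ).indicator b r) := by
    have h1 := hind (fun s => φ s ^ m) S 1
    have h2 := hind b ρ 1
    simp only [Pi.one_apply, mul_one] at h1 h2
    rw [h1, h2, hlin_a]
  obtain ⟨R, hRm, hR, hRs, hkey⟩ := exists_monotone_transport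
    (a := (Ioo 0 S).indicator fun s => φ s ^ m) (b := (Ioo 0 ρ).indicator b) hS hρ
    (ha_int.integrable_indicator measurableSet_Ioo)
    (fun s => indicator_nonneg (fun s _ => Real.rpow_nonneg (hφ0 s) _) s)
    (fun s hs => by rw [indicator_of_mem hs]; exact Real.rpow_pos_of_pos (hφpos s hs) _)
    (fun s hs => indicator_of_notMem (fun h => hs (Ioo_subset_Icc_self h)) _)
    (hgint.integrable_indicator measurableSet_Ioo)
    (fun s => indicator_nonneg (fun r hr => (hbpos r hr).le) s)
    (fun s hs => by rw [indicator_of_mem hs]; exact hbpos s hs)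
    (fun s hs => indicator_of_notMem (fun h => hs (Ioo_subset_Icc_self h)) _)
    hmass
  have hkey' : ∀ F : ℝ → ℝ≥0∞, Measurable F →
      ∫⁻ s in Ioo 0 S, ENNReal.ofReal (φ s ^ m) * F (R s) =
      ∫⁻ r in Ioo 0 ρ, ENNReal.ofReal (b r) * F r := by
    intro F hF
    rw [← hind, ← hind]
    exact hkey F hF
  have hRpos : ∀ s ∈ Ioo 0 S, R s ∈ Ioo 0 ρ := fun s hs =>
    ⟨(hR 0).1.trans_lt (hRs ⟨le_rfl, hS.le⟩ (Ioo_subset_Icc_self hs) hs.1),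
      (hRs (Ioo_subset_Icc_self hs) ⟨hS.le, le_rfl⟩ hs.2).trans_le (hR S).2⟩
  set μ : ℝ → ℝ := fun t => ν.real {x | max t 0 < f x} with hμ
  have hμt : ∀ t, 0 ≤ t → μ t = ν.real {x | t < f x} := fun t ht => by
    simp only [hμ, max_eq_left ht]
  have hμanti : Antitone μ := fun s t hst =>
    antitone_measureReal_lt hfin (le_max_right s 0) (le_max_right t 0) (max_le_max_right 0 hst)
  have hμ0 : ∀ t, 0 ≤ μ t := fun t => measureReal_nonneg
  have hμS : ∀ t, μ t ≤ S := fun t =>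
    antitone_measureReal_lt hfin self_mem_Ici (le_max_right t 0) (le_max_right t 0)
  have hRμ : Antitone fun t => R (μ t) := fun s t hst => hRm (hμanti hst)
  refine ⟨fun t => R (μ t), hRμ, fun t => hR _, ?_, ?_⟩
  · rw [hrearr (fun y => ENNReal.ofReal (y ^ m * R (μ y) ^ P))
      (((hrpm m).mul ((hrpm P).comp hRμ.measurable)).ennreal_ofReal)
      (by simp [Real.zero_rpow hm.ne'])]
    calc _ ≤ ∫⁻ s in Ioo 0 S, ENNReal.ofReal (φ s ^ m) * ENNReal.ofReal (R s ^ P) := by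
          refine setLIntegral_mono' measurableSet_Ioo fun s hs => ?_
          rw [← ENNReal.ofReal_mul (Real.rpow_nonneg (hφ0 s) _)]
          refine ENNReal.ofReal_le_ofReal ?_
          have h1 : μ (φ s) ≤ s := by
            rw [hμt _ (hφ0 s)]
            exact not_lt.1 fun h =>
              lt_irrefl _ ((lt_decRearr_iff hfin hM hs.1.le (hφ0 s)).2 h)
          have h2 := hRm h1
          have h3 := (hR (μ (φ s))).1
          have h4 := Real.rpow_nonneg (hφ0 s) m
          gcongr
      _ = ∫⁻ r in Ioo 0 ρ, ENNReal.ofReal (b r) * ENNReal.ofReal (r ^ P) :=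
          hkey' (fun r => ENNReal.ofReal (r ^ P)) (hrpm P).ennreal_ofReal
      _ = _ := setLIntegral_congr_fun measurableSet_Ioo fun r hr =>
          (ENNReal.ofReal_mul (hbpos r hr).le).symm
  set Z : ℝ → ℝ := fun s => (φ s ^ m / g (R s)) ^ (1 / d) with hZ
  have hZm : Measurable Z :=
    (hrpm _).comp (((hrpm m).comp hφm).div (hg.comp hRm.measurable))
  have hZ0 : ∀ s ∈ Ioo 0 S, 0 ≤ Z s := fun s hs =>
    Real.rpow_nonneg (div_nonneg (Real.rpow_nonneg (hφ0 s) _) (hgpos _ (hRpos s hs)).le) _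
  -- the volume estimate for the transport map
  have hvol : ∀ σ ∈ Icc 0 S, ∫⁻ s in Ioo 0 σ, ENNReal.ofReal (Z s) ≤
      ENNReal.ofReal (R σ * (ω ^ (1 / d) * σ ^ (1 - 1 / d))) := by
    intro σ hσ
    have hsub : Ioo 0 σ ⊆ Ioo 0 S := Ioo_subset_Ioo_right hσ.2
    have h1 : ∫⁻ s in Ioo 0 σ, ENNReal.ofReal (Z s) ^ d ≤ ENNReal.ofReal (ω * R σ ^ d) := by
      set F : ℝ → ℝ≥0∞ := (Ioo 0 (R σ)).indicator fun r => ENNReal.ofReal (1 / g r) with hF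
      have hFm : Measurable F :=
        (measurable_const.div hg).ennreal_ofReal.indicator measurableSet_Ioo
      calc _ ≤ ∫⁻ s in Ioo 0 σ, ENNReal.ofReal (φ s ^ m) * F (R s) := by
            refine setLIntegral_mono' measurableSet_Ioo fun s hs => ?_
            have h2 := hRpos s (hsub hs)
            have h3 : R s < R σ := hRs (Ioo_subset_Icc_self (hsub hs)) hσ hs.2
            rw [hF, indicator_of_mem (show R s ∈ Ioo 0 (R σ) from ⟨h2.1, h3⟩),
              ENNReal.ofReal_rpow_of_nonneg (hZ0 s (hsub hs)) hd0.le,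
              ← ENNReal.ofReal_mul (Real.rpow_nonneg (hφ0 s) _)]
            refine ENNReal.ofReal_le_ofReal (le_of_eq ?_)
            simp only [hZ]
            rw [← Real.rpow_mul (div_nonneg (Real.rpow_nonneg (hφ0 s) _) (hgpos _ h2).le),
              one_div_mul_cancel hd0.ne', Real.rpow_one, mul_one_div]
        _ ≤ ∫⁻ s in Ioo 0 S, ENNReal.ofReal (φ s ^ m) * F (R s) := lintegral_mono_set hsub
        _ = ∫⁻ r in Ioo 0 ρ, ENNReal.ofReal (b r) * F r := hkey' F hFm
        _ ≤ ∫⁻ r in Ioo 0 ρ, (Ioo 0 (R σ)).indicator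
              (fun r => ENNReal.ofReal (d * ω * r ^ (d - 1))) r := by
            refine setLIntegral_mono' measurableSet_Ioo fun r hr => ?_
            by_cases hrσ : r ∈ Ioo 0 (R σ)
            · rw [hF, indicator_of_mem hrσ, indicator_of_mem hrσ,
                ← ENNReal.ofReal_mul (hbpos r hr).le]
              refine ENNReal.ofReal_le_ofReal (le_of_eq ?_)
              have := (hgpos r hr).ne'
              simp only [hb]
              field_simp
            · rw [hF, indicator_of_notMem hrσ, mul_zero]
              exact zero_le
        _ ≤ ∫⁻ r, (Ioo 0 (R σ)).indicator
              (fun r => ENNReal.ofReal (d * ω * r ^ (d - 1))) r := setLIntegral_le_lintegral _ _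
        _ = ∫⁻ r in Ioo 0 (R σ), ENNReal.ofReal (d * ω * r ^ (d - 1)) :=
            lintegral_indicator measurableSet_Ioo _
        _ = ENNReal.ofReal (ω * R σ ^ d) := by
            have hii : IntervalIntegrable (fun r : ℝ => d * ω * r ^ (d - 1)) volume 0 (R σ) :=
              (intervalIntegral.intervalIntegrable_rpow' (by linarith)).const_mul _
            rw [setLIntegral_congr Ioo_ae_eq_Ioc, ← ofReal_integral_eq_lintegral_ofReal
              ((intervalIntegrable_iff_integrableOn_Ioc_of_le (hR σ).1).1 hii)
              ((ae_restrict_iff' measurableSet_Ioc).2 (Eventually.of_forall fun r hr => by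
                have : 0 < r := hr.1
                change 0 ≤ _
                positivity)), ← intervalIntegral.integral_of_le (hR σ).1,
              intervalIntegral.integral_const_mul, integral_rpow (Or.inl (by linarith))]
            congr 1
            rw [sub_add_cancel, Real.zero_rpow hd0.ne']
            field_simp
            ring
    have hconj : d.HolderConjugate (d / (d - 1)) := Real.HolderConjugate.conjExponent hd
    have h2 := ENNReal.lintegral_mul_le_Lp_mul_Lq (volume.restrict (Ioo 0 σ)) hconj
      (f := fun s => ENNReal.ofReal (Z s)) (g := 1) hZm.ennreal_ofReal.aemeasurable
      aemeasurable_const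
    simp only [mul_one, Pi.one_apply, ENNReal.one_rpow, lintegral_const, Measure.restrict_apply_univ,
      one_mul, Real.volume_Ioo, sub_zero] at h2
    refine h2.trans ?_
    have h3 : 1 / (d / (d - 1)) = 1 - 1 / d := by field_simp
    have h4 : 0 ≤ 1 - 1 / d := by
      rw [sub_nonneg, div_le_one hd0]; exact hd.le
    have hσ0 := hσ.1
    have hRσ := (hR σ).1
    calc _ ≤ ENNReal.ofReal (ω * R σ ^ d) ^ (1 / d) * ENNReal.ofReal σ ^ (1 / (d / (d - 1))) := by
          gcongr
      _ = _ := by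
          rw [h3, ENNReal.ofReal_rpow_of_nonneg (by positivity) (by positivity),
            ENNReal.ofReal_rpow_of_nonneg hσ0 h4, ← ENNReal.ofReal_mul (by positivity),
            Real.mul_rpow hω.le (by positivity), ← Real.rpow_mul hRσ, mul_one_div_cancel hd0.ne',
            Real.rpow_one]
          congr 1
          ring
  -- layer cake for the measure with density `Z`
  have hcake : ∫⁻ s in Ioo 0 S, ENNReal.ofReal (Z s) * ENNReal.ofReal (φ s ^ q) ≤
      ENNReal.ofReal q * ∫⁻ t in Ioi (0 : ℝ), ENNReal.ofReal
        (t ^ (q - 1) * R (μ t) * (ω ^ (1 / d) * μ t ^ (1 - 1 / d))) := by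
    set κ := (volume.restrict (Ioo 0 S)).withDensity fun s => ENNReal.ofReal (Z s) with hκ
    have h1 := lintegral_rpow_eq_lintegral_meas_lt_mul κ (f := φ) (Eventually.of_forall hφ0)
      hφm.aemeasurable hq
    have h0 : ∫⁻ s, ENNReal.ofReal (φ s ^ q) ∂κ =
        ∫⁻ s in Ioo 0 S, ENNReal.ofReal (Z s) * ENNReal.ofReal (φ s ^ q) :=
      lintegral_withDensity_eq_lintegral_mul₀ hZm.ennreal_ofReal.aemeasurable
        ((hrpm q).comp hφm).ennreal_ofReal.aemeasurable
    rw [← h0, h1]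
    gcongr ENNReal.ofReal q * ?_
    refine setLIntegral_mono' measurableSet_Ioi fun t ht => ?_
    replace ht : 0 < t := ht
    have h2 : κ {s | t < φ s} ≤
        ENNReal.ofReal (R (μ t) * (ω ^ (1 / d) * μ t ^ (1 - 1 / d))) := by
      have hset : MeasurableSet {s | t < φ s} := measurableSet_lt measurable_const hφm
      rw [hκ, withDensity_apply _ hset, Measure.restrict_restrict hset]
      refine (lintegral_mono_set ?_).trans (hvol (μ t) ⟨hμ0 t, hμS t⟩)
      rintro s ⟨hs1, hs2⟩
      refine ⟨hs2.1, ?_⟩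
      rw [hμt t ht.le]
      exact (lt_decRearr_iff hfin hM hs2.1.le ht.le).1 hs1
    calc _ ≤ ENNReal.ofReal (R (μ t) * (ω ^ (1 / d) * μ t ^ (1 - 1 / d))) *
          ENNReal.ofReal (t ^ (q - 1)) := by gcongr
      _ = _ := by
          have := (hR (μ t)).1
          have := hμ0 t
          rw [← ENNReal.ofReal_mul (by positivity)]
          congr 1
          ring
  rw [hrearr (fun y => ENNReal.ofReal (y ^ q)) (hrpm q).ennreal_ofReal
    (by simp [Real.zero_rpow hq.ne']), ← lintegral_const_mul' _ _ ENNReal.ofReal_ne_top]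
  have hgγ : Measurable fun r => ENNReal.ofReal (g r ^ γ) := ((hrpm γ).comp hg).ennreal_ofReal
  calc _ ≤ ∫⁻ s in Ioo 0 S, (ENNReal.ofReal (φ s ^ m) * ENNReal.ofReal (g (R s) ^ γ) +
        ENNReal.ofReal (d * γ) * (ENNReal.ofReal (Z s) * ENNReal.ofReal (φ s ^ q))) := by
        refine setLIntegral_mono' measurableSet_Ioo fun s hs => ?_
        have h1 := hφpos s hs
        have h2 := hgpos _ (hRpos s hs)
        have h3 := hZ0 s hs
        rw [← ENNReal.ofReal_mul (by positivity), ← ENNReal.ofReal_mul (by positivity),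
          ← ENNReal.ofReal_mul (by positivity), ← ENNReal.ofReal_mul (by positivity),
          ← ENNReal.ofReal_add (by positivity) (by positivity)]
        refine ENNReal.ofReal_le_ofReal ?_
        have := transport_pointwise_le hd0 hγ hmq h1 h2
        simp only [hZ]
        linarith
    _ = (∫⁻ s in Ioo 0 S, ENNReal.ofReal (φ s ^ m) * ENNReal.ofReal (g (R s) ^ γ)) +
        ENNReal.ofReal (d * γ) * ∫⁻ s in Ioo 0 S, ENNReal.ofReal (Z s) *
          ENNReal.ofReal (φ s ^ q) := by
        have h1 : Measurable fun s => ENNReal.ofReal (φ s ^ m) * ENNReal.ofReal (g (R s) ^ γ) :=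
          ((hrpm m).comp hφm).ennreal_ofReal.mul (hgγ.comp hRm.measurable)
        rw [lintegral_add_left h1, lintegral_const_mul' _ _ ENNReal.ofReal_ne_top]
    _ ≤ (∫⁻ r in Ioo 0 ρ, ENNReal.ofReal (b r) * ENNReal.ofReal (g r ^ γ)) +
        ENNReal.ofReal (d * γ) * (ENNReal.ofReal q * ∫⁻ t in Ioi (0 : ℝ), ENNReal.ofReal
        (t ^ (q - 1) * R (μ t) * (ω ^ (1 / d) * μ t ^ (1 - 1 / d)))) := by
        rw [hkey' _ hgγ]
        gcongr
    _ = _ := by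
        congr 1
        · exact setLIntegral_congr_fun measurableSet_Ioo fun r hr =>
            (ENNReal.ofReal_mul (hbpos r hr).le).symm
        · rw [← mul_assoc, ← ENNReal.ofReal_mul (by positivity),
            show d * γ * q = (γ * q) * d by ring, ENNReal.ofReal_mul (by positivity), mul_assoc,
            ← lintegral_const_mul' _ _ ENNReal.ofReal_ne_top]
          congr 1
          refine setLIntegral_congr_fun measurableSet_Ioi fun t ht => ?_
          replace ht : 0 < t := ht
          have := (hR (μ t)).1
          have := hμ0 t
          simp only
          rw [← ENNReal.ofReal_mul hd0.le, ← hμt t ht.le]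
          congr 1
          ring

end TransportInequality

section Energy

lemma rpow_mul_add_rpow_mul_le {p a b x y : ℝ} (hp : 1 < p) (ha : 0 ≤ a) (hb : 0 ≤ b) (hx : 0 ≤ x)
    (hy : 0 ≤ y) : a ^ (p - 1) * x + b ^ (p - 1) * y ≤
      (a ^ p + b ^ p) ^ ((p - 1) / p) * (x ^ p + y ^ p) ^ (1 / p) := by
  have hc : (p / (p - 1)).HolderConjugate p := (Real.HolderConjugate.conjExponent hp).symm
  have h := Real.inner_le_Lp_mul_Lq_of_nonneg (Finset.univ : Finset (Fin 2)) hc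
    (f := ![a ^ (p - 1), b ^ (p - 1)]) (g := ![x, y])
    (by intro i _; fin_cases i <;> simp <;> positivity)
    (by intro i _; fin_cases i <;> simpa)
  have h1 : ∀ z : ℝ, 0 ≤ z → (z ^ (p - 1)) ^ (p / (p - 1)) = z ^ p := fun z hz => by
    rw [← rpow_mul hz]; congr 1; field_simp [show p - 1 ≠ 0 by linarith]
  simp only [Fin.sum_univ_two, Matrix.cons_val_zero, Matrix.cons_val_one] at h
  rw [h1 a ha, h1 b hb] at h
  rwa [one_div_div] at h

lemma mul_rpow_mul_le {p k g : ℝ} (hp : 1 < p) (hk : 0 ≤ k) (hg : 0 ≤ g) :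
    p * (k ^ ((p - 1) / p) * g) ≤ g ^ p + (p - 1) * k := by
  have hc : p.HolderConjugate (p / (p - 1)) := Real.HolderConjugate.conjExponent hp
  have h := Real.young_inequality_of_nonneg hg (rpow_nonneg hk ((p - 1) / p)) hc
  rw [← rpow_mul hk, div_mul_div_comm, mul_comm (p - 1) p,
    div_self (mul_ne_zero (by linarith) (by linarith)), rpow_one, div_div_eq_mul_div] at h
  have h2 := mul_le_mul_of_nonneg_left h (by linarith : 0 ≤ p)
  calc _ = p * (g * k ^ ((p - 1) / p)) := by ring
    _ ≤ _ := h2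
    _ = _ := by field_simp

lemma exists_abs_le_of_tsupport_subset {E : Type*} [NormedAddCommGroup E] [ProperSpace E]
    {u : E → ℝ} (hu : Continuous u) {r₀ : ℝ}
    (hsupp : tsupport u ⊆ closedBall 0 r₀) : ∃ M, ∀ x, |u x| ≤ M :=
  hu.bounded_above_of_compact_support
    ((isCompact_closedBall (0 : E) r₀).of_isClosed_subset (isClosed_tsupport u) hsupp)

variable {E : Type*} [NormedAddCommGroup E] [InnerProductSpace ℝ E] [FiniteDimensional ℝ E]
  [MeasurableSpace E] [BorelSpace E]

lemma hypVol_setOf_ne_zero_lt_top {u : E → ℝ} {r₀ : ℝ} (hr₀ : r₀ < 1)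
    (hsupp : tsupport u ⊆ closedBall 0 r₀) : hypVol {x | u x ≠ 0} < ∞ :=
  (measure_mono ((subset_tsupport u).trans hsupp)).trans_lt (hypVol_closedBall_lt_top hr₀)

lemma lintegral_abs_rpow_lt_top {u : E → ℝ} (hu : Continuous u) {r₀ : ℝ} (hr₀ : r₀ < 1)
    (hsupp : tsupport u ⊆ closedBall 0 r₀) {m : ℝ} (hm : 0 < m) :
    ∫⁻ x, ENNReal.ofReal (|u x| ^ m) ∂hypVol < ∞ := by
  obtain ⟨M, hM⟩ := exists_abs_le_of_tsupport_subset hu hsupp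
  calc ∫⁻ x, ENNReal.ofReal (|u x| ^ m) ∂hypVol
      ≤ ∫⁻ x, {x | u x ≠ 0}.indicator (fun _ => ENNReal.ofReal (M ^ m)) x ∂hypVol := by
        refine lintegral_mono fun x => ?_
        by_cases h : u x = 0
        · simp [h, zero_rpow hm.ne']
        · rw [indicator_of_mem (show x ∈ {x | u x ≠ 0} from h)]
          exact ENNReal.ofReal_le_ofReal (rpow_le_rpow (abs_nonneg _) (hM x) hm.le)
    _ = ENNReal.ofReal (M ^ m) * hypVol {x | u x ≠ 0} :=
        lintegral_indicator_const (isOpen_ne_fun hu continuous_const).measurableSet _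
    _ < ∞ := ENNReal.mul_lt_top ENNReal.ofReal_lt_top (hypVol_setOf_ne_zero_lt_top hr₀ hsupp)

theorem lintegral_energy_le {u : E → ℝ} (hu : ContDiff ℝ 1 u) {r₀ : ℝ} (hr₀ : r₀ < 1)
    (hsupp : tsupport u ⊆ closedBall 0 r₀) (hn : 2 ≤ finrank ℝ E) {p : ℝ}
    (hp : 2 * (finrank ℝ E : ℝ) / (finrank ℝ E - 1) ≤ p) {α ρ l : ℝ} (hα : 0 < α) (hl : 0 < l)
    {R : ℝ → ℝ} (hR : Antitone R) (hRρ : ∀ t, R t ∈ Icc 0 ρ) :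
    ENNReal.ofReal (p * l ^ (p - 1)) * (∫⁻ t in Ioi (0:ℝ), ENNReal.ofReal (t ^ (α * (p - 1)) * R t *
        (finrank ℝ E * volume.real (ball (0:E) 1) ^ (1 / (finrank ℝ E : ℝ)) *
          hypVol.real {x | t < |u x|} ^ (1 - 1 / (finrank ℝ E : ℝ))))) +
      ENNReal.ofReal (((finrank ℝ E - 1) / p) ^ p) * (∫⁻ x, ENNReal.ofReal (|u x| ^ p) ∂hypVol) ≤
    (∫⁻ x, ENNReal.ofReal (((1 - ‖x‖ ^ 2) / 2 * ‖fderiv ℝ u x‖) ^ p) ∂hypVol) +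
      ENNReal.ofReal ((p - 1) * l ^ p) *
        ∫⁻ x, ENNReal.ofReal (|u x| ^ (α * p) * R |u x| ^ (p / (p - 1))) ∂hypVol := by
  set n : ℝ := (finrank ℝ E : ℝ) with hnd
  have hn2 : (2:ℝ) ≤ n := by rw [hnd]; exact_mod_cast hn
  have hp2 : 2 < p := by
    refine lt_of_lt_of_le ?_ hp
    rw [lt_div_iff₀ (by linarith)]; linarith
  have hn1 : 0 < (n - 1) / p := div_pos (by linarith) (by linarith)
  set ω := volume.real (ball (0:E) 1) with hω
  have hω0 : 0 < ω := volume_real_unitBall_pos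
  have huc := hu.continuous
  obtain ⟨M, hM⟩ := exists_abs_le_of_tsupport_subset huc hsupp
  have hR0 : ∀ t, 0 ≤ R t := fun t => (hRρ t).1
  have hRm : Measurable R := hR.measurable
  set μ : ℝ → ℝ := fun t => hypVol.real {x | t < |u x|} with hμ
  have hfin : hypVol {x | 0 < |u x|} ≠ ∞ := by
    simpa only [abs_pos] using (hypVol_setOf_ne_zero_lt_top hr₀ hsupp).ne
  have hμ0 : ∀ t, 0 ≤ μ t := fun t => measureReal_nonneg
  set K : ℝ → ℝ → ℝ := fun r t => (l * t ^ α * r ^ (1 / (p - 1))) ^ p + ((n - 1) / p * t) ^ p with hK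
  have hK0 : ∀ r t, 0 ≤ r → 0 ≤ t → 0 ≤ K r t := fun r t hr ht => by positivity
  have hKmono : ∀ r r' t t', 0 ≤ r → r ≤ r' → 0 ≤ t → t ≤ t' → K r t ≤ K r' t' := by
    intro r r' t t' h1 h2 h3 h4
    have h5 : 0 ≤ 1 / (p - 1) := by apply div_nonneg <;> linarith
    have h6 : 0 ≤ t' := h3.trans h4
    simp only [hK]
    gcongr
  set w : ℝ → ℝ := fun t => K (R t) t ^ ((p - 1) / p) with hw
  have hpp : 0 < (p - 1) / p := div_pos (by linarith) (by linarith)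
  have hwm : Measurable w := by
    simp only [hw, hK]
    fun_prop
  have hmain := lintegral_mul_profile_le hu hr₀ hsupp hn hp hwm
    (fun t ht => rpow_nonneg (hK0 _ _ (hR0 t) ht) _) (W := K ρ M ^ ((p - 1) / p))
    (fun t ht ⟨y, hy⟩ => rpow_le_rpow (hK0 _ _ (hR0 t) ht)
      (hKmono _ _ _ _ (hR0 t) (hRρ t).2 ht (hy.le.trans (hM y))) hpp.le)
    (by
      intro t ht e he
      have hcont : Continuous fun t' => K (R t) t' ^ ((p - 1) / p) := by
        have h1 : Continuous fun t' : ℝ => t' ^ α := continuous_id.rpow_const fun _ => Or.inr hα.le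
        refine Continuous.rpow_const ?_ fun _ => Or.inr hpp.le
        refine Continuous.add ?_ ?_
        · exact (by fun_prop : Continuous fun t' : ℝ => l * t' ^ α * R t ^ (1 / (p - 1))).rpow_const
            fun _ => Or.inr (by linarith)
        · exact (by fun_prop : Continuous fun t' : ℝ => (n - 1) / p * t').rpow_const
            fun _ => Or.inr (by linarith)
      have h2 := (hcont.tendsto t).eventually_lt_const
        (show K (R t) t ^ ((p - 1) / p) < w t + e by simp only [hw]; linarith)
      filter_upwards [mem_nhdsWithin_of_mem_nhds h2, self_mem_nhdsWithin] with t' h3 h4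
      have h5 : t ≤ t' := h4
      exact (rpow_le_rpow (hK0 _ _ (hR0 _) (ht.trans h5)) (hKmono _ _ _ _ (hR0 _) (hR h5)
        (ht.trans h5) le_rfl) hpp.le).trans h3.le)
  rw [← hω] at hmain
  set c : ℝ := ((n - 1) / p) ^ p with hc
  have hc0 : 0 < c := by positivity
  set Hf := ∫⁻ x, ENNReal.ofReal (|u x| ^ p) ∂(hypVol : Measure E) with hHf
  have hHfin : Hf ≠ ∞ := (lintegral_abs_rpow_lt_top huc hr₀ hsupp (by linarith)).ne
  set I : ℝ → ℝ := fun t => n * ω ^ (1 / n) * μ t ^ (1 - 1 / n) with hI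
  have hI0 : ∀ t, 0 ≤ I t := fun t => by have := hμ0 t; positivity
  have hpow : ∀ r t, 0 ≤ r → 0 ≤ t → (l * t ^ α * r ^ (1 / (p - 1))) ^ p =
      l ^ p * (t ^ (α * p) * r ^ (p / (p - 1))) := by
    intro r t hr ht
    rw [mul_rpow (by positivity) (by positivity), mul_rpow hl.le (by positivity), ← rpow_mul ht,
      ← rpow_mul hr, mul_assoc, one_div_mul_eq_div]
  have hpow' : ∀ r t, 0 ≤ r → 0 ≤ t → (l * t ^ α * r ^ (1 / (p - 1))) ^ (p - 1) =
      l ^ (p - 1) * (t ^ (α * (p - 1)) * r) := by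
    intro r t hr ht
    rw [mul_rpow (by positivity) (by positivity), mul_rpow hl.le (by positivity), ← rpow_mul ht,
      ← rpow_mul hr, mul_assoc, one_div, inv_mul_cancel₀ (by linarith), rpow_one]
  -- lower bound for the left side
  have hcake : Hf = ENNReal.ofReal p * ∫⁻ t in Ioi (0:ℝ), ENNReal.ofReal (t ^ (p - 1) * μ t) := by
    rw [hHf, lintegral_rpow_eq_lintegral_meas_lt_mul _ (Eventually.of_forall fun x => abs_nonneg _)
      huc.abs.measurable.aemeasurable (by linarith)]
    congr 1
    refine setLIntegral_congr_fun measurableSet_Ioi fun t ht => ?_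
    have ht : 0 < t := ht
    have h1 : hypVol {x | t < |u x|} ≠ ∞ :=
      ((measure_mono fun x (hx : t < |u x|) => show 0 < |u x| from ht.trans hx).trans_lt
        hfin.lt_top).ne
    simp only [hμ]
    rw [ENNReal.ofReal_mul (by positivity), mul_comm, ofReal_measureReal h1]
  have hlow : ENNReal.ofReal (l ^ (p - 1)) *
        (∫⁻ t in Ioi (0:ℝ), ENNReal.ofReal (t ^ (α * (p - 1)) * R t * I t)) +
      ENNReal.ofReal (((n - 1) / p) ^ (p - 1) * (n - 1)) *
        (∫⁻ t in Ioi (0:ℝ), ENNReal.ofReal (t ^ (p - 1) * μ t)) ≤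
      ∫⁻ t in Ioi (0:ℝ), ENNReal.ofReal (w t) * ENNReal.ofReal (profile (finrank ℝ E) p ω (μ t)) := by
    have hμm : AEMeasurable (fun t => ENNReal.ofReal (t ^ (p - 1) * μ t))
        (volume.restrict (Ioi (0:ℝ))) := by
      have : AEMeasurable μ (volume.restrict (Ioi (0:ℝ))) := by
        refine aemeasurable_restrict_of_antitoneOn measurableSet_Ioi ?_
        intro s hs t ht hst
        refine measureReal_mono (fun x (hx : t < |u x|) => show s < |u x| from hst.trans_lt hx)
          ((measure_mono fun x (hx : s < |u x|) =>
            show 0 < |u x| from lt_trans hs hx).trans_lt hfin.lt_top).ne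
      fun_prop
    rw [← lintegral_const_mul' _ _ ENNReal.ofReal_ne_top, ← lintegral_const_mul'' _ hμm,
      ← lintegral_add_right' _ (hμm.const_mul _)]
    refine setLIntegral_mono' measurableSet_Ioi fun t ht => ?_
    have ht : 0 < t := ht
    have h1 := hR0 t
    have h2 := hI0 t
    have h3 := hμ0 t
    have hK1 := hK0 _ _ h1 ht.le
    have hn1' : 0 ≤ n - 1 := by linarith
    rw [← ENNReal.ofReal_mul (by positivity), ← ENNReal.ofReal_mul (by positivity),
      ← ENNReal.ofReal_add (by positivity) (by positivity), ← ENNReal.ofReal_mul (by positivity)]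
    refine ENNReal.ofReal_le_ofReal ?_
    have h4 := rpow_mul_add_rpow_mul_le (p := p) (by linarith)
      (show 0 ≤ l * t ^ α * R t ^ (1 / (p - 1)) by positivity)
      (show 0 ≤ (n - 1) / p * t by positivity) h2 (show 0 ≤ (n - 1) * μ t by positivity)
    rw [hpow' _ _ h1 ht.le, mul_rpow hn1.le ht.le] at h4
    simp only [profile, ← hnd]
    calc _ = l ^ (p - 1) * (t ^ (α * (p - 1)) * R t) * I t +
        ((n - 1) / p) ^ (p - 1) * t ^ (p - 1) * ((n - 1) * μ t) := by ring
      _ ≤ _ := h4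
  -- upper bound for the right side
  have hup : ENNReal.ofReal p *
      (∫⁻ x, ENNReal.ofReal (w |u x| * ((1 - ‖x‖ ^ 2) / 2 * ‖fderiv ℝ u x‖)) ∂hypVol) ≤
      (∫⁻ x, ENNReal.ofReal (((1 - ‖x‖ ^ 2) / 2 * ‖fderiv ℝ u x‖) ^ p) ∂hypVol) +
      ENNReal.ofReal ((p - 1) * l ^ p) *
        (∫⁻ x, ENNReal.ofReal (|u x| ^ (α * p) * R |u x| ^ (p / (p - 1))) ∂hypVol) +
      ENNReal.ofReal ((p - 1) * c) * Hf := by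
    have hm1 : Measurable fun x => ENNReal.ofReal (|u x| ^ (α * p) * R |u x| ^ (p / (p - 1))) := by
      have := huc.measurable
      have h2 : Measurable fun x => R |u x| := hRm.comp huc.abs.measurable
      have h3 : Measurable fun x => |u x| := huc.abs.measurable
      fun_prop
    have hm2 : Measurable fun x => ENNReal.ofReal (|u x| ^ p) := by
      have h3 : Measurable fun x => |u x| := huc.abs.measurable
      fun_prop
    rw [hHf, ← lintegral_const_mul _ hm1, ← lintegral_const_mul _ hm2,
      ← lintegral_add_right _ (hm1.const_mul _), ← lintegral_add_right _ (hm2.const_mul _),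
      ← lintegral_const_mul' _ _ ENNReal.ofReal_ne_top]
    refine lintegral_mono_ae ?_
    filter_upwards [ae_hypVol_mem_ball (E := E)] with x hx
    have h1 := one_sub_norm_sq_pos hx
    have h2 := hR0 |u x|
    have h3 := abs_nonneg (u x)
    have hp1 : 0 ≤ p - 1 := by linarith
    have hK1 := hK0 _ _ h2 h3
    rw [← ENNReal.ofReal_mul (by linarith), ← ENNReal.ofReal_mul (by positivity),
      ← ENNReal.ofReal_mul (by positivity), ← ENNReal.ofReal_add (by positivity) (by positivity),
      ← ENNReal.ofReal_add (by positivity) (by positivity)]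
    refine ENNReal.ofReal_le_ofReal ?_
    have h4 := mul_rpow_mul_le (p := p) (by linarith) hK1
      (show 0 ≤ (1 - ‖x‖ ^ 2) / 2 * ‖fderiv ℝ u x‖ by positivity)
    refine h4.trans (le_of_eq ?_)
    simp only [hK]
    rw [hpow _ _ h2 h3, mul_rpow hn1.le h3]
    ring
  have hfinal := (mul_le_mul_right (hlow.trans hmain) (ENNReal.ofReal p)).trans hup
  have hcc : ENNReal.ofReal p * (ENNReal.ofReal (((n - 1) / p) ^ (p - 1) * (n - 1)) *
      (∫⁻ t in Ioi (0:ℝ), ENNReal.ofReal (t ^ (p - 1) * μ t))) =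
      ENNReal.ofReal c * Hf + ENNReal.ofReal ((p - 1) * c) * Hf := by
    rw [← add_mul, ← ENNReal.ofReal_add hc0.le (mul_nonneg (by linarith) hc0.le), hcake,
      ← mul_assoc, ← mul_assoc, ← ENNReal.ofReal_mul (by linarith), ← ENNReal.ofReal_mul (by nlinarith)]
    congr 2
    have : c = ((n - 1) / p) ^ (p - 1) * ((n - 1) / p) := by
      rw [hc, ← rpow_add_one hn1.ne']; congr 1; ring
    rw [this]; field_simp; ring
  rw [mul_add, hcc, ← add_assoc, ← mul_assoc, ← ENNReal.ofReal_mul (by linarith)] at hfinal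
  exact ENNReal.le_of_add_le_add_right (ENNReal.mul_ne_top ENNReal.ofReal_ne_top hHfin) hfinal

end Energy

section Beta

lemma lintegral_rpow_mul_one_sub_rpow {a b : ℝ} (ha : 0 < a) (hb : 0 < b) :
    ∫⁻ x in Ioo (0:ℝ) 1, ENNReal.ofReal (x ^ (a - 1) * (1 - x) ^ (b - 1)) =
      ENNReal.ofReal (ProbabilityTheory.beta a b) := by
  have hB := ProbabilityTheory.beta_pos ha hb
  have h := ProbabilityTheory.lintegral_betaPDF_eq_one ha hb
  rw [ProbabilityTheory.lintegral_betaPDF] at h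
  simp only [mul_assoc, ENNReal.ofReal_mul (one_div_pos.2 hB).le] at h
  rw [lintegral_const_mul' _ _ ENNReal.ofReal_ne_top, one_div, ENNReal.ofReal_inv_of_pos hB] at h
  exact (inv_injective (ENNReal.eq_inv_of_mul_eq_one_left h)).symm

/-- A radial integral reduced to the beta function by the substitution `x = (r / ρ) ^ P`. -/
lemma lintegral_radial_beta {c d P s ρ : ℝ} (hc : 0 ≤ c) (hd : 0 < d) (hP : 0 < P) (hs : -1 < s)
    (hρ : 0 < ρ) :
    ∫⁻ r in Ioo 0 ρ, ENNReal.ofReal (c * r ^ (d - 1) * (1 - (r / ρ) ^ P) ^ s) =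
      ENNReal.ofReal (c * ρ ^ d / P * ProbabilityTheory.beta (d / P) (s + 1)) := by
  have himg : (fun r : ℝ => (r / ρ) ^ P) '' Ioo 0 ρ = Ioo 0 1 := by
    ext x
    constructor
    · rintro ⟨r, hr, rfl⟩
      exact ⟨rpow_pos_of_pos (div_pos hr.1 hρ) _,
        rpow_lt_one (div_pos hr.1 hρ).le ((div_lt_one hρ).2 hr.2) hP⟩
    · intro hx
      refine ⟨ρ * x ^ (1 / P), ⟨mul_pos hρ (rpow_pos_of_pos hx.1 _), ?_⟩, ?_⟩
      · exact mul_lt_of_lt_one_right hρ (rpow_lt_one hx.1.le hx.2 (by positivity))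
      · simp only
        rw [mul_div_cancel_left₀ _ hρ.ne', ← rpow_mul hx.1.le, one_div_mul_cancel hP.ne', rpow_one]
  have hinj : InjOn (fun r : ℝ => (r / ρ) ^ P) (Ioo 0 ρ) := by
    intro r hr r' hr' h
    have h1 := (rpow_left_inj (div_pos hr.1 hρ).le (div_pos hr'.1 hρ).le hP.ne').1 h
    exact (div_left_inj' hρ.ne').1 h1
  have hder : ∀ r ∈ Ioo 0 ρ, HasDerivWithinAt (fun r : ℝ => (r / ρ) ^ P)
      (P / ρ * (r / ρ) ^ (P - 1)) (Ioo 0 ρ) r := by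
    intro r hr
    have := ((hasDerivAt_id r).div_const ρ).rpow_const (p := P)
      (Or.inl (div_pos hr.1 hρ).ne')
    refine (this.congr_deriv ?_).hasDerivWithinAt
    simp only [id]; ring
  have h := lintegral_image_eq_lintegral_abs_deriv_mul measurableSet_Ioo hder hinj
    (fun x => ENNReal.ofReal (c * ρ ^ d / P * (x ^ (d / P - 1) * (1 - x) ^ s)))
  have hk : 0 ≤ c * ρ ^ d / P := by positivity
  rw [himg] at h
  simp only [ENNReal.ofReal_mul hk] at h
  rw [lintegral_const_mul' _ _ ENNReal.ofReal_ne_top] at h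
  have h2 := lintegral_rpow_mul_one_sub_rpow (div_pos hd hP) (show 0 < s + 1 by linarith)
  rw [add_sub_cancel_right] at h2
  rw [h2, ← ENNReal.ofReal_mul hk] at h
  rw [h]
  refine setLIntegral_congr_fun measurableSet_Ioo fun r hr => ?_
  have hr0 : 0 < r / ρ := div_pos hr.1 hρ
  rw [← ENNReal.ofReal_mul hk, ← ENNReal.ofReal_mul (abs_nonneg _), abs_of_nonneg (by positivity)]
  congr 1
  rw [← rpow_mul hr0.le, show P * (d / P - 1) = d - 1 - (P - 1) by field_simp; ring,
    rpow_sub hr0 (d - 1), div_rpow hr.1.le hρ.le (d - 1), rpow_sub hρ d, rpow_one]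
  have h3 : (r / ρ) ^ (P - 1) ≠ 0 := by positivity
  field_simp

lemma beta_add_one_left {a b : ℝ} (ha : 0 < a) (hb : 0 < b) :
    ProbabilityTheory.beta (a + 1) b = a / (a + b) * ProbabilityTheory.beta a b := by
  have h := (Gamma_pos_of_pos (add_pos ha hb)).ne'
  rw [ProbabilityTheory.beta, ProbabilityTheory.beta, Gamma_add_one ha.ne', add_right_comm,
    Gamma_add_one (add_pos ha hb).ne']
  field_simp

lemma beta_add_one_right {a b : ℝ} (ha : 0 < a) (hb : 0 < b) :
    ProbabilityTheory.beta a (b + 1) = b / (a + b) * ProbabilityTheory.beta a b := by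
  have h := (Gamma_pos_of_pos (add_pos ha hb)).ne'
  rw [ProbabilityTheory.beta, ProbabilityTheory.beta, Gamma_add_one hb.ne', ← add_assoc,
    Gamma_add_one (add_pos ha hb).ne']
  field_simp

end Beta

section Comparison

variable {E : Type*} [NormedAddCommGroup E] [InnerProductSpace ℝ E] [FiniteDimensional ℝ E]
  [MeasurableSpace E] [BorelSpace E]

lemma toReal_lintegral_le_of_energy_le {u : E → ℝ} (hu : ContDiff ℝ 1 u) {r₀ : ℝ} (hr₀ : r₀ < 1)
    (hsupp : tsupport u ⊆ closedBall 0 r₀) (hn : 2 ≤ finrank ℝ E) {p : ℝ}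
    (hp : 2 * (finrank ℝ E : ℝ) / (finrank ℝ E - 1) ≤ p) {α : ℝ} (hα : 0 < α) (hα1 : α < 1)
    (hS : 0 < hypVol.real {x | 0 < |u x|}) {D : ℝ} (hD : 0 < D)
    (henergy : ∫⁻ x, ENNReal.ofReal (((1 - ‖x‖ ^ 2) / 2 * ‖fderiv ℝ u x‖) ^ p) ∂hypVol ≤
      ENNReal.ofReal (((finrank ℝ E - 1) / p) ^ p) * (∫⁻ x, ENNReal.ofReal (|u x| ^ p) ∂hypVol) +
        ENNReal.ofReal D)
    {T a s b κ ρ : ℝ} (hT : T = (∫⁻ x, ENNReal.ofReal (|u x| ^ (α * p)) ∂hypVol).toReal)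
    (hT0 : 0 < T) (ha : a = finrank ℝ E * (p - 1) / p) (hs : s = α * p / (1 - α))
    (hb : b = finrank ℝ E * volume.real (ball (0:E) 1) / (p / (p - 1)) *
      ProbabilityTheory.beta a (s + 1))
    (hκ : κ = (s + 1) / (a + (s + 1))) (hρ : 0 < ρ) :
    (1 + finrank ℝ E * ((1 - α) / (α * p))) *
        (∫⁻ x, ENNReal.ofReal (|u x| ^ (α * (p - 1) + 1)) ∂hypVol).toReal ≤
      (T / (ρ ^ (finrank ℝ E : ℝ) * b)) ^ (1 + (1 - α) / (α * p)) * (ρ ^ (finrank ℝ E : ℝ) * b * κ) +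
      (1 - α) / (α * p) * (α * (p - 1) + 1) *
        (D ^ (1 / p) * (ρ ^ (p / (p - 1)) * T * (1 - κ)) ^ ((p - 1) / p)) := by
  set n : ℝ := (finrank ℝ E : ℝ) with hnd
  have hn2 : (2:ℝ) ≤ n := by rw [hnd]; exact_mod_cast hn
  have hp2 : 2 < p := by
    refine lt_of_lt_of_le ?_ hp
    rw [lt_div_iff₀ (by linarith)]; linarith
  set ω := volume.real (ball (0:E) 1) with hω
  have hω0 : 0 < ω := volume_real_unitBall_pos
  set P := p / (p - 1) with hPd
  have hp1 : 0 < p - 1 := by linarith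
  have hP : 0 < P := div_pos (by linarith) hp1
  have hβ : 0 < 1 - α := by linarith
  set γ := (1 - α) / (α * p) with hγd
  have hp0 : 0 < p := by linarith
  have hγ : 0 < γ := by positivity
  have ha0 : 0 < a := by rw [ha]; positivity
  have hs0 : 0 < s := by rw [hs]; positivity
  have haP : n / P = a := by rw [ha, hPd]; field_simp
  have hB := ProbabilityTheory.beta_pos ha0 (show 0 < s + 1 by linarith)
  have hb0 : 0 < b := by rw [hb]; positivity
  have hκ0 : 0 < κ := by rw [hκ]; positivity
  have hκ1 : 1 - κ = a / (a + (s + 1)) := by rw [hκ]; field_simp; ring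
  have hκ1p : 0 < 1 - κ := by rw [hκ1]; positivity
  have hρn : 0 < ρ ^ n := rpow_pos_of_pos hρ _
  set A := T / (ρ ^ n * b) with hA
  have hA0 : 0 < A := by positivity
  have hAT : A * ρ ^ n * b = T := by rw [hA]; field_simp
  have huc := hu.continuous
  obtain ⟨M, hM⟩ := exists_abs_le_of_tsupport_subset huc hsupp
  have hfin : hypVol {x | 0 < |u x|} ≠ ∞ := by
    simpa only [abs_pos] using (hypVol_setOf_ne_zero_lt_top hr₀ hsupp).ne
  set g : ℝ → ℝ := fun r => A * (1 - (r / ρ) ^ P) ^ s with hg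
  have hgm : Measurable g := by fun_prop
  have h1pos : ∀ r ∈ Ioo 0 ρ, 0 < 1 - (r / ρ) ^ P := fun r hr =>
    sub_pos.2 (rpow_lt_one (div_pos hr.1 hρ).le ((div_lt_one hρ).2 hr.2) hP)
  have hgpos : ∀ r ∈ Ioo 0 ρ, 0 < g r := fun r hr =>
    mul_pos hA0 (rpow_pos_of_pos (h1pos r hr) _)
  have hmass : ∫⁻ r in Ioo 0 ρ, ENNReal.ofReal (n * ω * r ^ (n - 1) * g r) = ENNReal.ofReal T := by
    have h := lintegral_radial_beta (c := n * ω * A) (d := n) (P := P) (s := s) (by positivity)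
      (by linarith) hP (by linarith) hρ
    rw [haP] at h
    calc _ = _ := by
          refine lintegral_congr fun r => ?_
          simp only [hg]; congr 1; ring
      _ = _ := h
      _ = _ := by rw [← hAT, hb]; congr 1; ring
  have hTfin : ∫⁻ x, ENNReal.ofReal (|u x| ^ (α * p)) ∂hypVol = ENNReal.ofReal T := by
    rw [hT, ENNReal.ofReal_toReal]
    exact (lintegral_abs_rpow_lt_top huc hr₀ hsupp (by positivity)).ne
  have hgint : IntegrableOn (fun r => n * ω * r ^ (n - 1) * g r) (Ioo 0 ρ) := by
    have hme : Measurable fun r => n * ω * r ^ (n - 1) * g r := by fun_prop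
    refine (lintegral_ofReal_ne_top_iff_integrable hme.aestronglyMeasurable
      (ae_restrict_of_forall_mem measurableSet_Ioo fun r hr => ?_)).1
        (hmass ▸ ENNReal.ofReal_ne_top)
    have := hgpos r hr
    have := hr.1
    simp only [Pi.zero_apply]
    positivity
  have hmq : α * p * (1 + γ) = α * (p - 1) + 1 := by rw [hγd]; field_simp; ring
  obtain ⟨R, hR, hRρ, hmom, hmain⟩ := exists_radius (f := fun x => |u x|) huc.abs.measurable
    (fun x => abs_nonneg _) hfin hM hS (by linarith) hω0 hγ (show 0 < α * p by positivity) hmq hP hρ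
    hgm hgpos hgint (hTfin.trans hmass.symm)
  have hmomeq : ∫⁻ r in Ioo 0 ρ, ENNReal.ofReal (n * ω * r ^ (n - 1) * g r * r ^ P) =
      ENNReal.ofReal (ρ ^ P * T * (1 - κ)) := by
    have h := lintegral_radial_beta (c := n * ω * A) (d := n + P) (P := P) (s := s) (by positivity)
      (by linarith) hP (by linarith) hρ
    rw [add_div, haP, div_self hP.ne', beta_add_one_left ha0 (by linarith), ← hκ1,
      rpow_add hρ] at h
    calc _ = _ := by
          refine setLIntegral_congr_fun measurableSet_Ioo fun r hr => ?_
          simp only [hg]; congr 1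
          rw [show n + P - 1 = n - 1 + P by ring, rpow_add hr.1]; ring
      _ = _ := h
      _ = _ := by rw [← hAT, hb]; congr 1; ring
  have hYeq : ∫⁻ r in Ioo 0 ρ, ENNReal.ofReal (n * ω * r ^ (n - 1) * g r * g r ^ γ) =
      ENNReal.ofReal (A ^ (1 + γ) * (ρ ^ n * b * κ)) := by
    have h := lintegral_radial_beta (c := n * ω * A ^ (1 + γ)) (d := n) (P := P) (s := s + 1)
      (by positivity) (by linarith) hP (by linarith) hρ
    rw [haP, beta_add_one_right ha0 (by linarith), ← hκ] at h
    calc _ = _ := by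
          refine setLIntegral_congr_fun measurableSet_Ioo fun r hr => ?_
          congr 1
          have h1 : g r * g r ^ γ = A ^ (1 + γ) * (1 - (r / ρ) ^ P) ^ (s + 1) := by
            rw [← rpow_one_add' (hgpos r hr).le (by linarith)]
            simp only [hg]
            rw [mul_rpow hA0.le (rpow_pos_of_pos (h1pos r hr) _).le, ← rpow_mul (h1pos r hr).le]
            congr 2
            rw [hs, hγd]; field_simp
          rw [mul_assoc _ (g r), h1]; ring
      _ = _ := h
      _ = _ := by rw [hb]; congr 1; ring
  set Mom := ρ ^ P * T * (1 - κ) with hMomd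
  have hMom : 0 < Mom := by have := rpow_pos_of_pos hρ P; positivity
  rw [hmomeq] at hmom
  rw [hYeq, add_sub_cancel_right] at hmain
  set Ξ := ∫⁻ t in Ioi (0:ℝ), ENNReal.ofReal (t ^ (α * (p - 1)) * R t *
    (n * ω ^ (1 / n) * hypVol.real {x | t < |u x|} ^ (1 - 1 / n))) with hΞ
  set l := (D / Mom) ^ (1 / p) with hl
  have hl0 : 0 < l := rpow_pos_of_pos (div_pos hD hMom) _
  have hlp : l ^ p = D / Mom := by
    rw [hl, ← rpow_mul (div_pos hD hMom).le, one_div_mul_cancel hp0.ne', rpow_one]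
  have hen := lintegral_energy_le hu hr₀ hsupp hn hp hα hl0 hR hRρ
  rw [← hω, ← hnd, ← hΞ] at hen
  have hHfin : ENNReal.ofReal (((n - 1) / p) ^ p) *
      (∫⁻ x, ENNReal.ofReal (|u x| ^ p) ∂(hypVol : Measure E)) ≠ ∞ :=
    ENNReal.mul_ne_top ENNReal.ofReal_ne_top (lintegral_abs_rpow_lt_top huc hr₀ hsupp hp0).ne
  have h1 : ENNReal.ofReal (p * l ^ (p - 1)) * Ξ ≤ ENNReal.ofReal (p * D) := by
    have h2 := hen.trans (add_le_add henergy (mul_le_mul_right hmom _))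
    rw [add_comm, add_assoc] at h2
    refine (ENNReal.le_of_add_le_add_left hHfin h2).trans ?_
    rw [← ENNReal.ofReal_mul (by positivity), ← ENNReal.ofReal_add hD.le (by positivity), hlp]
    refine ENNReal.ofReal_le_ofReal (le_of_eq ?_)
    field_simp
    ring
  have hΞle : Ξ ≤ ENNReal.ofReal (D ^ (1 / p) * Mom ^ ((p - 1) / p)) := by
    have hk : 0 < p * l ^ (p - 1) := by positivity
    have h3 : p * D = p * l ^ (p - 1) * (D ^ (1 / p) * Mom ^ ((p - 1) / p)) := by
      rw [hl, ← rpow_mul (div_pos hD hMom).le, one_div_mul_eq_div, div_rpow hD.le hMom.le]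
      have h4 : Mom ^ ((p - 1) / p) ≠ 0 := by positivity
      have h5 : D ^ ((p - 1) / p) * D ^ (1 / p) = D := by
        rw [← rpow_add hD, ← add_div, sub_add_cancel, div_self hp0.ne', rpow_one]
      calc p * D = p * (D ^ ((p - 1) / p) * D ^ (1 / p)) := by rw [h5]
        _ = _ := by field_simp
    rw [h3, ENNReal.ofReal_mul hk.le] at h1
    exact (ENNReal.mul_le_mul_iff_right (ENNReal.ofReal_pos.2 hk).ne' ENNReal.ofReal_ne_top).1 h1
  have h2 := hmain.trans (add_le_add_right (mul_le_mul_right hΞle _) _)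
  have hq0 : 0 < α * (p - 1) + 1 := by positivity
  have hXfin := (lintegral_abs_rpow_lt_top huc hr₀ hsupp hq0).ne
  rw [← ENNReal.ofReal_mul (by positivity), ← ENNReal.ofReal_add (by positivity) (by positivity)]
    at h2
  have h3 := ENNReal.toReal_mono ENNReal.ofReal_ne_top h2
  rwa [ENNReal.toReal_mul, ENNReal.toReal_ofReal (by positivity),
    ENNReal.toReal_ofReal (by positivity)] at h3

end Comparison

section Constants

lemma le_of_forall_pos_le_rpow_add {e c₁ c₂ X : ℝ} (he : 0 < e) (h₁ : 0 < c₁) (h₂ : 0 < c₂)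
    (h : ∀ ρ, 0 < ρ → (1 + e) * X ≤ c₁ * ρ ^ (-e) + c₂ * ρ) :
    X ≤ c₁ ^ (1 / (1 + e)) * (c₂ / e) ^ (e / (1 + e)) := by
  have hc : 0 < c₁ * e / c₂ := by positivity
  set ρ := (c₁ * e / c₂) ^ (1 / (1 + e)) with hρ
  have hρ0 : 0 < ρ := rpow_pos_of_pos hc _
  have hpow : ρ ^ (1 + e) = c₁ * e / c₂ := by
    rw [hρ, ← rpow_mul hc.le, one_div_mul_cancel (by positivity), rpow_one]
  have h1 : c₁ * ρ ^ (-e) = c₂ / e * ρ := by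
    rw [rpow_neg hρ0.le]
    rw [rpow_add hρ0, rpow_one] at hpow
    have : ρ ^ e ≠ 0 := by positivity
    field_simp at hpow ⊢
    linarith
  have h2 : c₂ / e * ρ = c₁ ^ (1 / (1 + e)) * (c₂ / e) ^ (e / (1 + e)) := by
    have h3 : c₂ / e = (c₂ / e) ^ (1 / (1 + e)) * (c₂ / e) ^ (e / (1 + e)) := by
      rw [← rpow_add (by positivity), ← add_div, div_self (by positivity), rpow_one]
    rw [hρ, show c₁ * e / c₂ = c₁ / (c₂ / e) by field_simp, div_rpow h₁.le (by positivity)]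
    nth_rewrite 1 [h3]
    have : (c₂ / e) ^ (1 / (1 + e)) ≠ 0 := by positivity
    field_simp
  have h3 := h ρ hρ0
  have h4 : (1 + e) * X ≤ (1 + e) * (c₂ / e * ρ) := by
    rw [h1] at h3
    refine h3.trans (le_of_eq ?_)
    field_simp
  rw [← h2]
  exact le_of_mul_le_mul_left h4 (by linarith)

lemma rpow_le_gagliardoNirenbergConst {n : ℕ} (hn : 2 ≤ n) {p α D T X ω a s b κ : ℝ} (hp : 1 < p)
    (hα : 0 < α) (hα1 : α < 1) (hD : 0 < D) (hT : 0 < T) (hX : 0 ≤ X)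
    (hω : ω = √π ^ n / Gamma (n / 2 + 1)) (ha : a = n * (p - 1) / p) (hs : s = α * p / (1 - α))
    (hb : b = n * ω / (p / (p - 1)) * ProbabilityTheory.beta a (s + 1))
    (hκ : κ = (s + 1) / (a + (s + 1)))
    (h : ∀ ρ, 0 < ρ → (1 + n * ((1 - α) / (α * p))) * X ≤
      (T / (ρ ^ (n : ℝ) * b)) ^ (1 + (1 - α) / (α * p)) * (ρ ^ (n : ℝ) * b * κ) +
      (1 - α) / (α * p) * (α * (p - 1) + 1) *
        (D ^ (1 / p) * (ρ ^ (p / (p - 1)) * T * (1 - κ)) ^ ((p - 1) / p))) :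
    X ^ (1 / (α * (p - 1) + 1)) ≤ gagliardoNirenbergConst' n p α * D ^ (thetaGN' n p α / p) *
      T ^ ((1 - thetaGN' n p α) / (α * p)) := by
  have hn2 : (2:ℝ) ≤ n := by exact_mod_cast hn
  have hp0 : 0 < p := by linarith
  have hp1 : 0 < p - 1 := by linarith
  have hβ : 0 < 1 - α := by linarith
  have hγ : 0 < (1 - α) / (α * p) := by positivity
  set q := α * (p - 1) + 1 with hq
  have hq0 : 0 < q := by positivity
  set e := n * ((1 - α) / (α * p)) with he
  have he0 : 0 < e := by positivity
  have hpq : p - q = (1 - α) * (p - 1) := by rw [hq]; ring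
  have hpq0 : 0 < p - q := by rw [hpq]; positivity
  set δ := (n:ℝ) * p - (n - p) * q with hδ
  have hδeq : δ = n * (p - q) + p * q := by rw [hδ]; ring
  have hδ0 : 0 < δ := by rw [hδeq]; positivity
  set θ := thetaGN' n p α with hθ
  have hθe : θ = e / ((1 + e) * q) := by
    rw [hθ, thetaGN', he]
    rw [show α * p + 1 - α = q by rw [hq]; ring]
    have h1 : (n:ℝ) - α * (n - p) = n * (1 - α) + α * p := by ring
    have h2 : (0:ℝ) < n * (1 - α) + α * p := by positivity
    rw [h1]
    field_simp
    ring
  have hsβ : s + 1 = q * (p - 1) / (p - q) := by rw [hs, hpq, hq]; field_simp; ring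
  have has : a + (s + 1) = (p - 1) / p * (δ / (p - q)) := by
    rw [hsβ, ha, hδeq]; field_simp
  have ha0 : 0 < a := by rw [ha]; positivity
  have hs0 : 0 < s := by rw [hs]; positivity
  have hκe : κ = p * q / δ := by rw [hκ, has, hsβ]; field_simp
  have hκe' : 1 - κ = n * (p - q) / δ := by rw [hκe]; field_simp; linarith
  have hκ0 : 0 < κ := by rw [hκe]; positivity
  have hκ1 : 0 < 1 - κ := by rw [hκe']; positivity
  have hG1 : 0 < Gamma ((n:ℝ) / 2 + 1) := Gamma_pos_of_pos (by positivity)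
  have hω0 : 0 < ω := by rw [hω]; positivity
  have hB := ProbabilityTheory.beta_pos ha0 (show 0 < s + 1 by linarith)
  have hb0 : 0 < b := by rw [hb]; positivity
  set c₁ := T ^ (1 + (1 - α) / (α * p)) * b ^ (-((1 - α) / (α * p))) * κ with hc₁
  set c₂ := (1 - α) / (α * p) * q * (D ^ (1 / p) * (T * (1 - κ)) ^ ((p - 1) / p)) with hc₂
  have hc₁0 : 0 < c₁ := by positivity
  have hc₂0 : 0 < c₂ := by positivity
  have hopt := le_of_forall_pos_le_rpow_add he0 hc₁0 hc₂0 (X := X) (by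
    intro ρ hρ
    refine (h ρ hρ).trans (le_of_eq ?_)
    congr 1
    · rw [hc₁, div_rpow hT.le (by positivity), rpow_add (by positivity : 0 < ρ ^ (n:ℝ) * b), rpow_one,
        mul_rpow (by positivity) hb0.le, ← rpow_mul hρ.le, rpow_neg hb0.le, rpow_neg hρ.le, ← he]
      have h1 : ρ ^ e ≠ 0 := by positivity
      have h2 : b ^ ((1 - α) / (α * p)) ≠ 0 := by positivity
      field_simp
    · rw [hc₂, mul_assoc (ρ ^ _), mul_rpow (by positivity) (by positivity), ← rpow_mul hρ.le,
        show p / (p - 1) * ((p - 1) / p) = 1 by field_simp, rpow_one]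
      ring)
  refine (rpow_le_rpow hX hopt (by positivity)).trans (le_of_eq ?_)
  -- the remaining equality of positive constants
  have hG2 : 0 < Gamma ((p - 1) / p * (δ / (p - q)) + 1) := Gamma_pos_of_pos (by positivity)
  have hG3 : 0 < Gamma (q * (p - 1) / (p - q) + 1) := Gamma_pos_of_pos (by positivity)
  have hG4 : 0 < Gamma ((n:ℝ) * (p - 1) / p + 1) := Gamma_pos_of_pos (by positivity)
  set r := Gamma ((p - 1) / p * (δ / (p - q)) + 1) * Gamma ((n : ℝ) / 2 + 1) /
    (Gamma (q * (p - 1) / (p - q) + 1) * Gamma ((n : ℝ) * (p - 1) / p + 1)) with hr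
  have hr0 : 0 < r := by positivity
  have hbr : b = √π ^ n / (r * κ) := by
    have h1 : b * κ = n * ω / (p / (p - 1)) * ProbabilityTheory.beta a (s + 1 + 1) := by
      rw [beta_add_one_right ha0 (by linarith), hb, hκ]; ring
    have h2 : (n:ℝ) / (p / (p - 1)) = a := by rw [ha]; field_simp
    rw [ProbabilityTheory.beta, mul_div_right_comm, h2, ← add_assoc a, has, hsβ] at h1
    rw [eq_div_iff (by positivity), mul_left_comm, h1, hr, ← ha, Gamma_add_one ha0.ne', hω]
    have := (Gamma_pos_of_pos ha0).ne'
    field_simp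
  have hπ : 0 < √π := by positivity
  have hn0 : (0:ℝ) < n := by linarith
  have hLb : log b = n * log √π - log r - log κ := by
    rw [hbr, log_div (by positivity) (by positivity), log_pow, log_mul hr0.ne' hκ0.ne']; ring
  have hLκ : log κ = log p + log q - log δ := by
    rw [hκe, log_div (by positivity) hδ0.ne', log_mul hp0.ne' hq0.ne']
  have hLκ' : log (1 - κ) = log n + log (p - q) - log δ := by
    rw [hκe', log_div (by positivity) hδ0.ne', log_mul hn0.ne' hpq0.ne']
  have hc₂e : c₂ / e = q / n * (D ^ (1 / p) * (T * (1 - κ)) ^ ((p - 1) / p)) := by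
    rw [hc₂, he]; field_simp
  have hLc₁ : log c₁ = (1 + (1 - α) / (α * p)) * log T - (1 - α) / (α * p) * log b + log κ := by
    rw [hc₁, log_mul (by positivity) (by positivity), log_mul (by positivity) (by positivity),
      log_rpow hT, log_rpow hb0]; ring
  have hLc₂ : log (c₂ / e) = log q - log n + (1 / p * log D +
      (p - 1) / p * (log T + log (1 - κ))) := by
    rw [hc₂e, log_mul (by positivity) (by positivity), log_mul (by positivity) (by positivity),
      log_rpow hD, log_rpow (by positivity), log_mul hT.ne' hκ1.ne', log_div hq0.ne' hn0.ne']
  have hGN : gagliardoNirenbergConst' n p α = ((p - q) / (p * √π)) ^ θ *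
      (p * q / (n * (p - q))) ^ (θ / p) * (p * q / δ) ^ ((1 - θ) / (α * p)) * r ^ (θ / n) := rfl
  have hGN0 : 0 < gagliardoNirenbergConst' n p α := by rw [hGN]; positivity
  have hLGN : log (gagliardoNirenbergConst' n p α) = θ * (log (p - q) - (log p + log √π)) +
      θ / p * (log p + log q - (log n + log (p - q))) +
      (1 - θ) / (α * p) * (log p + log q - log δ) + θ / n * log r := by
    rw [hGN, log_mul (by positivity) (by positivity), log_mul (by positivity) (by positivity),
      log_mul (by positivity) (by positivity), log_rpow (by positivity), log_rpow (by positivity),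
      log_rpow (by positivity), log_rpow hr0, log_div hpq0.ne' (by positivity),
      log_div (by positivity) (by positivity), log_div (by positivity) hδ0.ne',
      log_mul hp0.ne' hπ.ne', log_mul hp0.ne' hq0.ne', log_mul hn0.ne' hpq0.ne']
  clear_value c₁ c₂
  refine log_injOn_pos (mem_Ioi.2 (by positivity)) (mem_Ioi.2 (by positivity)) ?_
  rw [log_rpow (by positivity), log_mul (by positivity) (by positivity), log_rpow hc₁0,
    log_rpow (by positivity), log_mul (mul_pos hGN0 (by positivity)).ne' (by positivity),
    log_mul hGN0.ne' (by positivity), log_rpow hD, log_rpow hT, hLGN, hLc₁, hLc₂, hLb, hLκ, hLκ']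
  have h1e : 1 + e ≠ 0 := by positivity
  have hα' : α = (q - 1) / (p - 1) := by rw [hq]; field_simp; ring
  rw [hθe]
  generalize log (p - q) = l1
  generalize log p = l2
  generalize log q = l3
  generalize log δ = l4
  generalize log r = l5
  generalize log √π = l6
  generalize log D = l7
  generalize log T = l8
  generalize log n = l9
  have hW : 0 < α * p + n * (1 - α) := by positivity
  have h1eW : 1 + e = (α * p + n * (1 - α)) / (α * p) := by rw [he]; field_simp
  rw [h1eW, he]
  set W := α * p + n * (1 - α) with hWd
  clear_value W
  clear_value q
  field_simp
  subst hWd hq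
  ring

end Constants

section Conclusion

variable {E : Type*} [NormedAddCommGroup E] [InnerProductSpace ℝ E] [FiniteDimensional ℝ E]
  [MeasurableSpace E] [BorelSpace E]

lemma setIntegral_mul_hypDensity {F : E → ℝ} (hF : Measurable F)
    (hF0 : ∀ x ∈ ball (0 : E) 1, 0 ≤ F x) :
    ∫ x in ball (0 : E) 1, F x * (2 / (1 - ‖x‖ ^ 2)) ^ (finrank ℝ E : ℝ) =
      (∫⁻ x, ENNReal.ofReal (F x) ∂hypVol).toReal := by
  have hd : ∀ x ∈ ball (0 : E) 1, 0 ≤ (2 / (1 - ‖x‖ ^ 2)) ^ finrank ℝ E := fun x hx => by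
    have := one_sub_norm_sq_pos hx
    positivity
  simp only [rpow_natCast]
  rw [integral_eq_lintegral_of_nonneg_ae
    (ae_restrict_of_forall_mem measurableSet_ball fun x hx => mul_nonneg (hF0 x hx) (hd x hx))
    (by fun_prop), hypVol, lintegral_withDensity_eq_lintegral_mul _ measurable_hypDensity
      hF.ennreal_ofReal]
  congr 1
  refine setLIntegral_congr_fun measurableSet_ball fun x hx => ?_
  simp only [Pi.mul_apply]
  rw [mul_comm, ENNReal.ofReal_mul (hd x hx)]

lemma eq_zero_of_hypVol_real_eq_zero {u : E → ℝ} (hu : Continuous u) {r₀ : ℝ} (hr₀ : r₀ < 1)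
    (hsupp : tsupport u ⊆ closedBall 0 r₀) (h : hypVol.real {x | 0 < |u x|} = 0) : u = 0 := by
  by_contra hne
  obtain ⟨x, hx⟩ := Function.ne_iff.1 hne
  have h1 := hypVol_setOf_ne_zero_lt_top hr₀ hsupp
  simp only [abs_pos] at h
  rw [measureReal_eq_zero_iff h1.ne] at h
  exact (volume_pos_of_isOpen (isOpen_ne_fun hu continuous_const)
    ⟨x, hx, closedBall_subset_ball hr₀ (hsupp (subset_tsupport u hx))⟩).ne' h

lemma lintegral_abs_rpow_pos {u : E → ℝ} (hu : Continuous u) {m : ℝ} (hS : 0 < hypVol.real {x | 0 < |u x|}) :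
    0 < ∫⁻ x, ENNReal.ofReal (|u x| ^ m) ∂hypVol := by
  have hm : Measurable fun x => ENNReal.ofReal (|u x| ^ m) :=
    (hu.abs.measurable.pow_const m).ennreal_ofReal
  rw [lintegral_pos_iff_support hm]
  refine (ENNReal.toReal_pos_iff.1 hS).1.trans_le (measure_mono fun x (hx : 0 < |u x|) => ?_)
  exact (ENNReal.ofReal_pos.2 (rpow_pos_of_pos hx m)).ne'

lemma lintegral_gradient_rpow_lt_top {u : E → ℝ} (hu : ContDiff ℝ 1 u) {r₀ : ℝ} (hr₀ : r₀ < 1)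
    (hsupp : tsupport u ⊆ closedBall 0 r₀) {p : ℝ} (hp : 0 < p) :
    ∫⁻ x, ENNReal.ofReal (((1 - ‖x‖ ^ 2) / 2 * ‖fderiv ℝ u x‖) ^ p) ∂hypVol < ∞ := by
  have hc : Continuous fun x => (1 - ‖x‖ ^ 2) / 2 * ‖fderiv ℝ u x‖ := by
    have := hu.continuous_fderiv one_ne_zero
    fun_prop
  have hs : tsupport (fun x => (1 - ‖x‖ ^ 2) / 2 * ‖fderiv ℝ u x‖) ⊆ closedBall 0 r₀ := by
    refine (closure_mono fun x hx => ?_).trans ((tsupport_fderiv_subset ℝ (f := u)).trans hsupp)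
    intro h0
    exact hx (by simp [h0])
  refine lt_of_eq_of_lt (lintegral_congr_ae ?_) (lintegral_abs_rpow_lt_top hc hr₀ hs hp)
  filter_upwards [ae_hypVol_mem_ball (E := E)] with x hx
  have := one_sub_norm_sq_pos hx
  rw [abs_of_nonneg (by positivity)]

lemma volume_real_ball_euclideanSpace (n : ℕ) (hn : 0 < n) :
    volume.real (ball (0 : EuclideanSpace ℝ (Fin n)) 1) = √π ^ n / Gamma (n / 2 + 1) := by
  have : Nonempty (Fin n) := ⟨⟨0, hn⟩⟩
  have := Gamma_pos_of_pos (show (0:ℝ) < n / 2 + 1 by positivity)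
  rw [measureReal_def, EuclideanSpace.volume_ball, ENNReal.ofReal_one, one_pow, one_mul,
    Fintype.card_fin, ENNReal.toReal_ofReal (by positivity)]

lemma thetaGN'_pos {n : ℕ} (hn : 0 < n) {p α : ℝ} (hp : 0 < p) (hα : 0 < α) (hα1 : α < 1) :
    0 < thetaGN' n p α := by
  have hn0 : (0:ℝ) < n := by exact_mod_cast hn
  have hβ : 0 < 1 - α := by linarith
  have h1 : 0 < α * p + 1 - α := by nlinarith
  have h2 : 0 < (n:ℝ) - α * (n - p) := by
    rw [show (n:ℝ) - α * (n - p) = n * (1 - α) + α * p by ring]; positivity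
  unfold thetaGN'
  positivity

lemma gagliardoNirenbergConst'_nonneg {n : ℕ} {p α : ℝ} (hp : 1 < p) (hα : 0 < α) (hα1 : α < 1) :
    0 ≤ gagliardoNirenbergConst' n p α := by
  have hβ : 0 < 1 - α := by linarith
  have hp1 : 0 < p - 1 := by linarith
  have hq : 0 < α * (p - 1) + 1 := by positivity
  have hpq : 0 < p - (α * (p - 1) + 1) := by
    rw [show p - (α * (p - 1) + 1) = (1 - α) * (p - 1) by ring]; positivity
  have hδ : 0 ≤ n * p - (n - p) * (α * (p - 1) + 1) := by
    rw [show n * p - (n - p) * (α * (p - 1) + 1) =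
      n * (p - (α * (p - 1) + 1)) + p * (α * (p - 1) + 1) by ring]
    positivity
  simp only [gagliardoNirenbergConst']
  have h1 := Gamma_nonneg_of_nonneg (show
    0 ≤ (p - 1) / p * ((n * p - (n - p) * (α * (p - 1) + 1)) / (p - (α * (p - 1) + 1))) + 1 by positivity)
  have h2 := Gamma_nonneg_of_nonneg (show (0:ℝ) ≤ n / 2 + 1 by positivity)
  have h3 := Gamma_nonneg_of_nonneg (show
    0 ≤ (α * (p - 1) + 1) * (p - 1) / (p - (α * (p - 1) + 1)) + 1 by positivity)
  have h4 := Gamma_nonneg_of_nonneg (show 0 ≤ n * (p - 1) / p + 1 by positivity)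
  positivity

end Conclusion

/-- The Poincaré–Gagliardo–Nirenberg inequality in `ℍⁿ`, case `0 < α < 1`. -/
theorem poincare_gagliardo_nirenberg_hyperbolic' (n : ℕ) (hn : 4 ≤ n) (p : ℝ)
    (hp1 : 2 * (n : ℝ) / ((n : ℝ) - 1) ≤ p) (hp2 : p < n)
    (α : ℝ) (hα1 : 0 < α) (hα2 : α < 1)
    (u : EuclideanSpace ℝ (Fin n) → ℝ) (hu : ContDiff ℝ (⊤ : ℕ∞) u)
    (hsupp : tsupport u ⊆ Metric.ball (0 : EuclideanSpace ℝ (Fin n)) 1) :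
    (∫ x in Metric.ball (0 : EuclideanSpace ℝ (Fin n)) 1,
        |u x| ^ (α * (p - 1) + 1) * (2 / (1 - ‖x‖ ^ 2)) ^ (n : ℝ)) ^ (1 / (α * (p - 1) + 1))
      ≤ gagliardoNirenbergConst' n p α *
        ((∫ x in Metric.ball (0 : EuclideanSpace ℝ (Fin n)) 1,
            ((1 - ‖x‖ ^ 2) / 2) ^ p * ‖fderiv ℝ u x‖ ^ p * (2 / (1 - ‖x‖ ^ 2)) ^ (n : ℝ))
          - (((n : ℝ) - 1) / p) ^ p *
            ∫ x in Metric.ball (0 : EuclideanSpace ℝ (Fin n)) 1,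
              |u x| ^ p * (2 / (1 - ‖x‖ ^ 2)) ^ (n : ℝ)) ^ (thetaGN' n p α / p) *
        (∫ x in Metric.ball (0 : EuclideanSpace ℝ (Fin n)) 1,
            |u x| ^ (α * p) * (2 / (1 - ‖x‖ ^ 2)) ^ (n : ℝ)) ^
          ((1 - thetaGN' n p α) / (α * p)) := by
  have hn4 : (4:ℝ) ≤ n := by exact_mod_cast hn
  have hp : 2 < p := by
    refine lt_of_lt_of_le ?_ hp1
    rw [lt_div_iff₀ (by linarith)]; linarith
  have hp0 : 0 < p := by linarith
  have hq0 : 0 < α * (p - 1) + 1 := by nlinarith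
  have hu1 : ContDiff ℝ 1 u := hu.of_le (by exact_mod_cast le_top)
  have huc := hu1.continuous
  obtain ⟨r₀, hr₀, hsub⟩ := exists_lt_subset_ball (isClosed_tsupport u) hsupp
  have hsupp' := hsub.trans ball_subset_closedBall
  have hfr : finrank ℝ (EuclideanSpace ℝ (Fin n)) = n := finrank_euclideanSpace_fin
  have hum : Measurable fun x => |u x| := huc.abs.measurable
  have hint : ∀ m : ℝ, ∫ x in ball (0 : EuclideanSpace ℝ (Fin n)) 1,
      |u x| ^ m * (2 / (1 - ‖x‖ ^ 2)) ^ (n : ℝ) =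
        (∫⁻ x, ENNReal.ofReal (|u x| ^ m) ∂hypVol).toReal := by
    intro m
    have h := setIntegral_mul_hypDensity (F := fun x => |u x| ^ m) (by fun_prop)
      (fun x _ => rpow_nonneg (abs_nonneg _) _)
    rwa [hfr] at h
  have hgrad : ∫ x in ball (0 : EuclideanSpace ℝ (Fin n)) 1,
      ((1 - ‖x‖ ^ 2) / 2) ^ p * ‖fderiv ℝ u x‖ ^ p * (2 / (1 - ‖x‖ ^ 2)) ^ (n : ℝ) =
        (∫⁻ x, ENNReal.ofReal (((1 - ‖x‖ ^ 2) / 2 * ‖fderiv ℝ u x‖) ^ p) ∂hypVol).toReal := by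
    have hm : Measurable fun x => ‖fderiv ℝ u x‖ :=
      (hu1.continuous_fderiv one_ne_zero).norm.measurable
    have h := setIntegral_mul_hypDensity
      (F := fun x => ((1 - ‖x‖ ^ 2) / 2 * ‖fderiv ℝ u x‖) ^ p) (by fun_prop) (fun x hx => by
        have := one_sub_norm_sq_pos hx
        positivity)
    rw [hfr] at h
    rw [← h]
    refine setIntegral_congr_fun measurableSet_ball fun x hx => ?_
    have := one_sub_norm_sq_pos hx
    rw [mul_rpow (by positivity) (norm_nonneg _)]
  rw [hint, hint, hint, hgrad]
  rcases (measureReal_nonneg (μ := hypVol) (s := {x | 0 < |u x|})).eq_or_lt with hS | hS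
  · have hzero := eq_zero_of_hypVol_real_eq_zero huc hr₀ hsupp' hS.symm
    have hα0 : α * p ≠ 0 := by positivity
    have hLHS : (∫⁻ x, ENNReal.ofReal (|u x| ^ (α * (p - 1) + 1))
        ∂(hypVol : Measure (EuclideanSpace ℝ (Fin n)))).toReal = 0 := by
      simp [hzero, zero_rpow hq0.ne']
    have hD0 : (∫⁻ x, ENNReal.ofReal (|u x| ^ p)
        ∂(hypVol : Measure (EuclideanSpace ℝ (Fin n)))).toReal = 0 := by
      simp [hzero, zero_rpow hp0.ne']
    rw [hLHS, hD0, zero_rpow (by positivity), mul_zero, sub_zero]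
    have := gagliardoNirenbergConst'_nonneg (n := n) (by linarith : 1 < p) hα1 hα2
    positivity
  set T := (∫⁻ x, ENNReal.ofReal (|u x| ^ (α * p))
    ∂(hypVol : Measure (EuclideanSpace ℝ (Fin n)))).toReal with hT
  set X := (∫⁻ x, ENNReal.ofReal (|u x| ^ (α * (p - 1) + 1))
    ∂(hypVol : Measure (EuclideanSpace ℝ (Fin n)))).toReal with hX
  set H := (∫⁻ x, ENNReal.ofReal (|u x| ^ p)
    ∂(hypVol : Measure (EuclideanSpace ℝ (Fin n)))).toReal with hH
  set G := (∫⁻ x, ENNReal.ofReal (((1 - ‖x‖ ^ 2) / 2 * ‖fderiv ℝ u x‖) ^ p)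
    ∂(hypVol : Measure (EuclideanSpace ℝ (Fin n)))).toReal with hG
  have hT0 : 0 < T := ENNReal.toReal_pos (lintegral_abs_rpow_pos huc hS).ne'
    (lintegral_abs_rpow_lt_top huc hr₀ hsupp' (by positivity)).ne
  have hX0 : 0 < X := ENNReal.toReal_pos (lintegral_abs_rpow_pos huc hS).ne'
    (lintegral_abs_rpow_lt_top huc hr₀ hsupp' hq0).ne
  have hc0 : 0 ≤ (((n:ℝ) - 1) / p) ^ p := rpow_nonneg (div_nonneg (by linarith) hp0.le) _
  set D := G - (((n:ℝ) - 1) / p) ^ p * H with hD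
  have hθ := thetaGN'_pos (by linarith : 0 < n) hp0 hα1 hα2
  have hbound : ∀ D', max D 0 < D' → X ^ (1 / (α * (p - 1) + 1)) ≤ gagliardoNirenbergConst' n p α *
      D' ^ (thetaGN' n p α / p) * T ^ ((1 - thetaGN' n p α) / (α * p)) := by
    intro D' hD'
    have hD0 : 0 < D' := (le_max_right _ _).trans_lt hD'
    refine rpow_le_gagliardoNirenbergConst (by linarith) (by linarith) hα1 hα2 hD0 hT0 hX0.le
      (volume_real_ball_euclideanSpace n (by linarith)) rfl rfl rfl rfl fun ρ hρ => ?_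
    have h := toReal_lintegral_le_of_energy_le hu1 hr₀ hsupp' (by rw [hfr]; linarith)
      (by rwa [hfr]) hα1 hα2 hS hD0 (by
        rw [hfr, ← ENNReal.ofReal_toReal (lintegral_gradient_rpow_lt_top hu1 hr₀ hsupp' hp0).ne,
          ← ENNReal.ofReal_toReal (lintegral_abs_rpow_lt_top huc hr₀ hsupp' hp0).ne, ← hG, ← hH,
          ← ENNReal.ofReal_mul hc0, ← ENNReal.ofReal_add (mul_nonneg hc0 ENNReal.toReal_nonneg) hD0.le]
        refine ENNReal.ofReal_le_ofReal ?_
        linarith [(le_max_left D 0).trans_lt hD']) hT hT0 rfl rfl rfl rfl hρ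
    rwa [hfr] at h
  have hlim : X ^ (1 / (α * (p - 1) + 1)) ≤ gagliardoNirenbergConst' n p α *
      max D 0 ^ (thetaGN' n p α / p) * T ^ ((1 - thetaGN' n p α) / (α * p)) := by
    have hcont : Continuous fun D' : ℝ => gagliardoNirenbergConst' n p α *
        D' ^ (thetaGN' n p α / p) * T ^ ((1 - thetaGN' n p α) / (α * p)) :=
      (continuous_const.mul (continuous_id.rpow_const fun _ => Or.inr (by positivity))).mul
        continuous_const
    exact ge_of_tendsto ((hcont.tendsto _).mono_left (nhdsWithin_le_nhds (s := Ioi (max D 0))))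
      (eventually_of_mem self_mem_nhdsWithin hbound)
  rcases le_or_gt D 0 with hneg | hpos
  · rw [max_eq_right hneg, zero_rpow (by positivity), mul_zero, zero_mul] at hlim
    exact absurd hlim (rpow_pos_of_pos hX0 _).not_ge
  · rwa [max_eq_left hpos.le] at hlim
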